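/- Let n ≥ 2 and suppose (1/p, 1/q) belongs to the interior of the region OCDA, and let s be given by 2s = n − (2/q + n/p). Then there is a constant C such that for every family {f_j} of functions orthonormal in Ḣ^s(ℝⁿ) and every sequence {λ_j} ∈ ℓ^q one has ‖ Σ_j λ_j |e^{itΔ}f_j|² ‖_{L^q(ℝ, L^p(ℝⁿ))} ≤ C ‖{λ_j}‖_{ℓ^q}. -/

import Mathlib

noncomputable section

open MeasureTheory ENNReal Real Set

namespace OS

/-- `ℝⁿ` as a Euclidean space. -/
abbrev Rn (n : ℕ) := EuclideanSpace ℝ (Fin n)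

/-- The real dot product `x·ξ`, viewed as a complex number. -/
def dotC {n : ℕ} (x ξ : Rn n) : ℂ := ((∑ i, x i * ξ i : ℝ) : ℂ)

/-- The Fourier transform `f̂(ξ) = ∫ f(x) e^{-i x·ξ} dx`. -/
def FT {n : ℕ} (f : Rn n → ℂ) (ξ : Rn n) : ℂ :=
  ∫ x : Rn n, Complex.exp (-(Complex.I * dotC x ξ)) * f x

/-- The propagator `e^{itΔ}` composed with a Fourier multiplier `m`:
`x ↦ (2π)^{-n} ∫ e^{i(x·ξ - t|ξ|²)} m(ξ) f̂(ξ) dξ`. -/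
def prop {n : ℕ} (m : Rn n → ℂ) (f : Rn n → ℂ) (t : ℝ) (x : Rn n) : ℂ :=
  ((2 * π : ℝ) ^ (-(n : ℝ)) : ℝ) •
    ∫ ξ : Rn n, Complex.exp (Complex.I * (dotC x ξ - (t : ℂ) * ((‖ξ‖ : ℝ) : ℂ) ^ 2)) *
      (m ξ * FT f ξ)

/-- The free Schrödinger propagator `e^{itΔ} f`, as a function of `(t, x)`. -/
def schrodinger {n : ℕ} (f : Rn n → ℂ) : ℝ → Rn n → ℂ := prop (fun _ => 1) f

/-- The Fourier multiplier `|ξ|^{-s} ψ(2^{-k}|ξ|)` of `(-Δ)^{-s/2} P_k`. -/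
def LPmult {n : ℕ} (s : ℝ) (ψ : ℝ → ℝ) (k : ℤ) (ξ : Rn n) : ℂ :=
  ((‖ξ‖ ^ (-s) * ψ ((2 : ℝ) ^ (-k) * ‖ξ‖) : ℝ) : ℂ)

/-- The Littlewood–Paley projection `P_k h`. -/
def LP {n : ℕ} (ψ : ℝ → ℝ) (k : ℤ) (h : Rn n → ℂ) (x : Rn n) : ℂ :=
  ((2 * π : ℝ) ^ (-(n : ℝ)) : ℝ) •
    ∫ ξ : Rn n, Complex.exp (Complex.I * dotC x ξ) *
      (((ψ ((2 : ℝ) ^ (-k) * ‖ξ‖) : ℝ) : ℂ) * FT h ξ)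

/-- The standing hypotheses on the Littlewood–Paley bump function `ψ`:
smooth, `[0,1]`-valued, supported in `[1/2,2]`, with `∑_{k∈ℤ} ψ(2^{-k} r) = 1` for `r ≠ 0`. -/
structure IsLPF (ψ : ℝ → ℝ) : Prop where
  smooth : ContDiff ℝ (⊤ : ℕ∞) ψ
  mem_Icc : ∀ r, ψ r ∈ Icc (0 : ℝ) 1
  supp : Function.support ψ ⊆ Icc (1 / 2 : ℝ) 2
  sum_one : ∀ r : ℝ, r ≠ 0 → ∑' k : ℤ, ψ ((2 : ℝ) ^ (-k) * r) = 1

/-- Orthonormality in `L²(ℝⁿ)`. -/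
def OrthonormalL2 {n : ℕ} (f : ℕ → Rn n → ℂ) : Prop :=
  ∀ j k, (∫ x : Rn n, f j x * (starRingEnd ℂ) (f k x)) = if j = k then 1 else 0

/-- Orthonormality in the homogeneous Sobolev space `Ḣ^s(ℝⁿ)`:
`(2π)^{-n} ∫ |ξ|^{2s} f̂_j(ξ) conj(f̂_k(ξ)) dξ = δ_{jk}`. -/
def OrthonormalHs {n : ℕ} (s : ℝ) (f : ℕ → Rn n → ℂ) : Prop :=
  ∀ j k, ((2 * π : ℝ) ^ (-(n : ℝ)) : ℝ) •
    (∫ ξ : Rn n, ((‖ξ‖ ^ (2 * s) : ℝ) : ℂ) * (FT (f j) ξ * (starRingEnd ℂ) (FT (f k) ξ)))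
      = if j = k then 1 else 0

/-- The density `Σ_j λ_j |u_j(t,x)|²` of a system of space-time functions. -/
def density2 {n : ℕ} (lam : ℕ → ℝ) (u : ℕ → ℝ → Rn n → ℂ) (t : ℝ) (x : Rn n) : ℝ :=
  ∑' j, lam j * ‖u j t x‖ ^ 2

/-- The density `Σ_j λ_j |e^{itΔ}f_j(x)|²`. -/
def density {n : ℕ} (lam : ℕ → ℝ) (f : ℕ → Rn n → ℂ) : ℝ → Rn n → ℝ :=
  density2 lam fun j => schrodinger (f j)

/-- The `L^q` norm (w.r.t. `μ`) of an `ℝ≥0∞`-valued function. -/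
def eLp {α : Type*} [MeasurableSpace α] (μ : Measure α) (q : ℝ≥0∞) (F : α → ℝ≥0∞) : ℝ≥0∞ :=
  if q = ∞ then essSup F μ
  else (∫⁻ t, F t ^ q.toReal ∂μ) ^ (1 / q.toReal)

/-- The Lorentz `L^{p,r}` (quasi)norm of an `ℝ≥0∞`-valued function, via the
distribution function.  For `r = ∞` this is the weak-`L^p` quasinorm
`sup_{s>0} s μ(G > s)^{1/p} = sup_{t>0} t^{1/p} G^*(t)`. -/
def lor {α : Type*} [MeasurableSpace α] (μ : Measure α) (p r : ℝ≥0∞) (G : α → ℝ≥0∞) : ℝ≥0∞ :=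
  if p = ∞ then essSup G μ
  else if r = ∞ then
    ⨆ (s : ℝ) (_ : 0 < s), ENNReal.ofReal s * μ {x | ENNReal.ofReal s < G x} ^ (1 / p.toReal)
  else
    (∫⁻ s in Ioi (0 : ℝ),
      (ENNReal.ofReal s * μ {x | ENNReal.ofReal s < G x} ^ (1 / p.toReal)) ^ r.toReal *
        (ENNReal.ofReal s)⁻¹) ^ (1 / r.toReal)

/-- The mixed norm `‖u‖_{L^q(ℝ, L^p(ℝⁿ))}`. -/
def mixedLp {n : ℕ} {E : Type*} [NormedAddCommGroup E] (q p : ℝ≥0∞)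
    (u : ℝ → Rn n → E) : ℝ≥0∞ :=
  eLp volume q fun t => eLpNorm (u t) p volume

/-- The mixed norm `‖u‖_{L^{q,∞}(ℝ, L^p(ℝⁿ))}` (weak in time). -/
def mixedWeakLp {n : ℕ} {E : Type*} [NormedAddCommGroup E] (q p : ℝ≥0∞)
    (u : ℝ → Rn n → E) : ℝ≥0∞ :=
  lor volume q ∞ fun t => eLpNorm (u t) p volume

/-- The weak `L^{p,∞}(ℝⁿ)` quasinorm. -/
def wLp {n : ℕ} {E : Type*} [NormedAddCommGroup E] (p : ℝ≥0∞) (g : Rn n → E) : ℝ≥0∞ :=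
  lor volume p ∞ fun x => (‖g x‖₊ : ℝ≥0∞)

/-- The mixed Lorentz norm `‖u‖_{L^{q,r}(ℝ, L^{p,r̃}(ℝⁿ))}`. -/
def mixedLorentz {n : ℕ} {E : Type*} [NormedAddCommGroup E] (q r p rt : ℝ≥0∞)
    (u : ℝ → Rn n → E) : ℝ≥0∞ :=
  lor volume q r fun t => lor volume p rt fun x => (‖u t x‖₊ : ℝ≥0∞)

/-- The `ℓ^a` norm of a sequence (with `ℓ^∞` the supremum norm). -/
def seqNormE (a : ℝ≥0∞) (lam : ℕ → ℝ) : ℝ≥0∞ :=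
  if a = ∞ then ⨆ j, ENNReal.ofReal |lam j|
  else (∑' j, ENNReal.ofReal |lam j| ^ a.toReal) ^ (1 / a.toReal)

/-- The decreasing rearrangement of a sequence: `seqRearr lam j` is the
`(j+1)`-th largest value of `|lam i|`. -/
def seqRearr (lam : ℕ → ℝ) (j : ℕ) : ℝ≥0∞ :=
  sInf {s : ℝ≥0∞ | Measure.count {i : ℕ | s < ENNReal.ofReal |lam i|} ≤ (j : ℝ≥0∞)}

/-- The Lorentz sequence norm `‖lam‖_{ℓ^{q,r}} = (Σ_j (j^{1/q} λ*_j)^r / j)^{1/r}`,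
parametrized by `qinv = 1/q` and a finite second exponent `r`. -/
def seqLor (qinv r : ℝ) (lam : ℕ → ℝ) : ℝ≥0∞ :=
  (∑' j : ℕ, (((j : ℝ≥0∞) + 1) ^ qinv * seqRearr lam j) ^ r * ((j : ℝ≥0∞) + 1)⁻¹) ^ (1 / r)

/-- The interior of the triangle `OAB`, in the coordinates `(a, b) = (1/p, 1/q)`. -/
def IntOAB (n : ℕ) (a b : ℝ) : Prop :=
  a ∈ Ioo (0 : ℝ) 1 ∧ b ∈ Ioo (0 : ℝ) 1 ∧ b < (n : ℝ) / (n - 1) * a ∧ 2 * b + n * a < n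

/-- The interior of the quadrilateral `OCDA`, in the coordinates `(a, b) = (1/p, 1/q)`. -/
def IntOCDA (n : ℕ) (a b : ℝ) : Prop :=
  a ∈ Ioo (0 : ℝ) 1 ∧ b ∈ Ioo (0 : ℝ) 1 ∧ (n : ℝ) / (n - 1) * a < b ∧ 2 * b + n * a < n

def ptO : ℝ × ℝ := (0, 0)
def ptA (n : ℕ) : ℝ × ℝ := (((n : ℝ) - 1) / (n + 1), (n : ℝ) / (n + 1))
def ptB : ℝ × ℝ := (1, 0)
def ptC : ℝ × ℝ := (0, 1)
def ptD (n : ℕ) : ℝ × ℝ := (((n : ℝ) - 2) / n, 1)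

/-- The closed triangle `OAB`. -/
def OAB (n : ℕ) : Set (ℝ × ℝ) := convexHull ℝ {ptO, ptA n, ptB}

/-- The closed quadrilateral `OCDA`. -/
def OCDA (n : ℕ) : Set (ℝ × ℝ) := convexHull ℝ {ptO, ptC, ptD n, ptA n}

/-- The half-open segment `[A, D)`. -/
def segAD (n : ℕ) : Set (ℝ × ℝ) := {x | ∃ t ∈ Ico (0 : ℝ) 1, x = (1 - t) • ptA n + t • ptD n}

/-- The Lebesgue exponent with reciprocal `a` (so `expOf 0 = ∞`). -/
def expOf (a : ℝ) : ℝ≥0∞ := (ENNReal.ofReal a)⁻¹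

/-- The weighted velocity average `∫ f(x - tv, v) |v|^{-2s} dv` of the solution of
the kinetic transport equation with datum `f`. -/
def velAvg {n : ℕ} (s : ℝ) (f : Rn n × Rn n → ℂ) (t : ℝ) (x : Rn n) : ℂ :=
  ∫ v : Rn n, ((‖v‖ ^ (-(2 * s)) : ℝ) : ℂ) * f (x - t • v, v)

end OS

namespace OS

open scoped ComplexConjugate InnerProductSpace

section tt_star

/-- Cauchy–Schwarz for real integrals of nonnegative functions. -/
theorem integral_mul_le_sqrt_mul_sqrt {α : Type*} [MeasurableSpace α] {μ : Measure α}
    {f g : α → ℝ} (hf0 : ∀ x, 0 ≤ f x) (hg0 : ∀ x, 0 ≤ g x)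
    (hf : MemLp f 2 μ) (hg : MemLp g 2 μ) :
    ∫ x, f x * g x ∂μ ≤ √(∫ x, f x ^ 2 ∂μ) * √(∫ x, g x ^ 2 ∂μ) := by
  have h := integral_mul_le_Lp_mul_Lq_of_nonneg (μ := μ) Real.HolderConjugate.two_two
    (Filter.Eventually.of_forall hf0) (Filter.Eventually.of_forall hg0)
    (by simpa using hf) (by simpa using hg)
  simpa [Real.sqrt_eq_rpow] using h

/-- A bounded strongly measurable function supported in a set of finite measure is integrable. -/
theorem integrable_of_bdd_support {Z G : Type*} [MeasurableSpace Z] [NormedAddCommGroup G]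
    {μ : Measure Z} {f : Z → G} (hf : AEStronglyMeasurable f μ) {E : Set Z}
    (hμE : μ E ≠ ∞) (M : ℝ) (hM : ∀ z, ‖f z‖ ≤ M) (h0 : ∀ z ∉ E, f z = 0) :
    Integrable f μ := by
  have h1 : IntegrableOn f E μ :=
    Measure.integrableOn_of_bounded hμE hf (Filter.Eventually.of_forall hM)
  exact h1.integrable_of_forall_notMem_eq_zero h0

theorem sum_norm_sq_rotate {ι H : Type*} [Fintype ι] [DecidableEq ι] [NormedAddCommGroup H]
    [InnerProductSpace ℂ H] (U : Matrix ι ι ℂ) (hU : U * star U = 1) (h : ι → H) :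
    ∑ i, ‖∑ j, U j i • h j‖ ^ 2 = ∑ j, ‖h j‖ ^ 2 := by
  have key : (∑ i, inner ℂ (∑ j, U j i • h j) (∑ j, U j i • h j) : ℂ) =
      ∑ j, inner ℂ (h j) (h j) := by
    simp_rw [sum_inner, inner_sum, inner_smul_left, inner_smul_right]
    rw [Finset.sum_comm]
    refine Finset.sum_congr rfl fun j _ => ?_
    rw [Finset.sum_comm]
    have : ∀ k, ∑ i, conj (U j i) * (U k i * inner ℂ (h j) (h k)) =
        (if k = j then 1 else 0) * inner ℂ (h j) (h k) := by
      intro k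
      have := congrFun (congrFun hU k) j
      rw [Matrix.mul_apply, Matrix.one_apply] at this
      rw [← this, Finset.sum_mul]
      refine Finset.sum_congr rfl fun i _ => ?_
      simp [Matrix.star_apply]
      ring
    simp_rw [this]
    simp
  have := congrArg Complex.re key
  simpa [← inner_self_eq_norm_sq (𝕜 := ℂ)] using this

variable {Z H ι : Type*} [MeasurableSpace Z] [NormedAddCommGroup H] [InnerProductSpace ℂ H]
  [CompleteSpace H] [Fintype ι]

/-- Ky Fan type bound for the trace of the compression of a Gram kernel, orthogonal case. -/
theorem sum_integral_inner_sq_le_of_orthogonal (μ : Measure Z) [SFinite μ] (e : Z → H)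
    (he : StronglyMeasurable e) (E : Set Z) (hμE : μ E ≠ ∞) (b : ℝ)
    (heb : ∀ z, ‖e z‖ ≤ b) (heE : ∀ z ∉ E, e z = 0)
    (h : ι → H) (hB : ∀ i, ‖h i‖ ≤ 1) (N : ℝ) (hN : ∑ j, ‖h j‖ ^ 2 ≤ N)
    (F : Set (Z × Z)) (hF : MeasurableSet F) (α β : ℝ) (hα : 0 ≤ α) (hβ : 0 ≤ β)
    (near : ∀ φ : Z → ℂ, StronglyMeasurable φ → (∃ M, ∀ z, ‖φ z‖ ≤ M) → (∀ z ∉ E, φ z = 0) →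
      ‖∫ w in Fᶜ, conj (φ w.1) * φ w.2 * inner ℂ (e w.1) (e w.2) ∂(μ.prod μ)‖
        ≤ α * ∫ z, ‖φ z‖ ^ 2 ∂μ)
    (far : ∫ w in F, ‖inner ℂ (e w.1) (e w.2)‖ ^ 2 ∂(μ.prod μ) ≤ β ^ 2)
    (orth : ∀ i j, i ≠ j → ∫ z, conj (inner ℂ (e z) (h i)) * inner ℂ (e z) (h j) ∂μ = 0) :
    ∑ j, ∫ z, ‖inner ℂ (e z) (h j)‖ ^ 2 ∂μ ≤ N * α + √N * β := by
  classical
  have hb0 : ∀ z, 0 ≤ b := fun z => (norm_nonneg _).trans (heb z)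
  set ψ : ι → Z → ℂ := fun i z => inner ℂ (e z) (h i) with hψ
  have hψm : ∀ i, StronglyMeasurable (ψ i) := fun i => he.inner stronglyMeasurable_const
  have hψb : ∀ i z, ‖ψ i z‖ ≤ b := fun i z =>
    (norm_inner_le_norm _ _).trans ((mul_le_mul (heb z) (hB i) (norm_nonneg _) (hb0 z)).trans
      (by simp))
  have hψ0 : ∀ i, ∀ z ∉ E, ψ i z = 0 := fun i z hz => by simp [hψ, heE z hz]
  set Λ : ι → ℝ := fun i => ∫ z, ‖ψ i z‖ ^ 2 ∂μ with hΛ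
  have hΛ0 : ∀ i, 0 ≤ Λ i := fun i => integral_nonneg fun z => by positivity
  have hEE : (μ.prod μ) (E ×ˢ E) ≠ ∞ := by
    rw [Measure.prod_prod]; exact ENNReal.mul_ne_top hμE hμE
  -- Gram kernel
  set K : Z × Z → ℂ := fun w => inner ℂ (e w.1) (e w.2) with hK
  have hKm : StronglyMeasurable K :=
    (he.comp_measurable measurable_fst).inner (he.comp_measurable measurable_snd)
  have hKb : ∀ w, ‖K w‖ ≤ b * b := fun w =>
    (norm_inner_le_norm _ _).trans (mul_le_mul (heb _) (heb _) (norm_nonneg _) (hb0 w.1))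
  have hψ1m : ∀ i, StronglyMeasurable (fun w : Z × Z => conj (ψ i w.1)) := fun i =>
    Complex.continuous_conj.comp_stronglyMeasurable ((hψm i).comp_measurable measurable_fst)
  have hψ2m : ∀ i, StronglyMeasurable (fun w : Z × Z => ψ i w.2) := fun i =>
    (hψm i).comp_measurable measurable_snd
  have hnotmem : ∀ w : Z × Z, w ∉ E ×ˢ E → w.1 ∉ E ∨ w.2 ∉ E := fun w hw => by
    by_contra! h'; exact hw ⟨h'.1, h'.2⟩
  have hkint : ∀ i, Integrable (fun w : Z × Z => conj (ψ i w.1) * ψ i w.2 * K w) (μ.prod μ) := by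
    intro i
    refine integrable_of_bdd_support
      (((hψ1m i).mul (hψ2m i)).mul hKm).aestronglyMeasurable hEE (b * b * (b * b)) ?_ ?_
    · intro w
      rw [norm_mul, norm_mul, RCLike.norm_conj]
      have := hb0 w.1
      gcongr
      exacts [hψb _ _, hψb _ _, hKb _]
    · intro w hw
      rcases hnotmem w hw with h' | h'
      · simp [hψ0 i _ h']
      · simp [hψ0 i _ h']
  have hΨint : ∀ i, Integrable (fun z => ψ i z • e z) μ := fun i =>
    integrable_of_bdd_support ((hψm i).smul he).aestronglyMeasurable hμE (b * b)
      (fun z => by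
        rw [norm_smul]; exact mul_le_mul (hψb _ _) (heb _) (norm_nonneg _) (hb0 z))
      (fun z hz => by simp [heE z hz])
  have hsqint : ∀ i, Integrable (fun z => ‖ψ i z‖ ^ 2) μ := fun i =>
    integrable_of_bdd_support ((hψm i).norm.pow 2).aestronglyMeasurable hμE (b ^ 2)
      (fun z => by
        rw [norm_pow, norm_norm]
        exact pow_le_pow_left₀ (norm_nonneg _) (hψb _ _) 2)
      (fun z hz => by simp [hψ0 i z hz])
  have hΨsq : ∀ i, ((‖∫ z, ψ i z • e z ∂μ‖ ^ 2 : ℝ) : ℂ) =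
      ∫ w, conj (ψ i w.1) * ψ i w.2 * K w ∂(μ.prod μ) := by
    intro i
    rw [integral_prod _ (hkint i)]
    have h1 : ∀ z, ∫ z', conj (ψ i z) * ψ i z' * K (z, z') ∂μ =
        conj (ψ i z) * inner ℂ (e z) (∫ z, ψ i z • e z ∂μ) := by
      intro z
      rw [← integral_inner (hΨint i), ← integral_const_mul]
      refine integral_congr_ae (Filter.Eventually.of_forall fun z' => ?_)
      simp only [hK, inner_smul_right]; ring
    simp_rw [h1]
    set Ψ := ∫ z, ψ i z • e z ∂μ
    have h2 : ∀ z, conj (ψ i z) * inner ℂ (e z) Ψ = conj (inner ℂ Ψ (ψ i z • e z)) := by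
      intro z
      rw [inner_smul_right, map_mul]
      congr 1
      exact (inner_conj_symm _ _).symm
    simp_rw [h2]
    rw [integral_conj, integral_inner (hΨint i)]
    simp only [Ψ]
    rw [inner_self_eq_norm_sq_to_K]
    norm_cast
    simp
  have hΛΨ : ∀ i, Λ i ^ 2 ≤ ‖h i‖ ^ 2 * ‖∫ z, ψ i z • e z ∂μ‖ ^ 2 := by
    intro i
    have h1 : (Λ i : ℂ) = inner ℂ (∫ z, ψ i z • e z ∂μ) (h i) := by
      rw [← inner_conj_symm, ← integral_inner (hΨint i), ← integral_conj, hΛ]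
      simp only
      rw [← integral_complex_ofReal]
      refine integral_congr_ae (Filter.Eventually.of_forall fun z => ?_)
      have h3 : conj (inner ℂ (h i) (ψ i z • e z)) = conj (ψ i z) * ψ i z := by
        rw [inner_smul_right, map_mul]
        congr 1
        exact inner_conj_symm _ _
      simp only [h3]
      rw [Complex.conj_mul']; push_cast; rfl
    have h2 : |Λ i| ≤ ‖∫ z, ψ i z • e z ∂μ‖ * ‖h i‖ := by
      rw [← Real.norm_eq_abs, ← Complex.norm_real, h1]
      exact norm_inner_le_norm _ _
    calc Λ i ^ 2 = |Λ i| ^ 2 := (sq_abs _).symm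
      _ ≤ (‖∫ z, ψ i z • e z ∂μ‖ * ‖h i‖) ^ 2 := by gcongr
      _ = _ := by ring
  set c : ι → ℝ := fun i => ‖h i‖ ^ 2 / Λ i with hc
  have hstep : ∀ i, Λ i ≤ ‖h i‖ ^ 2 * α +
      (c i * ∫ w in F, conj (ψ i w.1) * ψ i w.2 * K w ∂(μ.prod μ) : ℂ).re := by
    intro i
    have hn := near (ψ i) (hψm i) ⟨b, hψb i⟩ (hψ0 i)
    have hsplit := integral_add_compl hF (hkint i)
    have h1 : ‖∫ z, ψ i z • e z ∂μ‖ ^ 2 =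
        (∫ w in F, conj (ψ i w.1) * ψ i w.2 * K w ∂(μ.prod μ)).re +
        (∫ w in Fᶜ, conj (ψ i w.1) * ψ i w.2 * K w ∂(μ.prod μ)).re := by
      rw [← Complex.add_re, hsplit, ← hΨsq i, Complex.ofReal_re]
    have h2 := (Complex.re_le_norm _).trans hn
    have h3 := hΛΨ i
    rw [Complex.re_ofReal_mul]
    rcases (hΛ0 i).eq_or_lt with h0 | h0
    · simp only [hc, ← h0, _root_.div_zero, zero_mul, add_zero]; positivity
    · simp only [hc]
      rw [div_mul_eq_mul_div]
      refine le_of_mul_le_mul_right ?_ h0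
      rw [add_mul, div_mul_cancel₀ _ h0.ne']
      calc Λ i * Λ i = Λ i ^ 2 := by ring
        _ ≤ _ := h3
        _ ≤ ‖h i‖ ^ 2 * ((∫ w in F, conj (ψ i w.1) * ψ i w.2 * K w ∂(μ.prod μ)).re
              + α * Λ i) := by rw [h1]; gcongr
        _ = _ := by ring
  set S : Z × Z → ℂ := fun w => ∑ i, (c i : ℂ) * (conj (ψ i w.1) * ψ i w.2) with hS
  have hprodb : ∀ i (w : Z × Z), ‖conj (ψ i w.1) * ψ i w.2‖ ≤ b * b := fun i w => by
    rw [norm_mul, RCLike.norm_conj]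
    exact mul_le_mul (hψb _ _) (hψb _ _) (norm_nonneg _) (hb0 w.1)
  have hSm : StronglyMeasurable S := by
    have : S = ∑ i, fun w => (c i : ℂ) * (conj (ψ i w.1) * ψ i w.2) := by
      ext w; simp [hS]
    rw [this]
    exact Finset.stronglyMeasurable_sum _ fun i _ =>
      ((hψ1m i).mul (hψ2m i)).const_mul (c i : ℂ)
  have hSb : ∀ w, ‖S w‖ ≤ ∑ i, |c i| * (b * b) := fun w => by
    refine (norm_sum_le _ _).trans (Finset.sum_le_sum fun i _ => ?_)
    rw [norm_mul, Complex.norm_real, Real.norm_eq_abs]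
    gcongr; exact hprodb i w
  have hS0 : ∀ w ∉ E ×ˢ E, S w = 0 := fun w hw => by
    refine Finset.sum_eq_zero fun i _ => ?_
    rcases hnotmem w hw with h' | h'
    · simp [hψ0 i _ h']
    · simp [hψ0 i _ h']
  have hK0 : ∀ w ∉ E ×ˢ E, K w = 0 := fun w hw => by
    rcases hnotmem w hw with h' | h' <;> simp [hK, heE _ h']
  have hsumF : ∑ i, (c i : ℂ) * ∫ w in F, conj (ψ i w.1) * ψ i w.2 * K w ∂(μ.prod μ) =
      ∫ w in F, K w * S w ∂(μ.prod μ) := by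
    simp_rw [← integral_const_mul]
    rw [← integral_finsetSum]
    · refine integral_congr_ae (Filter.Eventually.of_forall fun w => ?_)
      simp only [hS, Finset.mul_sum]
      exact Finset.sum_congr rfl fun i _ => by ring
    · exact fun i _ => ((hkint i).integrableOn).const_mul _
  have hKL : MemLp (fun w => ‖K w‖) 2 ((μ.prod μ).restrict F) := by
    refine (MemLp.restrict F ?_)
    rw [memLp_two_iff_integrable_sq hKm.norm.aestronglyMeasurable]
    exact integrable_of_bdd_support (hKm.norm.pow 2).aestronglyMeasurable hEE ((b * b) ^ 2)
      (fun w => by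
        rw [norm_pow, norm_norm]; exact pow_le_pow_left₀ (norm_nonneg _) (hKb w) 2)
      (fun w hw => by simp [hK0 w hw])
  have hSint : Integrable (fun w => ‖S w‖ ^ 2) (μ.prod μ) :=
    integrable_of_bdd_support (hSm.norm.pow 2).aestronglyMeasurable hEE _
      (fun w => by
        rw [norm_pow, norm_norm]; exact pow_le_pow_left₀ (norm_nonneg _) (hSb w) 2)
      (fun w hw => by simp [hS0 w hw])
  have hSL : MemLp (fun w => ‖S w‖) 2 ((μ.prod μ).restrict F) := by
    refine (MemLp.restrict F ?_)
    rw [memLp_two_iff_integrable_sq hSm.norm.aestronglyMeasurable]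
    exact hSint
  have hov : ∀ i j, ∫ z, conj (ψ i z) * ψ j z ∂μ = if i = j then (Λ i : ℂ) else 0 := by
    intro i j
    split_ifs with hij
    · subst hij
      simp only [hΛ]
      rw [← integral_complex_ofReal]
      refine integral_congr_ae (Filter.Eventually.of_forall fun z => ?_)
      simp only []
      rw [Complex.conj_mul']; push_cast; rfl
    · exact orth i j hij
  have hpint : ∀ i j, Integrable (fun w : Z × Z =>
      ((conj (ψ i w.1) * ψ j w.1) * conj (conj (ψ i w.2) * ψ j w.2))) (μ.prod μ) := by
    intro i j
    have h1 : Integrable (fun z => conj (ψ i z) * ψ j z) μ := by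
      refine integrable_of_bdd_support
        ((Complex.continuous_conj.comp_stronglyMeasurable (hψm i)).mul
          (hψm j)).aestronglyMeasurable hμE (b * b) ?_ ?_
      · intro z
        rw [norm_mul, RCLike.norm_conj]
        exact mul_le_mul (hψb _ _) (hψb _ _) (norm_nonneg _) (hb0 z)
      · intro z hz; simp [hψ0 i z hz]
    exact h1.mul_prod ((Complex.conjLIE.toContinuousLinearEquiv :
      ℂ →L[ℝ] ℂ).integrable_comp h1)
  have hSsq : ∫ w, ‖S w‖ ^ 2 ∂(μ.prod μ) ≤ N := by
    have h1 : ((∫ w, ‖S w‖ ^ 2 ∂(μ.prod μ) : ℝ) : ℂ) = ∑ i, ((c i * Λ i) ^ 2 : ℝ) := by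
      rw [← integral_complex_ofReal]
      have h2 : ∀ w, ((‖S w‖ ^ 2 : ℝ) : ℂ) = ∑ i, ∑ j, ((c i : ℂ) * (c j : ℂ)) *
          ((conj (ψ i w.1) * ψ j w.1) * conj (conj (ψ i w.2) * ψ j w.2)) := by
        intro w
        push_cast
        rw [← Complex.mul_conj', hS, map_sum, Finset.sum_mul_sum]
        refine Finset.sum_congr rfl fun i _ => Finset.sum_congr rfl fun j _ => ?_
        simp only [map_mul, Complex.conj_conj, Complex.conj_ofReal]
        ring
      simp_rw [h2]
      rw [integral_finsetSum _ fun i _ => integrable_finsetSum _ fun j _ => (hpint i j).const_mul _]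
      refine Eq.trans (Finset.sum_congr rfl fun i _ => ?_) (Complex.ofReal_sum _ _).symm
      rw [integral_finsetSum _ fun j _ => (hpint i j).const_mul _]
      simp_rw [integral_const_mul]
      have h3 : ∀ j, ∫ w : Z × Z, ((conj (ψ i w.1) * ψ j w.1) *
          conj (conj (ψ i w.2) * ψ j w.2)) ∂(μ.prod μ) = if i = j then (Λ i : ℂ) ^ 2 else 0 := by
        intro j
        rw [integral_prod_mul (fun z => conj (ψ i z) * ψ j z)
          (fun z => conj (conj (ψ i z) * ψ j z)), integral_conj, hov i j]
        split_ifs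
        · rw [Complex.conj_ofReal]; ring
        · simp
      simp_rw [h3]
      simp only [mul_ite, mul_zero, Finset.sum_ite_eq, Finset.mem_univ, if_true]
      push_cast; ring
    have h1' : ∫ w, ‖S w‖ ^ 2 ∂(μ.prod μ) = ∑ i, (c i * Λ i) ^ 2 := by exact_mod_cast h1
    rw [h1']
    refine (Finset.sum_le_sum fun i _ => ?_).trans hN
    rcases (hΛ0 i).eq_or_lt with h0 | h0
    · rw [← h0]; simp
    · simp only [hc]
      rw [div_mul_cancel₀ _ h0.ne']
      have := hB i
      have h5 : ‖h i‖ ^ 2 ≤ 1 := pow_le_one₀ (norm_nonneg _) this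
      calc (‖h i‖ ^ 2) ^ 2 = ‖h i‖ ^ 2 * ‖h i‖ ^ 2 := by ring
        _ ≤ ‖h i‖ ^ 2 * 1 := by gcongr
        _ = _ := mul_one _
  calc ∑ j, Λ j ≤ ∑ i, (‖h i‖ ^ 2 * α +
      (c i * ∫ w in F, conj (ψ i w.1) * ψ i w.2 * K w ∂(μ.prod μ) : ℂ).re) :=
        Finset.sum_le_sum fun i _ => hstep i
    _ = (∑ i, ‖h i‖ ^ 2) * α + (∫ w in F, K w * S w ∂(μ.prod μ)).re := by
        rw [Finset.sum_add_distrib, Finset.sum_mul, ← hsumF, Complex.re_sum]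
    _ ≤ N * α + √N * β := by
        gcongr
        calc (∫ w in F, K w * S w ∂(μ.prod μ)).re ≤ ‖∫ w in F, K w * S w ∂(μ.prod μ)‖ :=
              Complex.re_le_norm _
          _ ≤ ∫ w in F, ‖K w * S w‖ ∂(μ.prod μ) := norm_integral_le_integral_norm _
          _ = ∫ w in F, ‖K w‖ * ‖S w‖ ∂(μ.prod μ) := by simp_rw [norm_mul]
          _ ≤ √(∫ w in F, ‖K w‖ ^ 2 ∂(μ.prod μ)) * √(∫ w in F, ‖S w‖ ^ 2 ∂(μ.prod μ)) :=
              integral_mul_le_sqrt_mul_sqrt (fun _ => norm_nonneg _) (fun _ => norm_nonneg _)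
                hKL hSL
          _ ≤ β * √N := by
              gcongr
              · exact (Real.sqrt_le_sqrt far).trans_eq (Real.sqrt_sq hβ)
              · exact (setIntegral_le_integral hSint
                  (Filter.Eventually.of_forall fun w => by positivity)).trans hSsq
          _ = _ := mul_comm _ _

/-- Ky Fan type bound for the trace of the compression of a Gram kernel. -/
theorem sum_integral_inner_sq_le (μ : Measure Z) [SFinite μ] (e : Z → H)
    (he : StronglyMeasurable e) (E : Set Z) (hμE : μ E ≠ ∞) (b : ℝ)
    (heb : ∀ z, ‖e z‖ ≤ b) (heE : ∀ z ∉ E, e z = 0)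
    (h : ι → H) (hB : ∀ c : ι → ℂ, ‖∑ j, c j • h j‖ ^ 2 ≤ ∑ j, ‖c j‖ ^ 2)
    (N : ℝ) (hN : ∑ j, ‖h j‖ ^ 2 ≤ N)
    (F : Set (Z × Z)) (hF : MeasurableSet F) (α β : ℝ) (hα : 0 ≤ α) (hβ : 0 ≤ β)
    (near : ∀ φ : Z → ℂ, StronglyMeasurable φ → (∃ M, ∀ z, ‖φ z‖ ≤ M) → (∀ z ∉ E, φ z = 0) →
      ‖∫ w in Fᶜ, conj (φ w.1) * φ w.2 * inner ℂ (e w.1) (e w.2) ∂(μ.prod μ)‖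
        ≤ α * ∫ z, ‖φ z‖ ^ 2 ∂μ)
    (far : ∫ w in F, ‖inner ℂ (e w.1) (e w.2)‖ ^ 2 ∂(μ.prod μ) ≤ β ^ 2) :
    ∑ j, ∫ z, ‖inner ℂ (e z) (h j)‖ ^ 2 ∂μ ≤ N * α + √N * β := by
  classical
  have hm : ∀ v : H, StronglyMeasurable (fun z => inner ℂ (e z) v) := fun v =>
    he.inner stronglyMeasurable_const
  have hb : ∀ (v : H) z, ‖inner ℂ (e z) v‖ ≤ b * ‖v‖ := fun v z =>
    (norm_inner_le_norm _ _).trans (by gcongr; exact heb z)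
  have hinn : ∀ v w : H, Integrable (fun z => conj (inner ℂ (e z) v) * inner ℂ (e z) w) μ := by
    intro v w
    refine integrable_of_bdd_support
      ((Complex.continuous_conj.comp_stronglyMeasurable (hm v)).mul (hm w)).aestronglyMeasurable
      hμE (b * ‖v‖ * (b * ‖w‖)) (fun z => ?_) (fun z hz => by simp [heE z hz])
    rw [norm_mul, RCLike.norm_conj]
    exact mul_le_mul (hb v z) (hb w z) (norm_nonneg _) ((norm_nonneg _).trans (hb v z))
  have hinn2 : ∀ v : H, Integrable (fun z => ‖inner ℂ (e z) v‖ ^ 2) μ := by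
    intro v
    refine integrable_of_bdd_support ((hm v).norm.pow 2).aestronglyMeasurable
      hμE ((b * ‖v‖) ^ 2) (fun z => ?_) (fun z hz => by simp [heE z hz])
    rw [norm_pow, norm_norm]
    exact pow_le_pow_left₀ (norm_nonneg _) (hb v z) 2
  set G : Matrix ι ι ℂ := fun i j => ∫ z, conj (inner ℂ (e z) (h i)) * inner ℂ (e z) (h j) ∂μ
    with hG
  have hGh : G.IsHermitian := by
    ext i j
    change conj (G j i) = G i j
    simp only [hG]
    rw [← integral_conj]
    refine integral_congr_ae (Filter.Eventually.of_forall fun z => ?_)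
    simp only [map_mul, Complex.conj_conj]; ring
  set U : Matrix ι ι ℂ := (hGh.eigenvectorUnitary : Matrix ι ι ℂ) with hU
  have hUU : U * star U = 1 := Unitary.mul_star_self_of_mem hGh.eigenvectorUnitary.2
  have hUU' : star U * U = 1 := Unitary.star_mul_self_of_mem hGh.eigenvectorUnitary.2
  have hdiag : star U * G * U = Matrix.diagonal (RCLike.ofReal ∘ hGh.eigenvalues) := by
    have := hGh.conjStarAlgAut_star_eigenvectorUnitary
    simpa [Unitary.conjStarAlgAut_apply] using this
  set k : ι → H := fun i => ∑ j, U j i • h j with hk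
  have hinner : ∀ z i, inner ℂ (e z) (k i) = ∑ j, U j i • (inner ℂ (e z) (h j) : ℂ) := by
    intro z i
    simp only [hk, inner_sum, inner_smul_right, smul_eq_mul]
  have hsum : ∑ j, ∫ z, ‖inner ℂ (e z) (h j)‖ ^ 2 ∂μ = ∑ j, ∫ z, ‖inner ℂ (e z) (k j)‖ ^ 2 ∂μ := by
    rw [← integral_finsetSum _ fun i _ => hinn2 _, ← integral_finsetSum _ fun i _ => hinn2 _]
    refine integral_congr_ae (Filter.Eventually.of_forall fun z => ?_)
    simp only [hinner]
    exact (sum_norm_sq_rotate U hUU _).symm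
  rw [hsum]
  refine sum_integral_inner_sq_le_of_orthogonal μ e he E hμE b heb heE k ?_ N ?_ F hF α β hα hβ
    near far ?_
  · intro i
    have h1 := hB (fun j => U j i)
    have h2 : ∑ j, ‖U j i‖ ^ 2 = 1 := by
      have := congrFun (congrFun hUU' i) i
      rw [Matrix.mul_apply, Matrix.one_apply_eq] at this
      have h3 : ((∑ j, ‖U j i‖ ^ 2 : ℝ) : ℂ) = 1 := by
        rw [← this]
        push_cast
        refine Finset.sum_congr rfl fun j _ => ?_
        rw [Matrix.star_apply, RCLike.star_def, Complex.conj_mul']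
      exact_mod_cast h3
    rw [h2] at h1
    exact (sq_le_one_iff₀ (norm_nonneg _)).1 h1
  · rw [sum_norm_sq_rotate U hUU]; exact hN
  · intro i j hij
    have h1 := congrFun (congrFun hdiag i) j
    rw [Matrix.diagonal_apply_ne _ hij] at h1
    rw [← h1]
    have h2 : ∀ z, conj (inner ℂ (e z) (k i)) * inner ℂ (e z) (k j) =
        ∑ m, ∑ l, (conj (U l i) * U m j) * (conj (inner ℂ (e z) (h l)) * inner ℂ (e z) (h m)) := by
      intro z
      rw [hinner, hinner, map_sum, Finset.sum_mul_sum, Finset.sum_comm]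
      refine Finset.sum_congr rfl fun m _ => Finset.sum_congr rfl fun l _ => ?_
      simp only [smul_eq_mul, map_mul]; ring
    simp_rw [h2]
    rw [integral_finsetSum _ fun m _ => integrable_finsetSum _ fun l _ => (hinn _ _).const_mul _,
      Matrix.mul_apply]
    refine Finset.sum_congr rfl fun m _ => ?_
    rw [integral_finsetSum _ fun l _ => (hinn _ _).const_mul _, Matrix.mul_apply, Finset.sum_mul]
    refine Finset.sum_congr rfl fun l _ => ?_
    rw [integral_const_mul, Matrix.star_apply, RCLike.star_def]
    simp only [hG]; ring

end tt_star

section damped_waves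

variable {n : ℕ}

theorem dotC_eq_inner (x ξ : Rn n) : dotC x ξ = ((inner ℝ x ξ : ℝ) : ℂ) := by
  simp only [dotC, PiLp.inner_apply, RCLike.inner_apply, conj_trivial]
  congr 1
  exact Finset.sum_congr rfl fun i _ => mul_comm _ _

/-- The damped plane wave `e^{-i(x·ξ - t|ξ|²) - a|ξ|²/2}`. -/
def dampedWave (a : ℝ) (z : ℝ × Rn n) (ξ : Rn n) : ℂ :=
  Complex.exp (-(Complex.I * (dotC z.2 ξ - (z.1 : ℂ) * ((‖ξ‖ : ℝ) : ℂ) ^ 2)) -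
    ((a / 2 * ‖ξ‖ ^ 2 : ℝ) : ℂ))

theorem continuous_dampedWave (a : ℝ) (z : ℝ × Rn n) : Continuous (dampedWave a z) := by
  unfold dampedWave
  simp_rw [dotC_eq_inner]
  fun_prop

theorem norm_dampedWave (a : ℝ) (z : ℝ × Rn n) (ξ : Rn n) :
    ‖dampedWave a z ξ‖ = rexp (-(a / 2 * ‖ξ‖ ^ 2)) := by
  rw [dampedWave, Complex.norm_exp, dotC_eq_inner]
  congr 1
  rw [← Complex.ofReal_pow, ← Complex.ofReal_mul, ← Complex.ofReal_sub]
  simp [-Complex.ofReal_pow, -Complex.ofReal_mul, -Complex.ofReal_sub]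

theorem conj_dampedWave (a : ℝ) (z : ℝ × Rn n) (ξ : Rn n) :
    conj (dampedWave a z ξ) =
      Complex.exp (Complex.I * (dotC z.2 ξ - (z.1 : ℂ) * ((‖ξ‖ : ℝ) : ℂ) ^ 2)) *
        ((rexp (-(a / 2 * ‖ξ‖ ^ 2)) : ℝ) : ℂ) := by
  rw [dampedWave, ← Complex.exp_conj, Complex.ofReal_exp, ← Complex.exp_add, dotC_eq_inner]
  congr 1
  simp only [map_sub, map_neg, map_mul, Complex.conj_I, Complex.conj_ofReal, map_pow]
  push_cast; ring

theorem memLp_dampedWave {a : ℝ} (ha : 0 < a) (z : ℝ × Rn n) :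
    MemLp (dampedWave a z) 2 volume := by
  rw [memLp_two_iff_integrable_sq_norm (continuous_dampedWave a z).aestronglyMeasurable]
  have h1 := (GaussianFourier.integrable_cexp_neg_mul_sq_norm_add (b := (a : ℂ))
    (by simpa using ha) 0 (0 : Rn n)).norm
  refine h1.congr (Filter.Eventually.of_forall fun ξ => ?_)
  simp only [norm_dampedWave, Complex.norm_exp]
  rw [← Real.exp_nat_mul]
  congr 1
  rw [← Complex.ofReal_pow, ← Complex.ofReal_neg, ← Complex.ofReal_mul]
  simp [-Complex.ofReal_pow, -Complex.ofReal_mul, -Complex.ofReal_neg]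
  ring

/-- The damped plane wave as an element of `L²`. -/
def waveVec {a : ℝ} (ha : 0 < a) (z : ℝ × Rn n) : Lp ℂ 2 (volume : Measure (Rn n)) :=
  (memLp_dampedWave ha z).toLp _

theorem inner_waveVec_left {a : ℝ} (ha : 0 < a) (z : ℝ × Rn n)
    (g : Lp ℂ 2 (volume : Measure (Rn n))) :
    inner ℂ (waveVec ha z) g = ∫ ξ, conj (dampedWave a z ξ) * g ξ := by
  rw [L2.inner_def]
  refine integral_congr_ae ?_
  filter_upwards [(memLp_dampedWave ha z).coeFn_toLp] with ξ h
  rw [waveVec, h, RCLike.inner_apply, mul_comm]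

theorem inner_waveVec {a : ℝ} (ha : 0 < a) (z w : ℝ × Rn n) :
    inner ℂ (waveVec ha z) (waveVec ha w) =
      ((π : ℂ) / (a + (z.1 - w.1 : ℝ) * Complex.I)) ^ (((n / 2 : ℝ) : ℂ)) *
        Complex.exp (-((‖z.2 - w.2‖ ^ 2 : ℝ) : ℂ) / (4 * (a + (z.1 - w.1 : ℝ) * Complex.I))) := by
  set b : ℂ := a + (z.1 - w.1 : ℝ) * Complex.I with hb
  have hbre : 0 < b.re := by simpa [hb] using ha
  have h := GaussianFourier.integral_cexp_neg_mul_sq_norm_add hbre Complex.I (z.2 - w.2)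
  rw [finrank_euclideanSpace_fin] at h
  rw [inner_waveVec_left]
  have h1 : ∫ ξ, conj (dampedWave a z ξ) * waveVec ha w ξ =
      ∫ ξ : Rn n, Complex.exp (-b * ‖ξ‖ ^ 2 + Complex.I * (inner ℝ (z.2 - w.2) ξ : ℝ)) := by
    refine integral_congr_ae ?_
    filter_upwards [(memLp_dampedWave ha w).coeFn_toLp] with ξ h
    rw [waveVec, h, dampedWave, dampedWave, ← Complex.exp_conj, ← Complex.exp_add]
    congr 1
    simp only [map_sub, map_neg, map_mul, Complex.conj_I, Complex.conj_ofReal, map_pow,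
      dotC_eq_inner, inner_sub_left, hb]
    push_cast; ring
  rw [h1]
  refine h.trans ?_
  congr 2
  · push_cast; rfl
  · rw [Complex.I_sq]; push_cast; ring

theorem norm_inner_waveVec_le {a : ℝ} (ha : 0 < a) (z w : ℝ × Rn n) :
    ‖inner ℂ (waveVec ha z) (waveVec ha w)‖ ≤
      (π / ‖((a : ℂ) + (z.1 - w.1 : ℝ) * Complex.I)‖) ^ (n / 2 : ℝ) := by
  rw [inner_waveVec]
  set b : ℂ := a + (z.1 - w.1 : ℝ) * Complex.I with hb
  have hbre : b.re = a := by simp [hb]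
  rw [norm_mul, Complex.norm_cpow_real, norm_div, Complex.norm_real, Real.norm_eq_abs,
    abs_of_pos pi_pos, Complex.norm_exp]
  refine mul_le_of_le_one_right (by positivity) (Real.exp_le_one_iff.2 ?_)
  have h : (-((‖z.2 - w.2‖ ^ 2 : ℝ) : ℂ) / (4 * b)) =
      ((-(‖z.2 - w.2‖ ^ 2) / 4 : ℝ) : ℂ) * b⁻¹ := by
    push_cast; rw [div_mul_eq_div_div, div_eq_mul_inv]
  rw [h, Complex.re_ofReal_mul, Complex.inv_re, hbre]
  have : 0 ≤ a / Complex.normSq b := div_nonneg ha.le (Complex.normSq_nonneg _)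
  have h2 : 0 ≤ ‖z.2 - w.2‖ ^ 2 := by positivity
  nlinarith [mul_nonneg h2 this]

theorem norm_inner_waveVec_le_left {a : ℝ} (ha : 0 < a) (z w : ℝ × Rn n) :
    ‖inner ℂ (waveVec ha z) (waveVec ha w)‖ ≤ (π / a) ^ (n / 2 : ℝ) := by
  refine (norm_inner_waveVec_le ha z w).trans ?_
  have h : a ≤ ‖((a : ℂ) + (z.1 - w.1 : ℝ) * Complex.I)‖ := by
    refine le_trans ?_ (Complex.re_le_norm _)
    simp
  gcongr

theorem norm_inner_waveVec_le_right {a : ℝ} (ha : 0 < a) (z w : ℝ × Rn n) (h : z.1 ≠ w.1) :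
    ‖inner ℂ (waveVec ha z) (waveVec ha w)‖ ≤ (π / |z.1 - w.1|) ^ (n / 2 : ℝ) := by
  refine (norm_inner_waveVec_le ha z w).trans ?_
  have h1 : |z.1 - w.1| ≤ ‖((a : ℂ) + (z.1 - w.1 : ℝ) * Complex.I)‖ := by
    refine le_trans ?_ (Complex.abs_im_le_norm _)
    simp
  have h2 : 0 < |z.1 - w.1| := abs_pos.2 (sub_ne_zero.2 h)
  gcongr

theorem norm_inner_waveVec_same {a : ℝ} (ha : 0 < a) (t : ℝ) (x y : Rn n) :
    ‖inner ℂ (waveVec ha (t, x)) (waveVec ha (t, y))‖ =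
      (π / a) ^ (n / 2 : ℝ) * rexp (-(1 / (4 * a)) * ‖x - y‖ ^ 2) := by
  rw [inner_waveVec]
  simp only [sub_self, Complex.ofReal_zero, zero_mul, add_zero]
  rw [norm_mul, Complex.norm_cpow_real, norm_div, Complex.norm_real, Real.norm_eq_abs,
    abs_of_pos pi_pos, Complex.norm_real, Real.norm_eq_abs, abs_of_pos ha, Complex.norm_exp]
  congr 2
  rw [show (-((‖x - y‖ ^ 2 : ℝ) : ℂ) / (4 * (a : ℂ))) = ((-(1 / (4 * a)) * ‖x - y‖ ^ 2 : ℝ) : ℂ) by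
    push_cast; ring, Complex.ofReal_re]

theorem norm_waveVec_sq {a : ℝ} (ha : 0 < a) (z : ℝ × Rn n) :
    ‖waveVec ha z‖ ^ 2 = (π / a) ^ (n / 2 : ℝ) := by
  have h := norm_inner_waveVec_same ha z.1 z.2 z.2
  rw [inner_self_eq_norm_sq_to_K] at h
  simpa using h

theorem integral_norm_inner_waveVec_same {a : ℝ} (ha : 0 < a) :
    ∫ y : Rn n, (π / a) ^ (n / 2 : ℝ) * rexp (-(1 / (4 * a)) * ‖y‖ ^ 2) =
      (4 * π ^ 2) ^ (n / 2 : ℝ) := by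
  rw [integral_const_mul, GaussianFourier.integral_rexp_neg_mul_sq_norm (by positivity),
    finrank_euclideanSpace_fin, ← Real.mul_rpow (by positivity) (by positivity)]
  congr 1
  field_simp

theorem continuous_waveVec {a : ℝ} (ha : 0 < a) :
    Continuous (waveVec ha : ℝ × Rn n → Lp ℂ 2 (volume : Measure (Rn n))) := by
  rw [continuous_iff_continuousAt]
  intro z
  have hK : Continuous fun w : ℝ × Rn n => inner ℂ (waveVec ha z) (waveVec ha w) := by
    simp_rw [inner_waveVec]
    have hne : ∀ w : ℝ × Rn n, ((a : ℂ) + (z.1 - w.1 : ℝ) * Complex.I) ≠ 0 := fun w h0 => by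
      have := congrArg Complex.re h0
      simp at this
      exact ha.ne' this
    have hsl : ∀ w : ℝ × Rn n,
        (π : ℂ) / ((a : ℂ) + (z.1 - w.1 : ℝ) * Complex.I) ∈ Complex.slitPlane := fun w => by
      left
      rw [div_eq_mul_inv, Complex.re_ofReal_mul, Complex.inv_re]
      have h1 : 0 < Complex.normSq ((a : ℂ) + (z.1 - w.1 : ℝ) * Complex.I) :=
        Complex.normSq_pos.2 (hne w)
      have h2 : ((a : ℂ) + (z.1 - w.1 : ℝ) * Complex.I).re = a := by simp
      rw [h2]
      positivity
    refine Continuous.mul (Continuous.cpow ?_ continuous_const hsl) ?_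
    · refine Continuous.div continuous_const (by fun_prop) hne
    · refine Complex.continuous_exp.comp (Continuous.div (by fun_prop) (by fun_prop) fun w => ?_)
      exact mul_ne_zero (by norm_num) (hne w)
  have h1 : Continuous fun w : ℝ × Rn n => ‖waveVec ha w - waveVec ha z‖ ^ 2 := by
    have : ∀ w : ℝ × Rn n, ‖waveVec ha w - waveVec ha z‖ ^ 2 =
        2 * (π / a) ^ (n / 2 : ℝ) - 2 * (inner ℂ (waveVec ha z) (waveVec ha w)).re := fun w => by
      rw [norm_sub_rev, @norm_sub_sq ℂ, norm_waveVec_sq, norm_waveVec_sq]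
      simp only [RCLike.re_to_complex]
      ring
    simp_rw [this]
    exact continuous_const.sub (continuous_const.mul (Complex.continuous_re.comp hK))
  rw [ContinuousAt, tendsto_iff_norm_sub_tendsto_zero]
  have h2 := (Real.continuous_sqrt.comp h1).tendsto z
  simpa [Function.comp_def, Real.sqrt_sq (norm_nonneg _)] using h2

theorem stronglyMeasurable_waveVec {a : ℝ} (ha : 0 < a) :
    StronglyMeasurable (waveVec ha : ℝ × Rn n → Lp ℂ 2 (volume : Measure (Rn n))) :=
  (continuous_waveVec ha).stronglyMeasurable

end damped_waves

section real_integrals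

theorem ennreal_mul_le_half (a b : ℝ≥0∞) : a * b ≤ 2⁻¹ * (a ^ 2 + b ^ 2) := by
  have key : ∀ a b : ℝ≥0∞, a ≤ b → 2 * (a * b) ≤ a ^ 2 + b ^ 2 := by
    intro a b h
    obtain ⟨c, rfl⟩ := exists_add_of_le h
    calc 2 * (a * (a + c)) ≤ 2 * (a * (a + c)) + c ^ 2 := le_self_add
      _ = _ := by ring
  have h2 : 2 * (a * b) ≤ a ^ 2 + b ^ 2 := by
    rcases le_total a b with h | h
    · exact key a b h
    · rw [mul_comm a b, add_comm]; exact key b a h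
  calc a * b = 2⁻¹ * (2 * (a * b)) := by
        rw [← mul_assoc, ENNReal.inv_mul_cancel (by norm_num) (by norm_num), one_mul]
    _ ≤ _ := by gcongr

/-- Schur's test for convolution kernels. -/
theorem lintegral_lintegral_conv_le {G : Type*} [MeasurableSpace G] [AddCommGroup G]
    [MeasurableAdd₂ G] [MeasurableNeg G] (μ : Measure G) [SFinite μ] [μ.IsAddLeftInvariant]
    [μ.IsNegInvariant] {g f : G → ℝ≥0∞} (hg : Measurable g) (hf : Measurable f) :
    ∫⁻ x, ∫⁻ y, g (x - y) * (f x * f y) ∂μ ∂μ ≤ (∫⁻ x, g x ∂μ) * ∫⁻ x, f x ^ 2 ∂μ := by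
  have hgm : Measurable fun w : G × G => g (w.1 - w.2) :=
    hg.comp (measurable_fst.sub measurable_snd)
  have hgl : ∀ x, Measurable fun y => g (x - y) := fun x =>
    hg.comp (measurable_const.sub measurable_id)
  have hgr : ∀ y, Measurable fun x => g (x - y) := fun y =>
    hg.comp (measurable_id.sub measurable_const)
  have h1 : ∫⁻ x, ∫⁻ y, g (x - y) * f x ^ 2 ∂μ ∂μ = (∫⁻ x, g x ∂μ) * ∫⁻ x, f x ^ 2 ∂μ := by
    rw [← lintegral_const_mul _ (hf.pow_const 2)]
    refine lintegral_congr fun x => ?_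
    rw [lintegral_mul_const _ (hgl x),
      lintegral_sub_left_eq_self]
  have h2 : ∫⁻ x, ∫⁻ y, g (x - y) * f y ^ 2 ∂μ ∂μ = (∫⁻ x, g x ∂μ) * ∫⁻ x, f x ^ 2 ∂μ := by
    rw [lintegral_lintegral_swap
      (hgm.mul ((hf.comp measurable_snd).pow_const 2)).aemeasurable,
      ← lintegral_const_mul _ (hf.pow_const 2)]
    refine lintegral_congr fun y => ?_
    rw [lintegral_mul_const _ (hgr y),
      lintegral_sub_right_eq_self]
  calc ∫⁻ x, ∫⁻ y, g (x - y) * (f x * f y) ∂μ ∂μ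
      ≤ ∫⁻ x, ∫⁻ y, 2⁻¹ * (g (x - y) * f x ^ 2 + g (x - y) * f y ^ 2) ∂μ ∂μ := by
        refine lintegral_mono fun x => lintegral_mono fun y => ?_
        calc g (x - y) * (f x * f y) ≤ g (x - y) * (2⁻¹ * (f x ^ 2 + f y ^ 2)) :=
              mul_le_mul' le_rfl (ennreal_mul_le_half _ _)
          _ = _ := by ring
    _ = 2⁻¹ * (∫⁻ x, ∫⁻ y, g (x - y) * f x ^ 2 ∂μ ∂μ +
          ∫⁻ x, ∫⁻ y, g (x - y) * f y ^ 2 ∂μ ∂μ) := by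
        rw [← lintegral_add_left, ← lintegral_const_mul]
        · refine lintegral_congr fun x => ?_
          rw [lintegral_const_mul, lintegral_add_left]
          · exact (hgl x).mul_const _
          · exact ((hgl x).mul_const _).add
              ((hgl x).mul (hf.pow_const 2))
        · exact ((hgm.mul ((hf.comp measurable_fst).pow_const 2)).lintegral_prod_right').add
            ((hgm.mul ((hf.comp measurable_snd).pow_const 2)).lintegral_prod_right')
        · exact (hgm.mul ((hf.comp measurable_fst).pow_const 2)).lintegral_prod_right'
    _ = _ := by
        rw [h1, h2, ← two_mul, ← mul_assoc, ENNReal.inv_mul_cancel (by norm_num) (by norm_num),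
          one_mul]

theorem lintegral_comp_abs_real (f : ℝ → ℝ≥0∞) :
    ∫⁻ x, f |x| = 2 * ∫⁻ x in Ioi 0, f x := by
  rw [← lintegral_add_compl _ (measurableSet_Ioi (a := (0 : ℝ))), compl_Ioi, two_mul]
  congr 1
  · exact setLIntegral_congr_fun measurableSet_Ioi fun x hx => by
      rw [abs_of_pos (mem_Ioi.1 hx)]
  · rw [← Measure.restrict_congr_set (Iio_ae_eq_Iic (μ := volume) (a := (0 : ℝ))),
      ← lintegral_indicator measurableSet_Iio, ← lintegral_neg_eq_self,
      ← lintegral_indicator measurableSet_Ioi]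
    refine lintegral_congr fun x => ?_
    by_cases hx : 0 < x
    · rw [indicator_of_mem, indicator_of_mem, abs_neg, abs_of_pos hx]
      · exact hx
      · simpa using hx
    · rw [indicator_of_notMem, indicator_of_notMem]
      · exact hx
      · simpa using hx

theorem lintegral_abs_rpow_lt {β R : ℝ} (hβ : β < 1) (hR : 0 < R) :
    ∫⁻ x : ℝ, (if |x| < R then ENNReal.ofReal (|x| ^ (-β)) else 0) =
      ENNReal.ofReal (2 / (1 - β) * R ^ (1 - β)) := by
  rw [lintegral_comp_abs_real fun y => if y < R then ENNReal.ofReal (y ^ (-β)) else 0]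
  have h1 : ∫⁻ x in Ioi 0, (if x < R then ENNReal.ofReal (x ^ (-β)) else 0) =
      ∫⁻ x in Ioo 0 R, ENNReal.ofReal (x ^ (-β)) := by
    rw [← lintegral_indicator measurableSet_Ioi, ← lintegral_indicator measurableSet_Ioo]
    refine lintegral_congr fun x => ?_
    by_cases hx : 0 < x <;> by_cases hx' : x < R <;> simp [indicator, hx, hx']
  have hi : IntegrableOn (fun x : ℝ => x ^ (-β)) (Ioo 0 R) :=
    (intervalIntegral.integrableOn_Ioo_rpow_iff hR).2 (by linarith)
  rw [h1, ← ofReal_integral_eq_lintegral_ofReal hi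
    ((ae_restrict_mem measurableSet_Ioo).mono fun x hx => rpow_nonneg hx.1.le _),
    ← integral_Ioc_eq_integral_Ioo, ← intervalIntegral.integral_of_le hR.le,
    integral_rpow (Or.inl (by linarith)), zero_rpow (by linarith),
    show (2 : ℝ≥0∞) = ENNReal.ofReal 2 by simp, ← ENNReal.ofReal_mul (by norm_num)]
  congr 1
  rw [show -β + 1 = 1 - β by ring]
  ring

theorem lintegral_abs_rpow_ge {γ R : ℝ} (hγ : 1 < γ) (hR : 0 < R) :
    ∫⁻ x : ℝ, (if R ≤ |x| then ENNReal.ofReal (|x| ^ (-γ)) else 0) =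
      ENNReal.ofReal (2 / (γ - 1) * R ^ (1 - γ)) := by
  rw [lintegral_comp_abs_real fun y => if R ≤ y then ENNReal.ofReal (y ^ (-γ)) else 0]
  have h1 : ∫⁻ x in Ioi 0, (if R ≤ x then ENNReal.ofReal (x ^ (-γ)) else 0) =
      ∫⁻ x in Ioi R, ENNReal.ofReal (x ^ (-γ)) := by
    rw [Measure.restrict_congr_set (Ioi_ae_eq_Ici (μ := volume) (a := R)),
      ← lintegral_indicator measurableSet_Ioi, ← lintegral_indicator measurableSet_Ici]
    refine lintegral_congr fun x => ?_
    by_cases hx : R ≤ x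
    · simp [indicator, hx, hR.trans_le hx]
    · simp [indicator, hx]
  have hi : IntegrableOn (fun x : ℝ => x ^ (-γ)) (Ioi R) :=
    integrableOn_Ioi_rpow_of_lt (by linarith) hR
  rw [h1, ← ofReal_integral_eq_lintegral_ofReal hi
    ((ae_restrict_mem measurableSet_Ioi).mono fun x hx => rpow_nonneg (hR.trans hx).le _),
    integral_Ioi_rpow_of_lt (by linarith) hR,
    show (2 : ℝ≥0∞) = ENNReal.ofReal 2 by simp, ← ENNReal.ofReal_mul (by norm_num)]
  congr 1
  rw [show -γ + 1 = 1 - γ by ring, show γ - 1 = -(1 - γ) by ring, div_neg]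
  ring

/-- Cauchy–Schwarz on the support. -/
theorem lintegral_sq_le_of_support {X : Type*} [MeasurableSpace X] {μ : Measure X}
    {f : X → ℝ≥0∞} (hf : Measurable f) {S : Set X} (hS : MeasurableSet S)
    (h0 : ∀ x ∉ S, f x = 0) :
    (∫⁻ x, f x ∂μ) ^ 2 ≤ μ S * ∫⁻ x, f x ^ 2 ∂μ := by
  have h1 : ∫⁻ x, f x ∂μ = ∫⁻ x, (f * S.indicator (1 : X → ℝ≥0∞)) x ∂μ := by
    refine lintegral_congr fun x => ?_
    by_cases hx : x ∈ S
    · simp [hx]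
    · simp [hx, h0 x hx]
  have h2 := ENNReal.lintegral_mul_le_Lp_mul_Lq μ Real.HolderConjugate.two_two hf.aemeasurable
    ((measurable_one.indicator hS).aemeasurable : AEMeasurable (S.indicator (1 : X → ℝ≥0∞)) μ)
  rw [← h1] at h2
  have h3 : ∫⁻ x, S.indicator (1 : X → ℝ≥0∞) x ^ (2 : ℝ) ∂μ = μ S := by
    rw [← lintegral_indicator_one hS]
    refine lintegral_congr fun x => ?_
    by_cases hx : x ∈ S <;> simp [hx]
  rw [h3] at h2
  calc (∫⁻ x, f x ∂μ) ^ 2 ≤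
      ((∫⁻ x, f x ^ (2 : ℝ) ∂μ) ^ (1 / 2 : ℝ) * (μ S) ^ (1 / 2 : ℝ)) ^ 2 := by gcongr
    _ = μ S * ∫⁻ x, f x ^ 2 ∂μ := by
      rw [mul_pow, ← ENNReal.rpow_natCast, ← ENNReal.rpow_natCast, ← ENNReal.rpow_mul,
        ← ENNReal.rpow_mul]
      norm_num
      rw [mul_comm]

end real_integrals

section near_part

section near
variable {X H : Type*} [MeasurableSpace X] [NormedAddCommGroup H] [InnerProductSpace ℂ H]
  [CompleteSpace H]

theorem enorm_inner_integral_le {μ : Measure X} {f g : X → H} (hf : Integrable f μ)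
    (hg : Integrable g μ) :
    ‖(inner ℂ (∫ x, f x ∂μ) (∫ y, g y ∂μ) : ℂ)‖ₑ ≤
      ∫⁻ x, ∫⁻ y, ‖(inner ℂ (f x) (g y) : ℂ)‖ₑ ∂μ ∂μ := by
  have h1 : inner ℂ (∫ x, f x ∂μ) (∫ y, g y ∂μ) =
      conj (∫ x, inner ℂ (∫ y, g y ∂μ) (f x) ∂μ) := by
    rw [integral_inner hf, inner_conj_symm]
  rw [h1, enorm_eq_nnnorm, RCLike.nnnorm_conj, ← enorm_eq_nnnorm]
  refine (enorm_integral_le_lintegral_enorm _).trans (lintegral_mono fun x => ?_)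
  have h2 : inner ℂ (∫ y, g y ∂μ) (f x) = conj (∫ y, inner ℂ (f x) (g y) ∂μ) := by
    rw [integral_inner hg, inner_conj_symm]
  rw [h2, enorm_eq_nnnorm, RCLike.nnnorm_conj, ← enorm_eq_nnnorm]
  exact enorm_integral_le_lintegral_enorm _

theorem enorm_inner_smul_smul {H : Type*} [NormedAddCommGroup H] [InnerProductSpace ℂ H]
    (a b : ℂ) (v w : H) :
    ‖(inner ℂ (a • v) (b • w) : ℂ)‖ₑ = ‖(inner ℂ v w : ℂ)‖ₑ * (‖a‖ₑ * ‖b‖ₑ) := by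
  rw [inner_smul_left, inner_smul_right]
  simp only [enorm_mul]
  rw [enorm_eq_nnnorm (conj a), RCLike.nnnorm_conj, ← enorm_eq_nnnorm]
  ring

/-- Time-localised form of a Gram kernel, rewritten with time slices. -/
theorem enorm_near_le_lintegral {μ : Measure X} [SFinite μ] {f : ℝ × X → H}
    (hf : StronglyMeasurable f) {E : Set (ℝ × X)} (hE : (volume.prod μ) E ≠ ∞)
    (hEt : ∀ t, μ (Prod.mk t ⁻¹' E) ≠ ∞) {M : ℝ} (hM : ∀ z, ‖f z‖ ≤ M)
    (h0 : ∀ z ∉ E, f z = 0) (R : ℝ) :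
    ‖∫ w in {w : (ℝ × X) × (ℝ × X) | R ≤ |w.1.1 - w.2.1|}ᶜ, inner ℂ (f w.1) (f w.2)
        ∂((volume.prod μ).prod (volume.prod μ))‖ₑ ≤
      ∫⁻ t, ∫⁻ t', (if |t - t'| < R then
        ‖(inner ℂ (∫ x, f (t, x) ∂μ) (∫ x, f (t', x) ∂μ) : ℂ)‖ₑ else 0) := by
  have hM0 : ∀ z : ℝ × X, 0 ≤ M := fun z => (norm_nonneg _).trans (hM z)
  set k : ℝ → ℝ → ℂ := fun t t' => if |t - t'| < R then 1 else 0 with hk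
  have hset : MeasurableSet {w : ℝ × ℝ | |w.1 - w.2| < R} :=
    measurableSet_lt (by fun_prop) measurable_const
  have hkm : StronglyMeasurable fun w : ℝ × ℝ => k w.1 w.2 :=
    (Measurable.ite hset measurable_const measurable_const).stronglyMeasurable
  have hkb : ∀ t t', ‖k t t'‖ ≤ 1 := fun t t' => by
    simp only [hk]; split_ifs <;> simp
  have hfi : Integrable f (volume.prod μ) :=
    integrable_of_bdd_support hf.aestronglyMeasurable hE M hM h0
  have hfs : ∀ t, Integrable (fun x => f (t, x)) μ := fun t =>
    integrable_of_bdd_support (hf.comp_measurable measurable_prodMk_left).aestronglyMeasurable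
      (hEt t) M (fun x => hM _) (fun x hx => h0 _ hx)
  have hkf : ∀ t, Integrable (fun w : ℝ × X => k t w.1 • f w) (volume.prod μ) := fun t => by
    refine integrable_of_bdd_support ((hkm.comp_measurable
      (measurable_const.prodMk measurable_fst)).smul hf).aestronglyMeasurable hE M (fun z => ?_)
      (fun z hz => by simp [h0 z hz])
    rw [norm_smul]
    exact (mul_le_mul (hkb _ _) (hM z) (norm_nonneg _) zero_le_one).trans_eq (one_mul _)
  have hnotmem : ∀ w : (ℝ × X) × (ℝ × X), w ∉ E ×ˢ E → w.1 ∉ E ∨ w.2 ∉ E := fun w hw => by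
    by_contra! h'; exact hw ⟨h'.1, h'.2⟩
  have hbig : Integrable (fun w : (ℝ × X) × (ℝ × X) =>
      k w.1.1 w.2.1 * inner ℂ (f w.1) (f w.2)) ((volume.prod μ).prod (volume.prod μ)) := by
    refine integrable_of_bdd_support (E := E ×ˢ E) (M := 1 * (M * M)) ?_ ?_ ?_ ?_
    · exact ((hkm.comp_measurable ((measurable_fst.comp measurable_fst).prodMk
        (measurable_fst.comp measurable_snd))).mul ((hf.comp_measurable measurable_fst).inner
        (hf.comp_measurable measurable_snd))).aestronglyMeasurable
    · rw [Measure.prod_prod]; exact ENNReal.mul_ne_top hE hE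
    · intro w
      rw [norm_mul]
      exact mul_le_mul (hkb _ _) ((norm_inner_le_norm _ _).trans (mul_le_mul (hM _) (hM _)
        (norm_nonneg _) (hM0 w.1))) (norm_nonneg _) zero_le_one
    · intro w hw
      rcases hnotmem w hw with h' | h' <;> simp [h0 _ h']
  set Φ : ℝ → H := fun t => ∫ x, f (t, x) ∂μ with hΦ
  have hkΦ : ∀ t, Integrable (fun t' => k t t' • Φ t') volume := fun t => by
    have := (hkf t).integral_prod_left
    simpa only [integral_smul] using this
  have hY : ∀ t, ∫ w, k t w.1 • f w ∂(volume.prod μ) = ∫ t', k t t' • Φ t' := fun t => by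
    rw [integral_prod _ (hkf t)]
    simp only [integral_smul, hΦ]
  have hFm : MeasurableSet {w : (ℝ × X) × (ℝ × X) | R ≤ |w.1.1 - w.2.1|} :=
    measurableSet_le measurable_const (by fun_prop)
  have h1 : ∫ w in {w : (ℝ × X) × (ℝ × X) | R ≤ |w.1.1 - w.2.1|}ᶜ, inner ℂ (f w.1) (f w.2)
        ∂((volume.prod μ).prod (volume.prod μ)) =
      ∫ w, k w.1.1 w.2.1 * inner ℂ (f w.1) (f w.2) ∂((volume.prod μ).prod (volume.prod μ)) := by
    rw [← integral_indicator hFm.compl]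
    refine integral_congr_ae (Filter.Eventually.of_forall fun w => ?_)
    by_cases hw : |w.1.1 - w.2.1| < R
    · simp [indicator, hk, hw]
    · simp [indicator, hk, hw]
  have h2 : ∀ z : ℝ × X, ∫ w, k z.1 w.1 * inner ℂ (f z) (f w) ∂(volume.prod μ) =
      inner ℂ (f z) (∫ t', k z.1 t' • Φ t') := fun z => by
    rw [← hY, ← integral_inner (hkf z.1)]
    refine integral_congr_ae (Filter.Eventually.of_forall fun w => ?_)
    simp only [inner_smul_right]
  have hprodint : Integrable (fun z : ℝ × X => (inner ℂ (f z) (∫ t', k z.1 t' • Φ t') : ℂ))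
      (volume.prod μ) := by
    have := hbig.integral_prod_left
    simpa only [h2] using this
  rw [h1, integral_prod _ hbig]
  simp only [h2]
  rw [integral_prod _ hprodint]
  refine (enorm_integral_le_lintegral_enorm _).trans (lintegral_mono fun t => ?_)
  simp only
  have h3 : ∫ x, inner ℂ (f (t, x)) (∫ t', k t t' • Φ t') ∂μ =
      inner ℂ (Φ t) (∫ t', k t t' • Φ t') := by
    rw [← inner_conj_symm (Φ t), hΦ, ← integral_inner (hfs t), ← integral_conj]
    refine integral_congr_ae (Filter.Eventually.of_forall fun x => ?_)
    simp only [inner_conj_symm]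
  rw [h3, ← integral_inner (hkΦ t)]
  refine (enorm_integral_le_lintegral_enorm _).trans (lintegral_mono fun t' => ?_)
  simp only [hk]
  split_ifs <;> simp [hΦ]

theorem ennreal_interp {x d k r P : ℝ≥0∞} {a1 a2 a3 : ℝ} (h1 : 0 ≤ a1) (h2 : 0 ≤ a2)
    (h3 : 0 ≤ a3) (hsum : a1 + a2 + a3 = 1) (hd : x ≤ d * P) (hk : x ≤ k * P) (hr : x ≤ r * P) :
    x ≤ d ^ a1 * k ^ a2 * r ^ a3 * P := by
  calc x = x ^ a1 * x ^ a2 * x ^ a3 := by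
        rw [← ENNReal.rpow_add_of_nonneg _ _ h1 h2,
          ← ENNReal.rpow_add_of_nonneg _ _ (by positivity) h3,
          hsum, ENNReal.rpow_one]
    _ ≤ (d * P) ^ a1 * (k * P) ^ a2 * (r * P) ^ a3 := by gcongr
    _ = d ^ a1 * k ^ a2 * r ^ a3 * (P ^ a1 * P ^ a2 * P ^ a3) := by
        rw [ENNReal.mul_rpow_of_nonneg _ _ h1, ENNReal.mul_rpow_of_nonneg _ _ h2,
          ENNReal.mul_rpow_of_nonneg _ _ h3]
        ring
    _ = _ := by
        rw [← ENNReal.rpow_add_of_nonneg _ _ h1 h2,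
          ← ENNReal.rpow_add_of_nonneg _ _ (by positivity) h3,
          hsum, ENNReal.rpow_one]

theorem ofReal_rpow_mul_rpow_mul_rpow {D k σ r ν a1 a2 a3 : ℝ} (hD : 0 ≤ D) (hk : 0 ≤ k)
    (hσ : 0 ≤ σ) (hr : 0 < r) (h1 : 0 ≤ a1) (h2 : 0 ≤ a2) (h3 : 0 ≤ a3) :
    ENNReal.ofReal D ^ a1 * ENNReal.ofReal (k * σ) ^ a2 *
        ENNReal.ofReal ((π / r) ^ ν * σ) ^ a3 =
      ENNReal.ofReal (D ^ a1 * (k * σ) ^ a2 * (π ^ ν * σ) ^ a3) *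
        ENNReal.ofReal (r ^ (-(ν * a3))) := by
  rw [ENNReal.ofReal_rpow_of_nonneg hD h1, ENNReal.ofReal_rpow_of_nonneg (by positivity) h2,
    ENNReal.ofReal_rpow_of_nonneg (by positivity) h3, ← ENNReal.ofReal_mul (by positivity),
    ← ENNReal.ofReal_mul (by positivity), ← ENNReal.ofReal_mul (by positivity)]
  congr 1
  rw [mul_assoc _ _ (r ^ (-(ν * a3)))]
  congr 1
  rw [Real.div_rpow pi_pos.le hr.le, div_mul_eq_mul_div,
    Real.div_rpow (by positivity) (by positivity), ← Real.rpow_mul hr.le,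
    Real.rpow_neg hr.le, div_eq_mul_inv]

end near

variable {n : ℕ}

set_option maxHeartbeats 1000000 in
/-- The near-diagonal part of the Gram kernel of damped waves. -/
theorem near_waveVec {a : ℝ} (ha : 0 < a) {E : Set (ℝ × Rn n)} (hEm : MeasurableSet E)
    (hE : volume E ≠ ∞) {σ : ℝ} (hσ0 : 0 ≤ σ)
    (hσ : ∀ t, volume (Prod.mk t ⁻¹' E) ≤ ENNReal.ofReal σ) {R : ℝ} (hR : 0 < R)
    {a1 a2 a3 : ℝ} (h1 : 0 ≤ a1) (h2 : 0 ≤ a2) (h3 : 0 ≤ a3) (hsum : a1 + a2 + a3 = 1)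
    (hβ : n / 2 * a3 < 1)
    {φ : ℝ × Rn n → ℂ} (hφ : StronglyMeasurable φ) {M : ℝ} (hM : ∀ z, ‖φ z‖ ≤ M)
    (h0 : ∀ z ∉ E, φ z = 0) :
    ‖∫ w in {w : (ℝ × Rn n) × (ℝ × Rn n) | R ≤ |w.1.1 - w.2.1|}ᶜ,
        conj (φ w.1) * φ w.2 * inner ℂ (E.indicator (waveVec ha) w.1) (E.indicator (waveVec ha) w.2)
        ∂(volume.prod volume)‖ₑ ≤
      ENNReal.ofReal ((((4 * π ^ 2) ^ (n / 2 : ℝ)) ^ a1 * ((π / a) ^ (n / 2 : ℝ) * σ) ^ a2 *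
        (π ^ (n / 2 : ℝ) * σ) ^ a3) * (2 / (1 - n / 2 * a3) * R ^ (1 - n / 2 * a3))) *
        ∫⁻ z, ‖φ z‖ₑ ^ 2 := by
  set ν : ℝ := n / 2 with hν
  have hν0 : 0 ≤ ν := by positivity
  set f : ℝ × Rn n → Lp ℂ 2 (volume : Measure (Rn n)) := fun z => φ z • waveVec ha z with hf
  have hfm : StronglyMeasurable f := hφ.smul (stronglyMeasurable_waveVec ha)
  have hM0 : 0 ≤ M := (norm_nonneg _).trans (hM 0)
  have hb : ∀ z : ℝ × Rn n, ‖waveVec ha z‖ = √((π / a) ^ ν) := fun z => by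
    rw [← norm_waveVec_sq ha z, Real.sqrt_sq (norm_nonneg _)]
  have hfM : ∀ z, ‖f z‖ ≤ M * √((π / a) ^ ν) := fun z => by
    rw [hf]; simp only; rw [norm_smul, hb]
    gcongr; exact hM z
  have hf0 : ∀ z ∉ E, f z = 0 := fun z hz => by simp [hf, h0 z hz]
  have hEt : ∀ t, (volume : Measure (Rn n)) (Prod.mk t ⁻¹' E) ≠ ∞ := fun t =>
    ((hσ t).trans_lt ENNReal.ofReal_lt_top).ne
  have hstart : ∫ w in {w : (ℝ × Rn n) × (ℝ × Rn n) | R ≤ |w.1.1 - w.2.1|}ᶜ,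
        conj (φ w.1) * φ w.2 * inner ℂ (E.indicator (waveVec ha) w.1) (E.indicator (waveVec ha) w.2)
        ∂(volume.prod volume) =
      ∫ w in {w : (ℝ × Rn n) × (ℝ × Rn n) | R ≤ |w.1.1 - w.2.1|}ᶜ, inner ℂ (f w.1) (f w.2)
        ∂((volume.prod volume).prod (volume.prod volume)) := by
    refine integral_congr_ae (Filter.Eventually.of_forall fun w => ?_)
    simp only [hf, inner_smul_left, inner_smul_right]
    by_cases hw1 : w.1 ∈ E
    · by_cases hw2 : w.2 ∈ E
      · simp only [hw1, hw2, indicator_of_mem]; ring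
      · simp [h0 _ hw2]
    · simp [h0 _ hw1]
  have hfs : ∀ t, Integrable (fun x => f (t, x)) volume := fun t =>
    integrable_of_bdd_support (hfm.comp_measurable measurable_prodMk_left).aestronglyMeasurable
      (hEt t) _ (fun x => hfM _) (fun x hx => hf0 _ hx)
  rw [hstart]
  refine (enorm_near_le_lintegral hfm hE hEt hfM hf0 R).trans ?_
  set aa : ℝ → ℝ≥0∞ := fun t => ∫⁻ x, ‖φ (t, x)‖ₑ ^ 2 with haa
  have hφe : Measurable fun z => ‖φ z‖ₑ := hφ.enorm
  have haam : Measurable aa := (hφe.pow_const 2).lintegral_prod_right'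
  set A : ℝ → ℝ≥0∞ := fun t => aa t ^ (1 / 2 : ℝ) with hA
  have hAm : Measurable A := haam.pow_const _
  have hA2 : ∀ t, A t ^ 2 = aa t := fun t => by
    simp only [hA]; rw [← ENNReal.rpow_natCast, ← ENNReal.rpow_mul]; norm_num
  have hsq : ∀ {u v : ℝ≥0∞}, u ^ 2 ≤ v → u ≤ v ^ (1 / 2 : ℝ) := fun {u v} h => by
    calc u = (u ^ 2) ^ (1 / 2 : ℝ) := by
          rw [← ENNReal.rpow_natCast, ← ENNReal.rpow_mul]; norm_num
      _ ≤ _ := by gcongr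
  set Φ : ℝ → Lp ℂ 2 (volume : Measure (Rn n)) := fun t => ∫ x, f (t, x) with hΦ
  set D : ℝ := (4 * π ^ 2) ^ ν with hD
  -- Gaussian Schur bound on one slice
  have hΦ1 : ∀ t, ‖Φ t‖ₑ ≤ (ENNReal.ofReal D) ^ (1 / 2 : ℝ) * A t := by
    intro t
    rw [hA, ← ENNReal.mul_rpow_of_nonneg _ _ (by norm_num)]
    refine hsq ?_
    have hself : ‖Φ t‖ₑ ^ 2 = ‖(inner ℂ (Φ t) (Φ t) : ℂ)‖ₑ := by
      rw [inner_self_eq_norm_sq_to_K, enorm_pow]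
      congr 1
      simp [enorm_eq_nnnorm]
    rw [hself]
    refine (enorm_inner_integral_le (hfs t) (hfs t)).trans ?_
    set g : Rn n → ℝ≥0∞ := fun y =>
      ENNReal.ofReal ((π / a) ^ ν * rexp (-(1 / (4 * a)) * ‖y‖ ^ 2)) with hg
    have hgm : Measurable g := by fun_prop
    have hgi : ∫⁻ y, g y = ENNReal.ofReal D := by
      rw [hg, ← ofReal_integral_eq_lintegral_ofReal]
      · rw [integral_norm_inner_waveVec_same ha]
      · refine Integrable.const_mul ?_ _
        have h1 := (GaussianFourier.integrable_cexp_neg_mul_sq_norm_add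
          (b := ((1 / (4 * a) : ℝ) : ℂ)) (by rw [Complex.ofReal_re]; positivity) 0 (0 : Rn n)).norm
        refine h1.congr (Filter.Eventually.of_forall fun ξ => ?_)
        simp only [Complex.norm_exp]
        congr 1
        rw [← Complex.ofReal_pow, ← Complex.ofReal_neg, ← Complex.ofReal_mul, zero_mul, add_zero,
          Complex.ofReal_re]
      · exact Filter.Eventually.of_forall fun y => by positivity
    calc ∫⁻ x, ∫⁻ y, ‖(inner ℂ (f (t, x)) (f (t, y)) : ℂ)‖ₑ
        ≤ ∫⁻ x, ∫⁻ y, g (x - y) * (‖φ (t, x)‖ₑ * ‖φ (t, y)‖ₑ) := by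
          refine lintegral_mono fun x => lintegral_mono fun y => ?_
          simp only [hf]
          rw [enorm_inner_smul_smul]
          refine mul_le_mul' ?_ le_rfl
          rw [← ofReal_norm, norm_inner_waveVec_same]
      _ ≤ (∫⁻ y, g y) * ∫⁻ x, ‖φ (t, x)‖ₑ ^ 2 :=
          lintegral_lintegral_conv_le volume hgm (hφe.comp measurable_prodMk_left)
      _ = _ := by rw [hgi]
  -- support bound on one slice
  have hφ1 : ∀ t, ∫⁻ x, ‖φ (t, x)‖ₑ ≤ (ENNReal.ofReal σ) ^ (1 / 2 : ℝ) * A t := by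
    intro t
    rw [hA, ← ENNReal.mul_rpow_of_nonneg _ _ (by norm_num)]
    refine hsq ?_
    refine (lintegral_sq_le_of_support (hφe.comp measurable_prodMk_left)
      (measurable_prodMk_left hEm : MeasurableSet (Prod.mk t ⁻¹' E)) (fun x hx => ?_)).trans ?_
    · have : φ (t, x) = 0 := h0 _ hx
      simp [this]
    · exact mul_le_mul' (hσ t) le_rfl
  have hhalf : ∀ u : ℝ≥0∞, u ^ (1 / 2 : ℝ) * u ^ (1 / 2 : ℝ) = u := fun u => by
    rw [← ENNReal.rpow_add_of_nonneg _ _ (by norm_num) (by norm_num)]; norm_num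
  have hκ : ∀ t t' (κ : ℝ), 0 ≤ κ → (∀ x y : Rn n, ‖(inner ℂ (waveVec ha (t, x))
      (waveVec ha (t', y)) : ℂ)‖ ≤ κ) →
      ‖(inner ℂ (Φ t) (Φ t') : ℂ)‖ₑ ≤ ENNReal.ofReal (κ * σ) * (A t * A t') := by
    intro t t' κ hκ0 hκ
    refine (enorm_inner_integral_le (hfs t) (hfs t')).trans ?_
    calc ∫⁻ x, ∫⁻ y, ‖(inner ℂ (f (t, x)) (f (t', y)) : ℂ)‖ₑ
        ≤ ∫⁻ x, ∫⁻ y, ENNReal.ofReal κ * (‖φ (t, x)‖ₑ * ‖φ (t', y)‖ₑ) := by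
          refine lintegral_mono fun x => lintegral_mono fun y => ?_
          simp only [hf]
          rw [enorm_inner_smul_smul]
          refine mul_le_mul' ?_ le_rfl
          rw [← ofReal_norm]
          exact ENNReal.ofReal_le_ofReal (hκ x y)
      _ = ENNReal.ofReal κ * ((∫⁻ x, ‖φ (t, x)‖ₑ) * ∫⁻ y, ‖φ (t', y)‖ₑ) := by
          have hm : ∀ s, Measurable fun x => ‖φ (s, x)‖ₑ := fun s =>
            hφe.comp measurable_prodMk_left
          simp_rw [lintegral_const_mul _ ((hm t').const_mul _), lintegral_const_mul _ (hm t')]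
          rw [lintegral_const_mul _ ((hm t).mul_const _), lintegral_mul_const _ (hm t)]
      _ ≤ ENNReal.ofReal κ * (((ENNReal.ofReal σ) ^ (1 / 2 : ℝ) * A t) *
            ((ENNReal.ofReal σ) ^ (1 / 2 : ℝ) * A t')) :=
          mul_le_mul' le_rfl (mul_le_mul' (hφ1 t) (hφ1 t'))
      _ = ENNReal.ofReal κ * ((ENNReal.ofReal σ) ^ (1 / 2 : ℝ) * (ENNReal.ofReal σ) ^ (1 / 2 : ℝ)) *
            (A t * A t') := by ring
      _ = _ := by rw [hhalf, ENNReal.ofReal_mul hκ0]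
  set L : ℝ := D ^ a1 * ((π / a) ^ ν * σ) ^ a2 * (π ^ ν * σ) ^ a3 with hL
  have hL0 : 0 ≤ L := by positivity
  have hpair : ∀ t t', t ≠ t' → ‖(inner ℂ (Φ t) (Φ t') : ℂ)‖ₑ ≤
      ENNReal.ofReal L * ENNReal.ofReal (|t - t'| ^ (-(ν * a3))) * (A t * A t') := by
    intro t t' htt
    have hr : 0 < |t - t'| := abs_pos.2 (sub_ne_zero.2 htt)
    have e1 : ‖(inner ℂ (Φ t) (Φ t') : ℂ)‖ₑ ≤ ENNReal.ofReal D * (A t * A t') := by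
      calc ‖(inner ℂ (Φ t) (Φ t') : ℂ)‖ₑ ≤ ‖Φ t‖ₑ * ‖Φ t'‖ₑ := by
            simp only [← ofReal_norm]
            rw [← ENNReal.ofReal_mul (norm_nonneg _)]
            exact ENNReal.ofReal_le_ofReal (norm_inner_le_norm _ _)
        _ ≤ ((ENNReal.ofReal D) ^ (1 / 2 : ℝ) * A t) * ((ENNReal.ofReal D) ^ (1 / 2 : ℝ) * A t') :=
            mul_le_mul' (hΦ1 t) (hΦ1 t')
        _ = ((ENNReal.ofReal D) ^ (1 / 2 : ℝ) * (ENNReal.ofReal D) ^ (1 / 2 : ℝ)) *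
            (A t * A t') := by ring
        _ = _ := by rw [hhalf]
    have e2 := hκ t t' ((π / a) ^ ν) (by positivity) fun x y => norm_inner_waveVec_le_left ha _ _
    have e3 := hκ t t' ((π / |t - t'|) ^ ν) (by positivity) fun x y =>
      norm_inner_waveVec_le_right ha (t, x) (t', y) htt
    refine (ennreal_interp h1 h2 h3 hsum e1 e2 e3).trans_eq ?_
    congr 1
    exact ofReal_rpow_mul_rpow_mul_rpow (by positivity) (by positivity) hσ0 hr h1 h2 h3
  set G : ℝ → ℝ≥0∞ := fun r => ENNReal.ofReal L *
    (if |r| < R then ENNReal.ofReal (|r| ^ (-(ν * a3))) else 0) with hG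
  have hGm' : Measurable fun r : ℝ => if |r| < R then ENNReal.ofReal (|r| ^ (-(ν * a3))) else 0 :=
    Measurable.ite (measurableSet_lt (by fun_prop) measurable_const) (by fun_prop) measurable_const
  have hGm : Measurable G := hGm'.const_mul _
  calc ∫⁻ t, ∫⁻ t', (if |t - t'| < R then ‖(inner ℂ (Φ t) (Φ t') : ℂ)‖ₑ else 0)
      ≤ ∫⁻ t, ∫⁻ t', G (t - t') * (A t * A t') := by
        refine lintegral_mono fun t => lintegral_mono_ae ?_
        have : ∀ᵐ t' : ℝ, t' ≠ t := by
          simp [ae_iff]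
        filter_upwards [this] with t' ht'
        simp only [hG]
        split_ifs
        · exact hpair t t' ht'.symm
        · simp
    _ ≤ (∫⁻ r, G r) * ∫⁻ t, A t ^ 2 := lintegral_lintegral_conv_le volume hGm hAm
    _ = _ := by
        rw [hG, lintegral_const_mul _ hGm', lintegral_abs_rpow_lt hβ hR,
          ← ENNReal.ofReal_mul hL0]
        simp only [hA2, haa]
        congr 1
        rw [Measure.volume_eq_prod, lintegral_prod _ (hφe.pow_const 2).aemeasurable]

end near_part

section far_part

variable {n : ℕ}

theorem volume_le_of_sections {E : Set (ℝ × Rn n)} (hEm : MeasurableSet E) {Θ : Set ℝ}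
    (hΘm : MeasurableSet Θ) {τ σ : ℝ} (hσ0 : 0 ≤ σ) (hτ : volume Θ ≤ ENNReal.ofReal τ)
    (hEΘ : ∀ z ∈ E, z.1 ∈ Θ) (hσ : ∀ t, volume (Prod.mk t ⁻¹' E) ≤ ENNReal.ofReal σ) :
    volume E ≤ ENNReal.ofReal (σ * τ) := by
  rw [Measure.volume_eq_prod, Measure.prod_apply hEm]
  calc ∫⁻ t, volume (Prod.mk t ⁻¹' E) ≤ ∫⁻ t in Θ, ENNReal.ofReal σ := by
        rw [← lintegral_indicator hΘm]
        refine lintegral_mono fun t => ?_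
        by_cases ht : t ∈ Θ
        · simpa [ht] using hσ t
        · have : Prod.mk t ⁻¹' E = ∅ := by
            ext x; simp only [mem_preimage, mem_empty_iff_false, iff_false]
            exact fun h => ht (hEΘ _ h)
          simp [this]
    _ ≤ _ := by
        rw [setLIntegral_const, ENNReal.ofReal_mul hσ0]; gcongr

theorem lintegral_far_waveVec {a : ℝ} (ha : 0 < a) (hn : 2 ≤ n) {E : Set (ℝ × Rn n)}
    (hEm : MeasurableSet E) {V σ : ℝ} (hσ0 : 0 ≤ σ) (hV : volume E ≤ ENNReal.ofReal V)
    (hσ : ∀ t, volume (Prod.mk t ⁻¹' E) ≤ ENNReal.ofReal σ) {R : ℝ} (hR : 0 < R) :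
    ∫⁻ w in {w : (ℝ × Rn n) × (ℝ × Rn n) | R ≤ |w.1.1 - w.2.1|},
      ‖(inner ℂ (E.indicator (waveVec ha) w.1) (E.indicator (waveVec ha) w.2) : ℂ)‖ₑ ^ 2
        ∂(volume.prod volume) ≤
      ENNReal.ofReal (π ^ (n : ℝ) * (2 / (n - 1) * R ^ (1 - n : ℝ)) * σ * V) := by
  have hn1 : (1 : ℝ) < n := by exact_mod_cast hn
  set g : ℝ → ℝ≥0∞ := fun r => if R ≤ |r| then ENNReal.ofReal (|r| ^ (-(n : ℝ))) else 0 with hg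
  have hgm : Measurable g :=
    Measurable.ite (measurableSet_le measurable_const (by fun_prop)) (by fun_prop) measurable_const
  have hFm : MeasurableSet {w : (ℝ × Rn n) × (ℝ × Rn n) | R ≤ |w.1.1 - w.2.1|} :=
    measurableSet_le measurable_const (by fun_prop)
  have hI : Measurable (E.indicator (1 : ℝ × Rn n → ℝ≥0∞)) := measurable_one.indicator hEm
  set h : (ℝ × Rn n) × (ℝ × Rn n) → ℝ≥0∞ := fun w => ENNReal.ofReal (π ^ (n : ℝ)) *
    (E.indicator 1 w.1 * (E.indicator 1 w.2 * g (w.1.1 - w.2.1))) with hh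
  have hhm : Measurable h := by
    refine Measurable.const_mul ?_ _
    exact (hI.comp measurable_fst).mul ((hI.comp measurable_snd).mul
      (hgm.comp ((measurable_fst.comp measurable_fst).sub (measurable_fst.comp measurable_snd))))
  have hpt : ∀ w ∈ {w : (ℝ × Rn n) × (ℝ × Rn n) | R ≤ |w.1.1 - w.2.1|},
      ‖(inner ℂ (E.indicator (waveVec ha) w.1) (E.indicator (waveVec ha) w.2) : ℂ)‖ₑ ^ 2 ≤ h w := by
    intro w hw
    have hw' : R ≤ |w.1.1 - w.2.1| := hw
    by_cases h1 : w.1 ∈ E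
    · by_cases h2 : w.2 ∈ E
      · have hr : 0 < |w.1.1 - w.2.1| := hR.trans_le hw'
        simp only [h1, h2, indicator_of_mem, hh, hg, hw', if_true, Pi.one_apply, one_mul]
        rw [← ofReal_norm, ← ENNReal.ofReal_pow (norm_nonneg _),
          ← ENNReal.ofReal_mul (by positivity)]
        refine ENNReal.ofReal_le_ofReal ?_
        have := norm_inner_waveVec_le_right ha w.1 w.2 (sub_ne_zero.1 (abs_pos.1 hr))
        calc ‖(inner ℂ (waveVec ha w.1) (waveVec ha w.2) : ℂ)‖ ^ 2 ≤
            ((π / |w.1.1 - w.2.1|) ^ (n / 2 : ℝ)) ^ 2 := by gcongr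
          _ = _ := by
            rw [← Real.rpow_natCast, ← Real.rpow_mul (by positivity),
              Real.div_rpow pi_pos.le hr.le, Real.rpow_neg hr.le, div_eq_mul_inv]
            norm_num
      · simp [h2]
    · simp [h1]
  calc _ ≤ ∫⁻ w in {w : (ℝ × Rn n) × (ℝ × Rn n) | R ≤ |w.1.1 - w.2.1|}, h w
        ∂(volume.prod volume) := setLIntegral_mono' hFm hpt
    _ ≤ ∫⁻ w, h w ∂(volume.prod volume) := setLIntegral_le_lintegral _ _
    _ = ∫⁻ z, ∫⁻ w, h (z, w) := lintegral_prod _ hhm.aemeasurable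
    _ ≤ ∫⁻ z : ℝ × Rn n, ENNReal.ofReal (π ^ (n : ℝ)) * (E.indicator 1 z *
          (ENNReal.ofReal σ * ∫⁻ r, g r)) := by
        refine lintegral_mono fun z => ?_
        simp only [hh]
        have hm1 : Measurable fun w : ℝ × Rn n => E.indicator 1 w * g (z.1 - w.1) :=
          hI.mul (hgm.comp (measurable_const.sub measurable_fst))
        rw [lintegral_const_mul _ (hm1.const_mul _), lintegral_const_mul _ hm1]
        refine mul_le_mul' le_rfl (mul_le_mul' le_rfl ?_)
        rw [Measure.volume_eq_prod, lintegral_prod _ hm1.aemeasurable]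
        calc ∫⁻ t, ∫⁻ x, E.indicator 1 (t, x) * g (z.1 - t)
            ≤ ∫⁻ t, ENNReal.ofReal σ * g (z.1 - t) := by
              refine lintegral_mono fun t => ?_
              have hIt : Measurable fun x : Rn n =>
                  E.indicator (1 : ℝ × Rn n → ℝ≥0∞) (t, x) := hI.comp measurable_prodMk_left
              simp only
              rw [lintegral_mul_const _ hIt]
              refine mul_le_mul' ?_ le_rfl
              refine le_trans (le_of_eq ?_) (hσ t)
              rw [← lintegral_indicator_one (measurable_prodMk_left hEm)]
              rfl
          _ = _ := by
              have hgl : Measurable fun t => g (z.1 - t) :=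
                hgm.comp (measurable_const.sub measurable_id)
              rw [lintegral_const_mul _ hgl, lintegral_sub_left_eq_self]
    _ = ENNReal.ofReal (π ^ (n : ℝ)) * (volume E * (ENNReal.ofReal σ * ∫⁻ r, g r)) := by
        rw [lintegral_const_mul _ (hI.mul_const _), lintegral_mul_const _ hI,
          lintegral_indicator_one hEm]
    _ ≤ ENNReal.ofReal (π ^ (n : ℝ)) * (ENNReal.ofReal V * (ENNReal.ofReal σ *
          ENNReal.ofReal (2 / (n - 1) * R ^ (1 - n : ℝ)))) := by
        rw [hg, lintegral_abs_rpow_ge hn1 hR]; gcongr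
    _ = _ := by
        have : 0 < (n : ℝ) - 1 := by linarith
        rw [← ENNReal.ofReal_mul hσ0, mul_comm (ENNReal.ofReal V),
          ← ENNReal.ofReal_mul (by positivity), ← ENNReal.ofReal_mul (by positivity)]
        congr 1; ring

variable {ι : Type*} [Fintype ι]

theorem measurable_indicator_waveVec {a : ℝ} (ha : 0 < a) {E : Set (ℝ × Rn n)}
    (hEm : MeasurableSet E) : StronglyMeasurable (E.indicator (waveVec ha)) :=
  (stronglyMeasurable_waveVec ha).indicator hEm

theorem setIntegral_inner_waveVec {a : ℝ} (ha : 0 < a) {E : Set (ℝ × Rn n)}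
    (hEm : MeasurableSet E) (g : Lp ℂ 2 (volume : Measure (Rn n))) :
    ∫ z in E, ‖(inner ℂ (waveVec ha z) g : ℂ)‖ ^ 2 =
      ∫ z, ‖(inner ℂ (E.indicator (waveVec ha) z) g : ℂ)‖ ^ 2 := by
  rw [← integral_indicator hEm]
  refine integral_congr_ae (Filter.Eventually.of_forall fun z => ?_)
  by_cases hz : z ∈ E <;> simp [hz]

/-- The trace bound with a free cut-off parameter `R`. -/
theorem sum_setIntegral_waveVec_le_cutoff {a : ℝ} (ha : 0 < a) (hn : 2 ≤ n)
    {E : Set (ℝ × Rn n)} (hEm : MeasurableSet E) {V σ : ℝ} (hσ0 : 0 ≤ σ) (hV0 : 0 ≤ V)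
    (hV : volume E ≤ ENNReal.ofReal V)
    (hσ : ∀ t, volume (Prod.mk t ⁻¹' E) ≤ ENNReal.ofReal σ) {R : ℝ} (hR : 0 < R)
    {a1 a2 a3 : ℝ} (h1 : 0 ≤ a1) (h2 : 0 ≤ a2) (h3 : 0 ≤ a3) (hsum : a1 + a2 + a3 = 1)
    (hβ : n / 2 * a3 < 1)
    (h : ι → Lp ℂ 2 (volume : Measure (Rn n)))
    (hB : ∀ c : ι → ℂ, ‖∑ j, c j • h j‖ ^ 2 ≤ ∑ j, ‖c j‖ ^ 2)
    {N : ℝ} (hN : ∑ j, ‖h j‖ ^ 2 ≤ N) :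
    ∑ j, ∫ z in E, ‖(inner ℂ (waveVec ha z) (h j) : ℂ)‖ ^ 2 ≤
      N * ((((4 * π ^ 2) ^ (n / 2 : ℝ)) ^ a1 * ((π / a) ^ (n / 2 : ℝ) * σ) ^ a2 *
        (π ^ (n / 2 : ℝ) * σ) ^ a3) * (2 / (1 - n / 2 * a3) * R ^ (1 - n / 2 * a3))) +
      √N * √(π ^ (n : ℝ) * (2 / (n - 1) * R ^ (1 - n : ℝ)) * σ * V) := by
  have hn1 : (0 : ℝ) < (n : ℝ) - 1 := by
    have : (1 : ℝ) < n := by exact_mod_cast hn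
    linarith
  have hE : volume E ≠ ∞ := (hV.trans_lt ENNReal.ofReal_lt_top).ne
  have hβ' : 0 < 1 - n / 2 * a3 := by linarith
  have hb : ∀ z : ℝ × Rn n, ‖waveVec ha z‖ = √((π / a) ^ (n / 2 : ℝ)) := fun z => by
    rw [← norm_waveVec_sq ha z, Real.sqrt_sq (norm_nonneg _)]
  simp_rw [setIntegral_inner_waveVec ha hEm]
  refine sum_integral_inner_sq_le volume _ (measurable_indicator_waveVec ha hEm) E hE
    (√((π / a) ^ (n / 2 : ℝ))) (fun z => ?_) (fun z hz => by simp [hz]) h hB N hN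
    {w : (ℝ × Rn n) × (ℝ × Rn n) | R ≤ |w.1.1 - w.2.1|}
    (measurableSet_le measurable_const (by fun_prop)) _ _ (by positivity) (by positivity) ?_ ?_
  · by_cases hz : z ∈ E
    · simp only [hz, indicator_of_mem]; exact (hb z).le
    · simp only [hz, not_false_eq_true, indicator_of_notMem, norm_zero]; positivity
  · rintro φ hφ ⟨M, hM⟩ h0
    have hnear := near_waveVec ha hEm hE hσ0 hσ hR h1 h2 h3 hsum hβ hφ hM h0
    have hi : Integrable (fun z => ‖φ z‖ ^ 2) volume :=
      integrable_of_bdd_support (hφ.norm.pow 2).aestronglyMeasurable hE (M ^ 2)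
        (fun z => by
          rw [norm_pow, norm_norm]; exact pow_le_pow_left₀ (norm_nonneg _) (hM z) 2)
        (fun z hz => by simp [h0 z hz])
    have h5 : ∫⁻ z, ‖φ z‖ₑ ^ 2 = ENNReal.ofReal (∫ z, ‖φ z‖ ^ 2) := by
      rw [ofReal_integral_eq_lintegral_ofReal hi
        (Filter.Eventually.of_forall fun z => by positivity)]
      refine lintegral_congr fun z => ?_
      rw [ENNReal.ofReal_pow (norm_nonneg _), ofReal_norm]
    rw [h5, ← ENNReal.ofReal_mul (by positivity), ← ofReal_norm] at hnear
    exact (ENNReal.ofReal_le_ofReal_iff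
      (mul_nonneg (by positivity) (integral_nonneg fun z => by positivity))).1 hnear
  · have hfar := lintegral_far_waveVec ha hn hEm hσ0 hV hσ hR
    rw [Real.sq_sqrt (by positivity)]
    rw [integral_eq_lintegral_of_nonneg_ae (Filter.Eventually.of_forall fun w => by positivity)]
    · refine ENNReal.toReal_le_of_le_ofReal (by positivity) (le_trans (le_of_eq ?_) hfar)
      refine lintegral_congr fun w => ?_
      rw [ENNReal.ofReal_pow (norm_nonneg _), ofReal_norm]
    · have hm := measurable_indicator_waveVec ha hEm
      exact (((hm.comp_measurable measurable_fst).inner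
        (hm.comp_measurable measurable_snd)).norm.pow 2).aestronglyMeasurable

/-- Bessel's inequality for contractive systems. -/
theorem sum_norm_inner_sq_le_of_contraction {H : Type*} [NormedAddCommGroup H]
    [InnerProductSpace ℂ H] (h : ι → H)
    (hB : ∀ c : ι → ℂ, ‖∑ j, c j • h j‖ ^ 2 ≤ ∑ j, ‖c j‖ ^ 2) (v : H) :
    ∑ j, ‖(inner ℂ v (h j) : ℂ)‖ ^ 2 ≤ ‖v‖ ^ 2 := by
  set S := ∑ j, ‖(inner ℂ v (h j) : ℂ)‖ ^ 2 with hS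
  have hS0 : 0 ≤ S := Finset.sum_nonneg fun _ _ => by positivity
  set c : ι → ℂ := fun j => conj (inner ℂ v (h j)) with hc
  have h1 := hB c
  have h2 : ∑ j, ‖c j‖ ^ 2 = S := by simp only [hc, hS, RCLike.norm_conj]
  have h3 : (inner ℂ v (∑ j, c j • h j) : ℂ) = (S : ℂ) := by
    rw [inner_sum, hS]
    push_cast
    refine Finset.sum_congr rfl fun j _ => ?_
    rw [inner_smul_right, hc]
    exact Complex.conj_mul' _
  have h4 : S ≤ ‖v‖ * ‖∑ j, c j • h j‖ := by
    have := norm_inner_le_norm (𝕜 := ℂ) v (∑ j, c j • h j)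
    rwa [h3, Complex.norm_real, Real.norm_of_nonneg hS0] at this
  rw [h2] at h1
  have h5 : S * S ≤ ‖v‖ ^ 2 * S := by
    calc S * S ≤ (‖v‖ * ‖∑ j, c j • h j‖) * (‖v‖ * ‖∑ j, c j • h j‖) :=
          mul_le_mul h4 h4 hS0 (by positivity)
      _ = ‖v‖ ^ 2 * ‖∑ j, c j • h j‖ ^ 2 := by ring
      _ ≤ _ := by gcongr
  rcases hS0.eq_or_lt with h0 | h0
  · rw [← h0]; positivity
  · exact le_of_mul_le_mul_right h5 h0

theorem sum_setIntegral_waveVec_le_trivial {a : ℝ} (ha : 0 < a)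
    {E : Set (ℝ × Rn n)} {V : ℝ} (hV0 : 0 ≤ V)
    (hV : volume E ≤ ENNReal.ofReal V)
    (h : ι → Lp ℂ 2 (volume : Measure (Rn n)))
    (hB : ∀ c : ι → ℂ, ‖∑ j, c j • h j‖ ^ 2 ≤ ∑ j, ‖c j‖ ^ 2) :
    ∑ j, ∫ z in E, ‖(inner ℂ (waveVec ha z) (h j) : ℂ)‖ ^ 2 ≤ V * (π / a) ^ (n / 2 : ℝ) := by
  have hE : volume E ≠ ∞ := (hV.trans_lt ENNReal.ofReal_lt_top).ne
  have hinn : ∀ j, IntegrableOn (fun z => ‖(inner ℂ (waveVec ha z) (h j) : ℂ)‖ ^ 2) E := fun j => by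
    refine Measure.integrableOn_of_bounded (M := (π / a) ^ (n / 2 : ℝ) * ‖h j‖ ^ 2) hE
      (((stronglyMeasurable_waveVec ha).inner
        stronglyMeasurable_const).norm.pow 2).aestronglyMeasurable
      (Filter.Eventually.of_forall fun z => ?_)
    rw [norm_pow, norm_norm, ← norm_waveVec_sq ha z, ← mul_pow]
    exact pow_le_pow_left₀ (norm_nonneg _) (norm_inner_le_norm _ _) 2
  rw [← integral_finsetSum _ fun j _ => hinn j]
  calc ∫ z in E, ∑ j, ‖(inner ℂ (waveVec ha z) (h j) : ℂ)‖ ^ 2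
      ≤ ∫ z in E, (π / a) ^ (n / 2 : ℝ) := by
        refine integral_mono (integrable_finsetSum _ fun j _ => hinn j)
          (integrableOn_const hE) fun z => ?_
        simp only
        rw [← norm_waveVec_sq ha z]
        exact sum_norm_inner_sq_le_of_contraction h hB _
    _ = volume.real E * (π / a) ^ (n / 2 : ℝ) := by rw [setIntegral_const, smul_eq_mul]
    _ ≤ _ := by
        gcongr
        exact ENNReal.toReal_le_of_le_ofReal hV0 hV

end far_part

section level_sets

variable {n : ℕ}

theorem near_factor_eq {a σ θ β K1 ν : ℝ} (ha : 0 < a) (hσ : 0 < σ) (hν : 0 < ν) :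
    K1 * ((π / a) ^ (ν / 2) * σ) ^ (θ - 2 * β / ν) * (π ^ (ν / 2) * σ) ^ (2 * β / ν) =
      (K1 * (π ^ (ν / 2)) ^ (θ - 2 * β / ν) * (π ^ (ν / 2)) ^ (2 * β / ν)) *
        (σ ^ θ * a ^ (β - ν * θ / 2)) := by
  have hp := pi_pos
  rw [Real.mul_rpow (by positivity) hσ.le, Real.mul_rpow (by positivity) hσ.le,
    Real.div_rpow hp.le ha.le, Real.div_rpow (by positivity) (by positivity),
    ← Real.rpow_mul ha.le]
  have h1 : σ ^ θ = σ ^ (θ - 2 * β / ν) * σ ^ (2 * β / ν) := by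
    rw [← Real.rpow_add hσ]; congr 1; ring
  have h2 : a ^ (β - ν * θ / 2) = (a ^ (ν / 2 * (θ - 2 * β / ν)))⁻¹ := by
    rw [← Real.rpow_neg ha.le]; congr 1; field_simp; ring
  rw [h1, h2]
  field_simp

theorem far_factor_eq {σ τ R ν : ℝ} (hσ : 0 < σ) (hτ : 0 < τ) (hR : 0 < R) (hν : 1 < ν) :
    √(π ^ ν * (2 / (ν - 1) * R ^ (1 - ν)) * σ * (σ * τ)) =
      √(π ^ ν * (2 / (ν - 1))) * (√τ * σ * R ^ ((1 - ν) / 2)) := by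
  have hp := pi_pos
  have h1 : 0 < ν - 1 := by linarith
  have h2 : R ^ (1 - ν) = (R ^ ((1 - ν) / 2)) ^ 2 := by
    rw [← Real.rpow_natCast, ← Real.rpow_mul hR.le]; congr 1; push_cast; ring
  rw [h2, show π ^ ν * (2 / (ν - 1) * (R ^ ((1 - ν) / 2)) ^ 2) * σ * (σ * τ) =
    (π ^ ν * (2 / (ν - 1))) * (τ * (σ * R ^ ((1 - ν) / 2)) ^ 2) by ring,
    Real.sqrt_mul (by positivity), Real.sqrt_mul hτ.le, Real.sqrt_sq (by positivity)]
  ring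

/-- Choosing the cut-off `R` that balances the two terms. -/
theorem exists_balanced_cutoff {N τ σ a ν θ β e x : ℝ} (hN : 0 < N) (hτ : 0 < τ) (hσ : 0 < σ)
    (ha : 0 < a) (hν : 1 < ν) (hβ1 : β < 1) (he : 1 - β = e * (ν + 1 - 2 * β))
    (hx : θ * (1 - 2 * e) = 1 - 2 * e - x) :
    ∃ R, 0 < R ∧ N * (σ ^ θ * a ^ (β - ν * θ / 2) * R ^ (1 - β)) =
        N ^ (1 - e) * τ ^ e * σ ^ (1 - x) * a ^ ((β - ν * θ / 2) * (1 - 2 * e)) ∧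
      √N * (√τ * σ * R ^ ((1 - ν) / 2)) =
        N ^ (1 - e) * τ ^ e * σ ^ (1 - x) * a ^ ((β - ν * θ / 2) * (1 - 2 * e)) := by
  obtain ⟨n', rfl⟩ : ∃ y, N = rexp y := ⟨log N, (Real.exp_log hN).symm⟩
  obtain ⟨t, rfl⟩ : ∃ y, τ = rexp y := ⟨log τ, (Real.exp_log hτ).symm⟩
  obtain ⟨u, rfl⟩ : ∃ y, σ = rexp y := ⟨log σ, (Real.exp_log hσ).symm⟩
  obtain ⟨v, rfl⟩ : ∃ y, a = rexp y := ⟨log a, (Real.exp_log ha).symm⟩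
  have hD : 0 < ν + 1 - 2 * β := by linarith
  have he' : e = (1 - β) / (ν + 1 - 2 * β) := by rw [he]; field_simp
  have hx' : x = (1 - 2 * e) * (1 - θ) := by linarith
  refine ⟨rexp ((t - n' + 2 * (1 - θ) * u - 2 * (β - ν * θ / 2) * v) / (ν + 1 - 2 * β)),
    Real.exp_pos _, ?_, ?_⟩
  · simp only [← Real.exp_mul, ← Real.exp_add]
    congr 1
    rw [hx', he']; field_simp; ring
  · have hs : ∀ y : ℝ, √(rexp y) = rexp (y / 2) := fun y => Real.exp_half y ▸ rfl
    simp only [hs, ← Real.exp_mul, ← Real.exp_add]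
    congr 1
    rw [hx', he']; field_simp; ring

theorem setIntegral_waveVec_upper_region (hn : 2 ≤ n) {x z : ℝ} (hz : z < 1)
    (hz' : (n : ℝ) / (n + 1) ≤ z) (hx : x ≤ 2 * z - 1) (hxz : 2 * z + n * x ≤ n) (hx0 : 0 ≤ x) :
    ∃ C : ℝ, 0 < C ∧ ∀ {ι : Type} [Fintype ι] {a : ℝ} (ha : 0 < a) {E : Set (ℝ × Rn n)}
      {σ τ N : ℝ} (h : ι → Lp ℂ 2 (volume : Measure (Rn n))), MeasurableSet E → 0 < σ → 0 < τ →
      0 < N → volume E ≤ ENNReal.ofReal (σ * τ) →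
      (∀ t, volume (Prod.mk t ⁻¹' E) ≤ ENNReal.ofReal σ) →
      (∀ c : ι → ℂ, ‖∑ j, c j • h j‖ ^ 2 ≤ ∑ j, ‖c j‖ ^ 2) → ∑ j, ‖h j‖ ^ 2 ≤ N →
      ∑ j, ∫ w in E, ‖(inner ℂ (waveVec ha w) (h j) : ℂ)‖ ^ 2 ≤
        C * (N ^ z * τ ^ (1 - z) * σ ^ (1 - x) * a ^ (-((n - 2 * z - n * x) / 2))) := by
  have hp := pi_pos
  have hn1 : (2 : ℝ) ≤ n := by exact_mod_cast hn
  have hz2 : (n : ℝ) ≤ z * (n + 1) := (div_le_iff₀ (by linarith)).1 hz'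
  have h12 : 0 < 2 * z - 1 := by nlinarith
  set e := 1 - z with he
  set θ := 1 - x / (2 * z - 1) with hθ
  set β := (1 - (n + 1) * e) / (2 * z - 1) with hβ
  have e1 : θ * (2 * z - 1) = 2 * z - 1 - x := by rw [hθ]; field_simp
  have e2 : β * (2 * z - 1) = 1 - (n + 1) * e := by rw [hβ]; field_simp
  have hθ0 : 0 ≤ θ := by rw [hθ, sub_nonneg, div_le_one h12]; exact hx
  have hθ1 : θ ≤ 1 := by rw [hθ]; linarith [div_nonneg hx0 h12.le]
  have hβ0 : 0 ≤ β := div_nonneg (by rw [he]; nlinarith) h12.le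
  have hβ1 : β < 1 := by rw [hβ, div_lt_one h12, he]; nlinarith
  have hβθ : 2 * β / n ≤ θ := by
    rw [div_le_iff₀ (by linarith)]
    refine le_of_mul_le_mul_right ?_ h12
    rw [mul_assoc, e2, show θ * n * (2 * z - 1) = n * (θ * (2 * z - 1)) by ring, e1, he]
    nlinarith
  have h1e : 1 - 2 * e = 2 * z - 1 := by rw [he]; ring
  have heq1 : 1 - β = e * (n + 1 - 2 * β) := by
    refine mul_right_cancel₀ h12.ne' ?_
    rw [show (1 - β) * (2 * z - 1) = (2 * z - 1) - β * (2 * z - 1) by ring,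
      show e * (n + 1 - 2 * β) * (2 * z - 1) =
        e * ((n + 1) * (2 * z - 1) - 2 * (β * (2 * z - 1))) by ring, e2, he]
    ring
  have hγ : (β - n * θ / 2) * (1 - 2 * e) = -((n - 2 * z - n * x) / 2) := by
    rw [h1e, show (β - n * θ / 2) * (2 * z - 1) = β * (2 * z - 1) - n / 2 * (θ * (2 * z - 1)) by
      ring, e1, e2, he]
    ring
  have hnβ : (n : ℝ) / 2 * (2 * β / n) = β := by field_simp
  have h1β : 0 < 1 - β := by linarith
  set K1 := ((4 * π ^ 2) ^ (n / 2 : ℝ)) ^ (1 - θ)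
  set C1 := (K1 * (π ^ (n / 2 : ℝ)) ^ (θ - 2 * β / n) * (π ^ (n / 2 : ℝ)) ^ (2 * β / n)) *
    (2 / (1 - β)) with hC1
  set C2 := √(π ^ (n : ℝ) * (2 / (n - 1))) with hC2
  refine ⟨C1 + C2, by positivity, ?_⟩
  intro ι _ a ha E σ τ N h hE hσ hτ hN hV hsec hB hh
  obtain ⟨R, hR, hR1, hR2⟩ := exists_balanced_cutoff (x := x) (θ := θ) hN hτ hσ ha
    (by linarith : (1 : ℝ) < n) hβ1 heq1 (by rw [h1e]; exact e1)
  have hmain := sum_setIntegral_waveVec_le_cutoff ha hn hE hσ.le (by positivity) hV hsec hR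
    (a1 := 1 - θ) (a2 := θ - 2 * β / n) (a3 := 2 * β / n) (by linarith) (by linarith)
    (by positivity) (by ring) (by rw [hnβ]; exact hβ1) h hB hh
  rw [hnβ, near_factor_eq ha hσ (by linarith), far_factor_eq hσ hτ hR (by linarith)] at hmain
  refine hmain.trans (le_of_eq ?_)
  rw [hγ, he, show 1 - (1 - z) = z by ring] at hR1 hR2
  rw [add_mul]
  congr 1
  · rw [← hR1, hC1]; ring
  · rw [← hR2, hC2]; ring

/-- Trace estimate for wave vectors on a product-like set, in the full open region. -/
theorem setIntegral_waveVec_le (hn : 2 ≤ n) {x z : ℝ} (hx0 : 0 < x) (hz0 : 0 < z) (hz : z < 1)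
    (hxz : n * x < (n - 1) * z) (hxz2 : 2 * z + n * x < n) :
    ∃ C : ℝ, 0 < C ∧ ∀ {ι : Type} [Fintype ι] {a : ℝ} (ha : 0 < a) {E : Set (ℝ × Rn n)}
      {Θ : Set ℝ} {σ τ N : ℝ} (h : ι → Lp ℂ 2 (volume : Measure (Rn n))), MeasurableSet E →
      MeasurableSet Θ → 0 < σ → 0 ≤ τ → 0 ≤ N → volume Θ ≤ ENNReal.ofReal τ →
      (∀ w ∈ E, w.1 ∈ Θ) →
      (∀ t, volume (Prod.mk t ⁻¹' E) ≤ ENNReal.ofReal σ) →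
      (∀ c : ι → ℂ, ‖∑ j, c j • h j‖ ^ 2 ≤ ∑ j, ‖c j‖ ^ 2) → ∑ j, ‖h j‖ ^ 2 ≤ N →
      ∑ j, ∫ w in E, ‖(inner ℂ (waveVec ha w) (h j) : ℂ)‖ ^ 2 ≤
        C * (N ^ z * τ ^ (1 - z) * σ ^ (1 - x) * a ^ (-((n - 2 * z - n * x) / 2))) := by
  have hp := pi_pos
  have hn1 : (2 : ℝ) ≤ n := by exact_mod_cast hn
  obtain ⟨ϑ, z', hϑ0, hϑ1, hzz, hz1', hz2', hx', hxz'⟩ : ∃ ϑ z' : ℝ, 0 < ϑ ∧ ϑ ≤ 1 ∧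
      z = ϑ * z' ∧ z' < 1 ∧ (n : ℝ) / (n + 1) ≤ z' ∧ x / ϑ ≤ 2 * z' - 1 ∧
      2 * z' + n * (x / ϑ) ≤ n := by
    have hn2 : (0 : ℝ) < n + 1 := by linarith
    rcases le_total ((n : ℝ) / (n + 1)) z with hc | hc
    · have hc' := (div_le_iff₀ hn2).1 hc
      refine ⟨1, z, one_pos, le_rfl, by ring, hz, hc, ?_, by simpa using hxz2.le⟩
      rw [_root_.div_one]; nlinarith
    · have hc' := (le_div_iff₀ hn2).1 hc
      refine ⟨z * (n + 1) / n, n / (n + 1), by positivity, ?_, by field_simp, ?_, le_rfl, ?_, ?_⟩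
      · rw [div_le_one (by linarith)]; exact hc'
      · rw [div_lt_one hn2]; linarith
      · rw [div_div_eq_mul_div, div_le_iff₀ (by positivity)]
        rw [show (2 * ((n : ℝ) / (n + 1)) - 1) * (z * (n + 1)) = (n - 1) * z by
          field_simp; ring]
        linarith
      · rw [div_div_eq_mul_div, ← le_sub_iff_add_le', ← mul_div_assoc,
          div_le_iff₀ (by positivity)]
        rw [show ((n : ℝ) - 2 * (n / (n + 1))) * (z * (n + 1)) = n * ((n - 1) * z) by
          field_simp; ring]
        have := mul_le_mul_of_nonneg_left hxz.le (by linarith : (0 : ℝ) ≤ n)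
        linarith
  obtain ⟨C, hC, hmain⟩ := setIntegral_waveVec_upper_region hn hz1' hz2' hx' hxz'
    (div_nonneg hx0.le hϑ0.le)
  refine ⟨C ^ ϑ * (π ^ (n / 2 : ℝ)) ^ (1 - ϑ), by positivity, ?_⟩
  intro ι _ a ha E Θ σ τ N h hE hΘ hσ hτ hN hΘτ hEΘ hsec hB hh
  have hV := volume_le_of_sections hE hΘ hσ.le hΘτ hEΘ hsec
  rcases hτ.eq_or_lt with rfl | hτ
  · have h0 : volume E = 0 := by simpa using hV
    simp only [setIntegral_measure_zero _ h0, Finset.sum_const_zero]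
    positivity
  rcases hN.eq_or_lt with rfl | hN
  · have h0 : ∀ j, h j = 0 := fun j => by
      have := (Finset.sum_eq_zero_iff_of_nonneg fun j _ => by positivity).1
        (le_antisymm hh (Finset.sum_nonneg fun j _ => by positivity)) j (Finset.mem_univ j)
      simpa using this
    simp only [h0, inner_zero_right, norm_zero]
    simp only [ne_eq, OfNat.ofNat_ne_zero, not_false_eq_true, zero_pow, integral_zero,
      Finset.sum_const_zero]
    positivity
  have b1 := hmain ha h hE hσ hτ hN hV hsec hB hh
  have b2 := sum_setIntegral_waveVec_le_trivial ha (by positivity) hV h hB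
  set B := ∑ j, ∫ w in E, ‖(inner ℂ (waveVec ha w) (h j) : ℂ)‖ ^ 2 with hBdef
  have hB0 : 0 ≤ B := Finset.sum_nonneg fun j _ => integral_nonneg fun w => by positivity
  calc B = B ^ ϑ * B ^ (1 - ϑ) := by
        rw [← Real.rpow_add_of_nonneg hB0 hϑ0.le (by linarith), add_sub_cancel, Real.rpow_one]
    _ ≤ (C * (N ^ z' * τ ^ (1 - z') * σ ^ (1 - x / ϑ) *
          a ^ (-((n - 2 * z' - n * (x / ϑ)) / 2)))) ^ ϑ *
          (σ * τ * (π / a) ^ (n / 2 : ℝ)) ^ (1 - ϑ) := by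
        gcongr
    _ = _ := by
        rw [Real.div_rpow hp.le ha.le, div_eq_mul_inv (π ^ _), ← Real.rpow_neg ha.le]
        have hP : 0 < π ^ (n / 2 : ℝ) := by positivity
        generalize π ^ (n / 2 : ℝ) = P at hP
        obtain ⟨c, rfl⟩ : ∃ y, C = rexp y := ⟨log C, (Real.exp_log hC).symm⟩
        obtain ⟨n', rfl⟩ : ∃ y, N = rexp y := ⟨log N, (Real.exp_log hN).symm⟩
        obtain ⟨t, rfl⟩ : ∃ y, τ = rexp y := ⟨log τ, (Real.exp_log hτ).symm⟩
        obtain ⟨u, rfl⟩ : ∃ y, σ = rexp y := ⟨log σ, (Real.exp_log hσ).symm⟩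
        obtain ⟨v, rfl⟩ : ∃ y, a = rexp y := ⟨log a, (Real.exp_log ha).symm⟩
        obtain ⟨r, rfl⟩ : ∃ y, P = rexp y := ⟨log P, (Real.exp_log hP).symm⟩
        simp only [← Real.exp_mul, ← Real.exp_add]
        congr 1
        rw [hzz]
        field_simp
        ring

end level_sets

section dyadic_sums

/-- The dyadic weight `2 ^ r`, as an extended nonnegative real. -/
def dy (r : ℝ) : ℝ≥0∞ := ENNReal.ofReal ((2 : ℝ) ^ r)

theorem dy_add (r s : ℝ) : dy (r + s) = dy r * dy s := by
  rw [dy, Real.rpow_add two_pos, ENNReal.ofReal_mul (by positivity)]; rfl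

theorem dy_pos (r : ℝ) : 0 < dy r := ENNReal.ofReal_pos.2 (by positivity)

theorem dy_mono {r s : ℝ} (h : r ≤ s) : dy r ≤ dy s :=
  ENNReal.ofReal_le_ofReal (Real.rpow_le_rpow_of_exponent_le one_le_two h)

theorem dy_lt_dy {r s : ℝ} : dy r < dy s ↔ r < s := by
  rw [dy, dy, ENNReal.ofReal_lt_ofReal_iff (by positivity),
    Real.rpow_lt_rpow_left_iff one_lt_two]

theorem dy_rpow (r s : ℝ) : dy r ^ s = dy (r * s) := by
  rw [dy, ENNReal.ofReal_rpow_of_pos (by positivity), ← Real.rpow_mul two_pos.le]; rfl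

theorem dy_zero : dy 0 = 1 := by simp [dy]

theorem dy_one : dy 1 = 2 := by simp [dy]

/-- A finite positive number lies between consecutive integer powers of `2 ^ r`. -/
theorem exists_dy_le_lt {r : ℝ} (hr : 0 < r) {v : ℝ≥0∞} (h0 : v ≠ 0) (h1 : v ≠ ∞) :
    ∃ m : ℤ, dy (r * m) ≤ v ∧ v < dy (r * (m + 1)) := by
  have hv : 0 < v.toReal := ENNReal.toReal_pos h0 h1
  obtain ⟨m, hm1, hm2⟩ := exists_mem_Ico_zpow hv
    (Real.one_lt_rpow one_lt_two hr : (1 : ℝ) < 2 ^ r)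
  refine ⟨m, ?_, ?_⟩
  · rw [← ENNReal.ofReal_toReal h1]
    refine ENNReal.ofReal_le_ofReal ?_
    rwa [Real.rpow_mul two_pos.le, Real.rpow_intCast]
  · rw [← ENNReal.ofReal_toReal h1, dy, ENNReal.ofReal_lt_ofReal_iff (by positivity)]
    rw [Real.rpow_mul two_pos.le]
    exact_mod_cast hm2

theorem exists_dy_lt_le {r : ℝ} (hr : 0 < r) {v : ℝ≥0∞} (h0 : v ≠ 0) (h1 : v ≠ ∞) :
    ∃ m : ℤ, dy (r * m) < v ∧ v ≤ dy (r * (m + 1)) := by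
  have hv : 0 < v.toReal := ENNReal.toReal_pos h0 h1
  obtain ⟨m, hm1, hm2⟩ := exists_mem_Ioc_zpow hv
    (Real.one_lt_rpow one_lt_two hr : (1 : ℝ) < 2 ^ r)
  refine ⟨m, ?_, ?_⟩
  · rw [← ENNReal.ofReal_toReal h1, dy, ENNReal.ofReal_lt_ofReal_iff hv]
    rwa [Real.rpow_mul two_pos.le, Real.rpow_intCast]
  · rw [← ENNReal.ofReal_toReal h1]
    refine ENNReal.ofReal_le_ofReal ?_
    rw [Real.rpow_mul two_pos.le]
    exact_mod_cast hm2

/-- Two-sided geometric sums along an arithmetic progression are bounded uniformly in the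
position of the centre. -/
theorem tsum_dy_neg_abs_le {δ r : ℝ} (hδ : 0 < δ) (hr : r ≠ 0) :
    ∃ C : ℝ, 0 < C ∧ ∀ X : ℝ, ∑' c : ℤ, dy (-(δ * |X - r * c|)) ≤ ENNReal.ofReal C := by
  have hr' : 0 < |r| := abs_pos.2 hr
  set ρ : ℝ := (2 : ℝ) ^ (-(δ * |r|)) with hρ
  have hρ0 : 0 < ρ := by positivity
  have hρ1 : ρ < 1 := Real.rpow_lt_one_of_one_lt_of_neg one_lt_two (by
    have := mul_pos hδ hr'; linarith)
  have hgeo : Summable fun i : ℕ => ρ ^ i := summable_geometric_of_lt_one hρ0.le hρ1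
  have hsum : Summable fun c : ℤ => ρ ^ c.natAbs :=
    Summable.of_nat_of_neg (by simpa using hgeo) (by simpa using hgeo)
  have hT0 : 0 ≤ ∑' c : ℤ, ρ ^ c.natAbs := tsum_nonneg fun c => by positivity
  refine ⟨(2 : ℝ) ^ (δ * |r|) * (∑' c : ℤ, ρ ^ c.natAbs + 1), by positivity, fun X => ?_⟩
  set c0 : ℤ := ⌊X / r⌋ with hc0
  have hterm : ∀ c : ℤ, dy (-(δ * |X - r * c|)) ≤
      ENNReal.ofReal ((2 : ℝ) ^ (δ * |r|)) * ENNReal.ofReal (ρ ^ (c - c0).natAbs) := by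
    intro c
    have h1 : |X - r * c| = |r| * |X / r - c| := by
      rw [← abs_mul]; congr 1; field_simp
    have h2 : |(c : ℝ) - c0| - 1 ≤ |X / r - c| := by
      have h3 : |X / r - c0| ≤ 1 := by
        rw [abs_le]
        exact ⟨by linarith [Int.floor_le (X / r)], by linarith [Int.lt_floor_add_one (X / r)]⟩
      have h4 := abs_sub_abs_le_abs_sub ((c : ℝ) - c0) (X / r - c0)
      rw [show (c : ℝ) - c0 - (X / r - c0) = -(X / r - c) by ring, abs_neg] at h4
      linarith
    have h5 : ρ ^ (c - c0).natAbs = (2 : ℝ) ^ (-(δ * |r|) * |(c : ℝ) - c0|) := by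
      rw [Real.rpow_mul two_pos.le, ← hρ, ← Real.rpow_natCast]
      congr 1
      rw [Nat.cast_natAbs]; push_cast; rfl
    rw [h5]
    change _ ≤ dy _ * dy _
    rw [← dy_add]
    refine dy_mono ?_
    rw [h1]
    have := mul_le_mul_of_nonneg_left h2 (mul_pos hδ hr').le
    nlinarith
  calc ∑' c : ℤ, dy (-(δ * |X - r * c|)) ≤
        ∑' c : ℤ, ENNReal.ofReal ((2 : ℝ) ^ (δ * |r|)) * ENNReal.ofReal (ρ ^ (c - c0).natAbs) :=
      ENNReal.tsum_le_tsum hterm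
    _ = ENNReal.ofReal ((2 : ℝ) ^ (δ * |r|)) * ∑' c : ℤ, ENNReal.ofReal (ρ ^ (c - c0).natAbs) :=
      ENNReal.tsum_mul_left
    _ = ENNReal.ofReal ((2 : ℝ) ^ (δ * |r|)) * ∑' c : ℤ, ENNReal.ofReal (ρ ^ c.natAbs) := by
      congr 1
      exact (Equiv.subRight c0).tsum_eq fun c : ℤ => ENNReal.ofReal (ρ ^ c.natAbs)
    _ = ENNReal.ofReal ((2 : ℝ) ^ (δ * |r|)) * ENNReal.ofReal (∑' c : ℤ, ρ ^ c.natAbs) := by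
      rw [ENNReal.ofReal_tsum_of_nonneg (fun c => by positivity) hsum]
    _ ≤ _ := by
      rw [← ENNReal.ofReal_mul (by positivity)]
      refine ENNReal.ofReal_le_ofReal ?_
      gcongr; linarith

theorem le_two_mul_tsum_dy {v : ℝ≥0∞} (hv : v ≠ ∞) :
    v ≤ 2 * ∑' b : ℤ, if dy b < v then dy b else 0 := by
  rcases eq_or_ne v 0 with rfl | h0
  · exact zero_le
  obtain ⟨m, h1, h2⟩ := exists_dy_lt_le one_pos h0 hv
  rw [one_mul] at h1 h2
  refine h2.trans ?_
  rw [dy_add, dy_one, mul_comm]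
  refine mul_le_mul' le_rfl (le_trans (le_of_eq ?_) (ENNReal.le_tsum m))
  rw [if_pos h1]

theorem tsum_dy_le_rpow {q : ℝ} (hq : 0 < q) : ∃ C : ℝ, 0 < C ∧ ∀ v : ℝ≥0∞,
    ∑' b : ℤ, (if dy b < v then dy (q * b) else 0) ≤ ENNReal.ofReal C * v ^ q := by
  obtain ⟨C, hC, h⟩ := tsum_dy_neg_abs_le hq one_ne_zero
  refine ⟨C, hC, fun v => ?_⟩
  rcases eq_or_ne v ∞ with rfl | hv
  · rw [ENNReal.top_rpow_of_pos hq, ENNReal.mul_top (by simpa using hC)]; exact le_top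
  rcases eq_or_ne v 0 with rfl | h0
  · simp
  obtain ⟨m, h1, h2⟩ := exists_dy_lt_le one_pos h0 hv
  rw [one_mul] at h1 h2
  calc ∑' b : ℤ, (if dy b < v then dy (q * b) else 0)
      ≤ ∑' b : ℤ, dy (-(q * |(m : ℝ) - 1 * b|)) * dy (q * m) := by
        refine ENNReal.tsum_le_tsum fun b => ?_
        split_ifs with hb
        · have hbm : (b : ℝ) < m + 1 := dy_lt_dy.1 (hb.trans_le h2)
          have hbm' : b ≤ m := by
            have : b < m + 1 := by exact_mod_cast hbm
            omega
          have hbm'' : (b : ℝ) ≤ m := by exact_mod_cast hbm'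
          rw [← dy_add]
          refine dy_mono ?_
          rw [one_mul, abs_of_nonneg (by linarith)]
          linarith
        · exact zero_le
    _ = (∑' b : ℤ, dy (-(q * |(m : ℝ) - 1 * b|))) * dy (q * m) := ENNReal.tsum_mul_right
    _ ≤ _ := by
        refine mul_le_mul' (h m) ?_
        rw [mul_comm, ← dy_rpow]
        gcongr

/-- Optimising over the four neighbouring exponents gives exponential off-diagonal decay. -/
theorem dyadic_term_le {n N τ x z δ η C T : ℝ} (hn : 0 ≤ n) (hN : 0 ≤ N) (hτ : 0 ≤ τ)
    (hC : 0 ≤ C) (hz0 : 0 < z - δ) (hz1 : z + δ < 1) (hδ : 0 < δ) (hη : 0 < η)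
    (hx0 : 0 ≤ x - η) (hx1 : x + η ≤ 1) (b c m k : ℝ)
    (hT : ∀ ζ η' : ℝ, (ζ = δ ∨ ζ = -δ) → (η' = η ∨ η' = -η) →
      T ≤ C * (N ^ (z + ζ) * τ ^ (1 - (z + ζ)) * ((2 : ℝ) ^ (n * (m + 1))) ^ (1 - (x + η')) *
        (2 : ℝ) ^ (k * (-2 * ζ - n * η')))) :
    (2 : ℝ) ^ (b + c) * (2 : ℝ) ^ (n * η / 2 * |k + m|) * T ≤
      C * 2 ^ n * ((2 : ℝ) ^ (-(n * η / 2 * |k + m|)) *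
        (2 : ℝ) ^ (-(δ * |1 / z * b + 2 * k - 1 / (1 - z) * (c + n * m * (1 - x))|)) *
        (N * (2 : ℝ) ^ (1 / z * b) + τ * (2 : ℝ) ^ (1 / (1 - z) * (c + n * m * (1 - x))))) := by
  have hz : 0 < z := by linarith
  have hz' : 0 < 1 - z := by linarith
  set X := 1 / z * b + 2 * k - 1 / (1 - z) * (c + n * m * (1 - x)) with hX
  obtain ⟨ζ, hζ, hζX⟩ : ∃ ζ, (ζ = δ ∨ ζ = -δ) ∧ ζ * X = δ * |X| := by
    rcases le_total 0 X with h | h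
    · exact ⟨δ, Or.inl rfl, by rw [abs_of_nonneg h]⟩
    · exact ⟨-δ, Or.inr rfl, by rw [abs_of_nonpos h]; ring⟩
  obtain ⟨η', hη', hηX⟩ : ∃ η', (η' = η ∨ η' = -η) ∧ η' * (k + m) = η * |k + m| := by
    rcases le_total 0 (k + m) with h | h
    · exact ⟨η, Or.inl rfl, by rw [abs_of_nonneg h]⟩
    · exact ⟨-η, Or.inr rfl, by rw [abs_of_nonpos h]; ring⟩
  have hT' := hT ζ η' hζ hη'
  have ha0 : 0 ≤ z + ζ := by rcases hζ with rfl | rfl <;> linarith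
  have ha1 : 0 ≤ 1 - (z + ζ) := by rcases hζ with rfl | rfl <;> linarith
  have hb0 : 0 ≤ 1 - (x + η') := by rcases hη' with rfl | rfl <;> linarith
  have hb1 : 1 - (x + η') ≤ 1 := by rcases hη' with rfl | rfl <;> linarith
  set P := N * (2 : ℝ) ^ (1 / z * b) with hP
  set Q := τ * (2 : ℝ) ^ (1 / (1 - z) * (c + n * m * (1 - x))) with hQ
  have hP0 : 0 ≤ P := by positivity
  have hQ0 : 0 ≤ Q := by positivity
  have hgm : P ^ (z + ζ) * Q ^ (1 - (z + ζ)) ≤ P + Q := by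
    refine (Real.geom_mean_le_arith_mean2_weighted ha0 ha1 hP0 hQ0 (by ring)).trans ?_
    nlinarith
  have hPQ : P ^ (z + ζ) * Q ^ (1 - (z + ζ)) = N ^ (z + ζ) * τ ^ (1 - (z + ζ)) *
      (2 : ℝ) ^ (1 / z * b * (z + ζ) + 1 / (1 - z) * (c + n * m * (1 - x)) * (1 - (z + ζ))) := by
    rw [hP, hQ, Real.mul_rpow hN (by positivity), Real.mul_rpow hτ (by positivity),
      Real.rpow_add two_pos, ← Real.rpow_mul two_pos.le, ← Real.rpow_mul two_pos.le]
    ring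
  have hσ : ((2 : ℝ) ^ (n * (m + 1))) ^ (1 - (x + η')) ≤
      2 ^ n * (2 : ℝ) ^ (n * m * (1 - (x + η'))) := by
    rw [← Real.rpow_mul two_pos.le, ← Real.rpow_add two_pos]
    refine Real.rpow_le_rpow_of_exponent_le one_le_two ?_
    nlinarith [mul_le_mul_of_nonneg_left hb1 hn]
  calc (2 : ℝ) ^ (b + c) * (2 : ℝ) ^ (n * η / 2 * |k + m|) * T
      ≤ (2 : ℝ) ^ (b + c) * (2 : ℝ) ^ (n * η / 2 * |k + m|) *
        (C * (N ^ (z + ζ) * τ ^ (1 - (z + ζ)) * (2 ^ n * (2 : ℝ) ^ (n * m * (1 - (x + η')))) *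
        (2 : ℝ) ^ (k * (-2 * ζ - n * η')))) := by
        refine mul_le_mul_of_nonneg_left (hT'.trans ?_) (by positivity)
        gcongr
    _ = C * 2 ^ n * ((2 : ℝ) ^ (-(n * η / 2 * |k + m|)) * (2 : ℝ) ^ (-(δ * |X|)) *
          (P ^ (z + ζ) * Q ^ (1 - (z + ζ)))) := by
        rw [hPQ]
        have : (2 : ℝ) ^ (b + c) * (2 : ℝ) ^ (n * η / 2 * |k + m|) *
            (2 : ℝ) ^ (n * m * (1 - (x + η'))) * (2 : ℝ) ^ (k * (-2 * ζ - n * η')) =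
            (2 : ℝ) ^ (-(n * η / 2 * |k + m|)) * (2 : ℝ) ^ (-(δ * |X|)) *
            (2 : ℝ) ^ (1 / z * b * (z + ζ) +
              1 / (1 - z) * (c + n * m * (1 - x)) * (1 - (z + ζ))) := by
          simp only [← Real.rpow_add two_pos]
          congr 1
          rw [← hζX, hX, show n * η / 2 * |k + m| = n / 2 * (η' * (k + m)) by rw [hηX]; ring]
          field_simp
          ring
        linear_combination (C * 2 ^ n * N ^ (z + ζ) * τ ^ (1 - (z + ζ))) * this
    _ ≤ _ := by gcongr

/-- Summation of the off-diagonally decaying bounds. -/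
theorem tsum_dyadic_le {ε δ q q' r : ℝ} (hε : 0 < ε) (hδ : 0 < δ) (hq : q ≠ 0) (hq' : q' ≠ 0) :
    ∃ C : ℝ, 0 < C ∧ ∀ A B : ℤ → ℤ → ℝ≥0∞,
      ∑' (b : ℤ) (c : ℤ) (m : ℤ) (k : ℤ), dy (-(ε * |(k : ℝ) + m|)) *
        dy (-(δ * |q * b + 2 * k - q' * (c + r * m)|)) * (A k b + B c m) ≤
      ENNReal.ofReal C * (∑' (k : ℤ) (b : ℤ), A k b + ∑' (c : ℤ) (m : ℤ), B c m) := by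
  obtain ⟨C1, hC1, h1⟩ := tsum_dy_neg_abs_le hε (neg_ne_zero.2 one_ne_zero)
  obtain ⟨C2, hC2, h2⟩ := tsum_dy_neg_abs_le hδ hq'
  obtain ⟨C3, hC3, h3⟩ := tsum_dy_neg_abs_le hδ (neg_ne_zero.2 hq)
  refine ⟨C1 * (C2 + C3), by positivity, fun A B => ?_⟩
  have hsplit : ∑' (b : ℤ) (c : ℤ) (m : ℤ) (k : ℤ), dy (-(ε * |(k : ℝ) + m|)) *
        dy (-(δ * |q * b + 2 * k - q' * (c + r * m)|)) * (A k b + B c m) =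
      ∑' (b : ℤ) (k : ℤ) (m : ℤ) (c : ℤ), A k b * (dy (-(ε * |(k : ℝ) + m|)) *
        dy (-(δ * |q * b + 2 * k - q' * (c + r * m)|))) +
      ∑' (c : ℤ) (m : ℤ) (k : ℤ) (b : ℤ), B c m * (dy (-(ε * |(k : ℝ) + m|)) *
        dy (-(δ * |q * b + 2 * k - q' * (c + r * m)|))) := by
    simp only [mul_add, ENNReal.tsum_add]
    congr 1
    · refine tsum_congr fun b => ?_
      rw [ENNReal.tsum_comm]
      refine (tsum_congr fun m => ENNReal.tsum_comm).trans ?_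
      rw [ENNReal.tsum_comm]
      refine tsum_congr fun k => tsum_congr fun m => tsum_congr fun c => mul_comm _ _
    · rw [ENNReal.tsum_comm]
      refine tsum_congr fun c => ?_
      rw [ENNReal.tsum_comm]
      refine tsum_congr fun m => ?_
      rw [ENNReal.tsum_comm]
      refine tsum_congr fun k => tsum_congr fun b => mul_comm _ _
  rw [hsplit, ENNReal.ofReal_mul hC1.le, ENNReal.ofReal_add hC2.le hC3.le, mul_add]
  refine add_le_add ?_ ?_
  · rw [ENNReal.tsum_comm]
    simp only [← ENNReal.tsum_mul_left]
    refine ENNReal.tsum_le_tsum fun k => ENNReal.tsum_le_tsum fun b => ?_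
    simp only [ENNReal.tsum_mul_left]
    rw [mul_comm]
    refine mul_le_mul' ?_ le_rfl
    calc _ ≤ ∑' m : ℤ, dy (-(ε * |(k : ℝ) - -1 * m|)) * ENNReal.ofReal C2 := by
          refine ENNReal.tsum_le_tsum fun m => ?_
          refine mul_le_mul' (le_of_eq ?_) (le_trans (le_of_eq ?_)
            (h2 (q * b + 2 * k - q' * (r * m))))
          · congr 4; ring
          · refine tsum_congr fun c => ?_
            congr 4; ring
      _ ≤ ENNReal.ofReal C1 * (ENNReal.ofReal C2 + ENNReal.ofReal C3) := by
          rw [ENNReal.tsum_mul_right]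
          exact mul_le_mul' (h1 k) le_self_add
  · simp only [← ENNReal.tsum_mul_left]
    refine ENNReal.tsum_le_tsum fun c => ENNReal.tsum_le_tsum fun m => ?_
    simp only [ENNReal.tsum_mul_left]
    rw [mul_comm]
    refine mul_le_mul' ?_ le_rfl
    calc _ ≤ ∑' k : ℤ, dy (-(ε * |(m : ℝ) - -1 * k|)) * ENNReal.ofReal C3 := by
          refine ENNReal.tsum_le_tsum fun k => ?_
          refine mul_le_mul' (le_of_eq ?_) (le_trans (le_of_eq ?_)
            (h3 (2 * k - q' * (c + r * m))))
          · congr 4; ring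
          · refine tsum_congr fun b => ?_
            congr 4; ring
      _ ≤ ENNReal.ofReal C1 * (ENNReal.ofReal C2 + ENNReal.ofReal C3) := by
          rw [ENNReal.tsum_mul_right]
          exact mul_le_mul' (h1 m) le_add_self

end dyadic_sums

section dyadic_pieces

variable {n : ℕ}

/-- The wave vector damped at the scale of frequencies `|ξ| ∼ 2 ^ k`. -/
def dyWave (k : ℤ) (w : ℝ × Rn n) : Lp ℂ 2 (volume : Measure (Rn n)) :=
  waveVec (a := (2 : ℝ) ^ (-2 * (k : ℝ))) (by positivity) w

theorem sum_lintegral_inner_waveVec_eq {ι : Type*} [Fintype ι] {a : ℝ} (ha : 0 < a)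
    {E : Set (ℝ × Rn n)} (hE : volume E ≠ ∞) (h : ι → Lp ℂ 2 (volume : Measure (Rn n))) :
    ∑ j, ∫⁻ w in E, ‖(inner ℂ (waveVec ha w) (h j) : ℂ)‖ₑ ^ 2 =
      ENNReal.ofReal (∑ j, ∫ w in E, ‖(inner ℂ (waveVec ha w) (h j) : ℂ)‖ ^ 2) := by
  rw [ENNReal.ofReal_sum_of_nonneg fun j _ => integral_nonneg fun w => by positivity]
  refine Finset.sum_congr rfl fun j _ => ?_
  rw [ofReal_integral_eq_lintegral_ofReal]
  · refine lintegral_congr fun w => ?_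
    rw [ENNReal.ofReal_pow (norm_nonneg _), ofReal_norm]
  · refine Measure.integrableOn_of_bounded (M := (π / a) ^ (n / 2 : ℝ) * ‖h j‖ ^ 2) hE
      (((stronglyMeasurable_waveVec ha).inner
        stronglyMeasurable_const).norm.pow 2).aestronglyMeasurable
      (Filter.Eventually.of_forall fun z => ?_)
    rw [norm_pow, norm_norm, ← norm_waveVec_sq ha z, ← mul_pow]
    exact pow_le_pow_left₀ (norm_nonneg _) (norm_inner_le_norm _ _) 2
  · exact Filter.Eventually.of_forall fun w => by positivity

theorem exists_region_margin {ν x z : ℝ} (hν : 2 ≤ ν) (hx0 : 0 < x) (hz0 : 0 < z) (hz : z < 1)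
    (hxz : ν * x < (ν - 1) * z) (hxz2 : 2 * z + ν * x < ν) :
    ∃ δ, 0 < δ ∧ δ < x ∧ δ < z ∧ z + δ < 1 ∧ x + δ < 1 ∧
      ν * (x + δ) < (ν - 1) * (z - δ) ∧ 2 * (z + δ) + ν * (x + δ) < ν := by
  have hν0 : 0 < ν := by linarith
  have g1 : 0 < ((ν - 1) * z - ν * x) / (4 * ν) := div_pos (by linarith) (by linarith)
  have g2 : 0 < (ν - 2 * z - ν * x) / (4 * ν) := div_pos (by linarith) (by linarith)
  obtain ⟨δ, hδ0, hδ⟩ := exists_between (lt_min (lt_min hx0 hz0)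
    (lt_min (sub_pos.2 hz) (lt_min g1 g2)))
  simp only [lt_min_iff, lt_div_iff₀ (by linarith : 0 < 4 * ν)] at hδ
  obtain ⟨⟨d1, d2⟩, d3, d4, d5⟩ := hδ
  have hp : 0 < δ * ν := by positivity
  have h2 : δ * 2 ≤ δ * ν := by gcongr
  have h6 : ν * (x + δ) < (ν - 1) * (z - δ) := by nlinarith
  refine ⟨δ, hδ0, d1, d2, by linarith, ?_, h6, by nlinarith⟩
  nlinarith

/-- The bound for one dyadic piece, with exponential decay off the diagonal. -/
theorem dyWave_term_le (hn : 2 ≤ n) {x z : ℝ} (hx0 : 0 < x) (hz0 : 0 < z) (hz : z < 1)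
    (hxz : n * x < (n - 1) * z) (hxz2 : 2 * z + n * x < n) :
    ∃ ε δ C : ℝ, 0 < ε ∧ 0 < δ ∧ 0 < C ∧ ∀ {ι : Type} [Fintype ι] (b c m k : ℤ)
      {E : Set (ℝ × Rn n)} {Θ : Set ℝ} {τ N : ℝ} (h : ι → Lp ℂ 2 (volume : Measure (Rn n))),
      MeasurableSet E → MeasurableSet Θ → 0 ≤ τ → 0 ≤ N → volume Θ ≤ ENNReal.ofReal τ →
      (∀ w ∈ E, w.1 ∈ Θ) → (∀ t, volume (Prod.mk t ⁻¹' E) ≤ dy (n * (m + 1))) →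
      (∀ c : ι → ℂ, ‖∑ j, c j • h j‖ ^ 2 ≤ ∑ j, ‖c j‖ ^ 2) → ∑ j, ‖h j‖ ^ 2 ≤ N →
      dy (b + c) * dy (ε * |(k : ℝ) + m|) * (dy (-(k * (n - 2 * z - n * x))) *
        ∑ j, ∫⁻ w in E, ‖(inner ℂ (dyWave k w) (h j) : ℂ)‖ₑ ^ 2) ≤
      ENNReal.ofReal C * (dy (-(ε * |(k : ℝ) + m|)) *
        dy (-(δ * |1 / z * b + 2 * k - 1 / (1 - z) * (c + n * (1 - x) * m)|)) *
        (ENNReal.ofReal N * dy (1 / z * b) +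
          ENNReal.ofReal τ * dy (1 / (1 - z) * (c + n * (1 - x) * m)))) := by
  have hn1 : (2 : ℝ) ≤ n := by exact_mod_cast hn
  obtain ⟨δ, hδ, d1, d2, d3, d4, d5, d6⟩ := exists_region_margin hn1 hx0 hz0 hz hxz hxz2
  have hreg : ∀ ζ η' : ℝ, (ζ = δ ∨ ζ = -δ) → (η' = δ ∨ η' = -δ) → 0 < x + η' ∧ 0 < z + ζ ∧
      z + ζ < 1 ∧ n * (x + η') < (n - 1) * (z + ζ) ∧ 2 * (z + ζ) + n * (x + η') < n := by
    have h4 : 0 < (n : ℝ) * δ := by positivity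
    rintro ζ η' (rfl | rfl) (rfl | rfl) <;>
      refine ⟨by linarith, by linarith, by linarith, by nlinarith, by nlinarith⟩
  have hkey : ∀ ζ η' : ℝ, (ζ = δ ∨ ζ = -δ) → (η' = δ ∨ η' = -δ) → _ := fun ζ η' h1 h2 =>
    setIntegral_waveVec_le hn (hreg ζ η' h1 h2).1 (hreg ζ η' h1 h2).2.1 (hreg ζ η' h1 h2).2.2.1
      (hreg ζ η' h1 h2).2.2.2.1 (hreg ζ η' h1 h2).2.2.2.2
  obtain ⟨C1, hC1, k1⟩ := hkey δ δ (Or.inl rfl) (Or.inl rfl)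
  obtain ⟨C2, hC2, k2⟩ := hkey δ (-δ) (Or.inl rfl) (Or.inr rfl)
  obtain ⟨C3, hC3, k3⟩ := hkey (-δ) δ (Or.inr rfl) (Or.inl rfl)
  obtain ⟨C4, hC4, k4⟩ := hkey (-δ) (-δ) (Or.inr rfl) (Or.inr rfl)
  refine ⟨n * δ / 2, δ, (C1 + C2 + C3 + C4) * 2 ^ (n : ℝ), by positivity, hδ, by positivity, ?_⟩
  intro ι _ b c m k E Θ τ N h hE hΘ hτ hN hΘτ hEΘ hsec hB hh
  have hσ0 : (0 : ℝ) < 2 ^ ((n : ℝ) * (m + 1)) := by positivity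
  have hV := volume_le_of_sections hE hΘ hσ0.le hΘτ hEΘ hsec
  have ha : (0 : ℝ) < (2 : ℝ) ^ (-2 * (k : ℝ)) := by positivity
  set S := ∑ j, ∫ w in E, ‖(inner ℂ (waveVec ha w) (h j) : ℂ)‖ ^ 2 with hS
  have hS0 : 0 ≤ S := Finset.sum_nonneg fun j _ => integral_nonneg fun w => by positivity
  have hSe : ∑ j, ∫⁻ w in E, ‖(inner ℂ (dyWave k w) (h j) : ℂ)‖ₑ ^ 2 = ENNReal.ofReal S :=
    sum_lintegral_inner_waveVec_eq ha (hV.trans_lt ENNReal.ofReal_lt_top).ne h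
  have hT : ∀ ζ η' : ℝ, (ζ = δ ∨ ζ = -δ) → (η' = δ ∨ η' = -δ) →
      (2 : ℝ) ^ (-(k * (n - 2 * z - n * x))) * S ≤ (C1 + C2 + C3 + C4) *
        (N ^ (z + ζ) * τ ^ (1 - (z + ζ)) *
        ((2 : ℝ) ^ ((n : ℝ) * (m + 1))) ^ (1 - (x + η')) *
        (2 : ℝ) ^ ((k : ℝ) * (-2 * ζ - n * η'))) := by
    intro ζ η' hζ hη'
    have hb : S ≤ (C1 + C2 + C3 + C4) * (N ^ (z + ζ) * τ ^ (1 - (z + ζ)) *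
        ((2 : ℝ) ^ ((n : ℝ) * (m + 1))) ^ (1 - (x + η')) *
        ((2 : ℝ) ^ (-2 * (k : ℝ))) ^ (-((n - 2 * (z + ζ) - n * (x + η')) / 2))) := by
      rcases hζ with rfl | rfl <;> rcases hη' with rfl | rfl
      · refine (k1 ha h hE hΘ hσ0 hτ hN hΘτ hEΘ hsec hB hh).trans ?_
        gcongr; linarith
      · refine (k2 ha h hE hΘ hσ0 hτ hN hΘτ hEΘ hsec hB hh).trans ?_
        gcongr; linarith
      · refine (k3 ha h hE hΘ hσ0 hτ hN hΘτ hEΘ hsec hB hh).trans ?_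
        gcongr; linarith
      · refine (k4 ha h hE hΘ hσ0 hτ hN hΘτ hEΘ hsec hB hh).trans ?_
        gcongr; linarith
    refine (mul_le_mul_of_nonneg_left hb (by positivity)).trans (le_of_eq ?_)
    have : (2 : ℝ) ^ (-((k : ℝ) * (n - 2 * z - n * x))) *
        ((2 : ℝ) ^ (-2 * (k : ℝ))) ^ (-((n - 2 * (z + ζ) - n * (x + η')) / 2)) =
        (2 : ℝ) ^ ((k : ℝ) * (-2 * ζ - n * η')) := by
      rw [← Real.rpow_mul two_pos.le, ← Real.rpow_add two_pos]
      congr 1; ring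
    rw [← this]; ring
  have hmain := dyadic_term_le (by linarith : (0 : ℝ) ≤ n) hN hτ (by positivity) (by linarith) d3
    hδ hδ (by linarith) d4.le b c m k hT
  rw [hSe]
  have hre : (c : ℝ) + n * (1 - x) * m = c + n * m * (1 - x) := by ring
  rw [hre]
  simp only [dy]
  rw [← ENNReal.ofReal_mul (by positivity), ← ENNReal.ofReal_mul (by positivity),
    ← ENNReal.ofReal_mul (by positivity), ← ENNReal.ofReal_mul (by positivity),
    ← ENNReal.ofReal_mul (by positivity), ← ENNReal.ofReal_mul (by positivity),
    ← ENNReal.ofReal_add (by positivity) (by positivity), ← ENNReal.ofReal_mul (by positivity),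
    ← ENNReal.ofReal_mul (by positivity)]
  exact ENNReal.ofReal_le_ofReal hmain

theorem lintegral_mul_le_tsum_levels {X : Type*} [MeasurableSpace X] {μ : Measure X}
    {V W : X → ℝ≥0∞} (hV : Measurable V) (hW : Measurable W) (hVt : ∀ w, V w ≠ ∞) :
    ∫⁻ w, V w * W w ∂μ ≤ 2 * ∑' c : ℤ, dy c * ∫⁻ w in {w | dy c < V w}, W w ∂μ := by
  have hS : ∀ c : ℤ, MeasurableSet {w | dy c < V w} := fun c =>
    measurableSet_lt measurable_const hV
  have hm : ∀ c : ℤ, Measurable fun w => dy c * ({w | dy c < V w}.indicator W w) := fun c =>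
    (hW.indicator (hS c)).const_mul _
  calc ∫⁻ w, V w * W w ∂μ
      ≤ ∫⁻ w, 2 * ∑' c : ℤ, dy c * ({w | dy c < V w}.indicator W w) ∂μ := by
        refine lintegral_mono fun w => ?_
        refine (mul_le_mul' (le_two_mul_tsum_dy (hVt w)) le_rfl).trans (le_of_eq ?_)
        rw [mul_assoc, ← ENNReal.tsum_mul_right]
        congr 1
        refine tsum_congr fun c => ?_
        by_cases h : dy c < V w <;> simp [h]
    _ = _ := by
        rw [lintegral_const_mul _ (Measurable.tsum hm),
          lintegral_tsum fun c => (hm c).aemeasurable]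
        congr 1
        refine tsum_congr fun c => ?_
        rw [lintegral_const_mul _ (hW.indicator (hS c)), lintegral_indicator (hS c)]

/-- Decomposition of a set according to the dyadic size of its time sections. -/
theorem lintegral_le_tsum_sections (hn : 0 < n) {S : Set (ℝ × Rn n)} (hS : MeasurableSet S)
    (hfin : ∀ t, volume (Prod.mk t ⁻¹' S) ≠ ∞) (W : ℝ × Rn n → ℝ≥0∞) :
    ∫⁻ w in S, W w ≤ ∑' m : ℤ, ∫⁻ w in S ∩ Prod.fst ⁻¹'
      {t | dy (n * m) ≤ volume (Prod.mk t ⁻¹' S) ∧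
        volume (Prod.mk t ⁻¹' S) < dy (n * (m + 1))}, W w := by
  have hn' : (0 : ℝ) < n := by exact_mod_cast hn
  have hD : Measurable fun t => volume (Prod.mk t ⁻¹' S) := measurable_measure_prodMk_left hS
  set Z := S ∩ Prod.fst ⁻¹' {t | volume (Prod.mk t ⁻¹' S) = 0} with hZ
  have hZm : MeasurableSet Z := hS.inter (measurable_fst (hD (measurableSet_singleton 0)))
  have hZ0 : volume Z = 0 := by
    rw [Measure.volume_eq_prod, Measure.prod_apply hZm]
    refine lintegral_eq_zero_of_ae_eq_zero (Filter.Eventually.of_forall fun t => ?_)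
    by_cases ht : volume (Prod.mk t ⁻¹' S) = 0
    · exact measure_mono_null (preimage_mono inter_subset_left) ht
    · have : Prod.mk t ⁻¹' Z = ∅ := by
        ext x; simp [hZ, ht]
      simp [this]
  have hsub : S ⊆ (⋃ m : ℤ, S ∩ Prod.fst ⁻¹'
      {t | dy (n * m) ≤ volume (Prod.mk t ⁻¹' S) ∧
        volume (Prod.mk t ⁻¹' S) < dy (n * (m + 1))}) ∪ Z := by
    intro w hw
    by_cases h0 : volume (Prod.mk w.1 ⁻¹' S) = 0
    · exact Or.inr ⟨hw, h0⟩
    · obtain ⟨m, hm1, hm2⟩ := exists_dy_le_lt hn' h0 (hfin w.1)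
      exact Or.inl (mem_iUnion.2 ⟨m, hw, hm1, hm2⟩)
  calc ∫⁻ w in S, W w ≤ _ := lintegral_mono_set hsub
    _ ≤ _ := lintegral_union_le _ _ _
    _ ≤ _ := by
        rw [setLIntegral_measure_zero _ _ hZ0, add_zero]
        exact lintegral_iUnion_le _ _

theorem tsum_rpow_le_rpow_tsum {ι : Type*} {r : ℝ} (hr : 1 ≤ r) (a : ι → ℝ≥0∞) :
    ∑' i, a i ^ r ≤ (∑' i, a i) ^ r := by
  have h : ∀ y : ℝ≥0∞, y ^ r = y * y ^ (r - 1) := fun y => by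
    conv_lhs => rw [show r = 1 + (r - 1) by ring]
    rw [ENNReal.rpow_add_of_nonneg _ _ zero_le_one (by linarith), ENNReal.rpow_one]
  rw [h, ← ENNReal.tsum_mul_right]
  refine ENNReal.tsum_le_tsum fun i => ?_
  rw [h]
  exact mul_le_mul' le_rfl (ENNReal.rpow_le_rpow (ENNReal.le_tsum i) (by linarith))

/-- The dyadic time sets recover the mixed norm. -/
theorem tsum_volume_levels_le {x z : ℝ} (hx1 : x < 1) (hz : z < 1) (hxz : x ≤ z) :
    ∃ C : ℝ, 0 < C ∧ ∀ {V : ℝ × Rn n → ℝ≥0∞}, Measurable V →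
      ∑' (c : ℤ) (m : ℤ), volume {t | dy (n * m) ≤ volume (Prod.mk t ⁻¹' {w | dy c < V w}) ∧
          volume (Prod.mk t ⁻¹' {w | dy c < V w}) < dy (n * (m + 1))} *
        dy (1 / (1 - z) * (c + n * (1 - x) * m)) ≤
      ENNReal.ofReal C *
        ∫⁻ t, (∫⁻ y, V (t, y) ^ (1 / (1 - x))) ^ ((1 - x) / (1 - z)) := by
  have hx' : 0 < 1 - x := by linarith
  have hz' : 0 < 1 - z := by linarith
  have hr : 1 ≤ (1 - x) / (1 - z) := by rw [one_le_div hz']; linarith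
  obtain ⟨C, hC, hdy⟩ := tsum_dy_le_rpow (show 0 < 1 / (1 - x) by positivity)
  refine ⟨C ^ ((1 - x) / (1 - z)), by positivity, fun {V} hV => ?_⟩
  have hS : ∀ c : ℤ, MeasurableSet {w : ℝ × Rn n | dy c < V w} := fun c =>
    measurableSet_lt measurable_const hV
  set D : ℤ → ℝ → ℝ≥0∞ := fun c t => volume (Prod.mk t ⁻¹' {w | dy c < V w}) with hD
  have hDm : ∀ c, Measurable (D c) := fun c => measurable_measure_prodMk_left (hS c)
  set Θ : ℤ → ℤ → Set ℝ := fun c m => {t | dy (n * m) ≤ D c t ∧ D c t < dy (n * (m + 1))} with hΘ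
  have hΘm : ∀ c m, MeasurableSet (Θ c m) := fun c m =>
    (measurableSet_le measurable_const (hDm c)).inter
      (measurableSet_lt (hDm c) measurable_const)
  have hind : ∀ c m, Measurable ((Θ c m).indicator
      fun _ : ℝ => dy (1 / (1 - z) * (c + n * (1 - x) * m))) := fun c m =>
    measurable_const.indicator (hΘm c m)
  have hpt : ∀ (c : ℤ) (t : ℝ), ∑' m : ℤ, (Θ c m).indicator
      (fun _ : ℝ => dy (1 / (1 - z) * (c + n * (1 - x) * m))) t ≤
      (dy (1 / (1 - x) * c) * D c t) ^ ((1 - x) / (1 - z)) := by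
    intro c t
    by_cases h : ∃ m, t ∈ Θ c m
    · obtain ⟨m, hm⟩ := h
      rw [tsum_eq_single m]
      · rw [indicator_of_mem hm]
        refine le_trans (le_of_eq ?_)
          (ENNReal.rpow_le_rpow (mul_le_mul' le_rfl hm.1) (by linarith))
        rw [← dy_add, dy_rpow]
        congr 1; field_simp
      · intro m' hm'
        refine indicator_of_notMem (fun h' => hm' ?_) _
        have hn0 : (0 : ℝ) ≤ n := Nat.cast_nonneg n
        have h1 := dy_lt_dy.1 (h'.1.trans_lt hm.2)
        have h2 := dy_lt_dy.1 (hm.1.trans_lt h'.2)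
        have h3 := lt_of_mul_lt_mul_left h1 hn0
        have h4 := lt_of_mul_lt_mul_left h2 hn0
        have h5 : m' < m + 1 := by exact_mod_cast h3
        have h6 : m < m' + 1 := by exact_mod_cast h4
        omega
    · have : ∀ m : ℤ, (Θ c m).indicator
          (fun _ : ℝ => dy (1 / (1 - z) * (c + n * (1 - x) * m))) t = 0 := fun m =>
        indicator_of_notMem (fun hm => h ⟨m, hm⟩) _
      rw [ENNReal.tsum_eq_zero.2 this]
      exact zero_le
  calc _ = ∑' (c : ℤ) (m : ℤ), ∫⁻ t, (Θ c m).indicator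
          (fun _ : ℝ => dy (1 / (1 - z) * (c + n * (1 - x) * m))) t := by
        refine tsum_congr fun c => tsum_congr fun m => ?_
        rw [lintegral_indicator_const (hΘm c m), mul_comm]
    _ = ∫⁻ t, ∑' (c : ℤ) (m : ℤ), (Θ c m).indicator
          (fun _ : ℝ => dy (1 / (1 - z) * (c + n * (1 - x) * m))) t := by
        rw [lintegral_tsum fun c => (Measurable.tsum fun m => hind c m).aemeasurable]
        refine tsum_congr fun c => ?_
        rw [lintegral_tsum fun m => (hind c m).aemeasurable]
    _ ≤ ∫⁻ t, (ENNReal.ofReal C * ∫⁻ y, V (t, y) ^ (1 / (1 - x))) ^ ((1 - x) / (1 - z)) := by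
        refine lintegral_mono fun t => ?_
        refine (ENNReal.tsum_le_tsum fun c => hpt c t).trans
          ((tsum_rpow_le_rpow_tsum hr _).trans ?_)
        refine ENNReal.rpow_le_rpow ?_ (by linarith)
        have hVt : Measurable fun y => V (t, y) := hV.comp measurable_prodMk_left
        have hSt : ∀ c : ℤ, MeasurableSet {y | dy c < V (t, y)} := fun c =>
          measurableSet_lt measurable_const hVt
        calc ∑' c : ℤ, dy (1 / (1 - x) * c) * D c t
            = ∑' c : ℤ, ∫⁻ y, {y | dy c < V (t, y)}.indicator
                (fun _ => dy (1 / (1 - x) * c)) y := by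
              refine tsum_congr fun c => ?_
              rw [lintegral_indicator_const (hSt c)]; rfl
          _ = ∫⁻ y, ∑' c : ℤ, {y | dy c < V (t, y)}.indicator
                (fun _ => dy (1 / (1 - x) * c)) y :=
              (lintegral_tsum fun c => (measurable_const.indicator (hSt c)).aemeasurable).symm
          _ ≤ ∫⁻ y, ENNReal.ofReal C * V (t, y) ^ (1 / (1 - x)) := by
              refine lintegral_mono fun y => le_trans (le_of_eq ?_) (hdy (V (t, y)))
              refine tsum_congr fun c => ?_
              simp only [indicator_apply, mem_ofPred_eq]
          _ = _ := lintegral_const_mul _ (hVt.pow_const _)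
    _ = _ := by
        rw [← ENNReal.ofReal_rpow_of_pos hC, ← lintegral_const_mul]
        · refine lintegral_congr fun t => ?_
          rw [ENNReal.mul_rpow_of_nonneg _ _ (by linarith)]
        · exact ((hV.pow_const _).lintegral_prod_right').pow_const _

end dyadic_pieces

section linearized_bound

variable {n : ℕ}

theorem measurable_enorm_inner_dyWave (k : ℤ) (g : Lp ℂ 2 (volume : Measure (Rn n))) :
    Measurable fun w : ℝ × Rn n => ‖(inner ℂ (dyWave k w) g : ℂ)‖ₑ ^ 2 :=
  (((stronglyMeasurable_waveVec _).inner stronglyMeasurable_const).measurable.enorm).pow_const 2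

theorem contraction_restrict {ι : Type*} [Fintype ι] {H : Type*} [NormedAddCommGroup H]
    [NormedSpace ℂ H] {h : ι → H} (hB : ∀ c : ι → ℂ, ‖∑ j, c j • h j‖ ^ 2 ≤ ∑ j, ‖c j‖ ^ 2)
    (P : ι → Prop) [DecidablePred P] (c : ι → ℂ) :
    ‖∑ j, c j • (if P j then h j else 0)‖ ^ 2 ≤ ∑ j, ‖c j‖ ^ 2 := by
  have h1 : ∑ j, c j • (if P j then h j else 0) = ∑ j, (if P j then c j else 0) • h j :=
    Finset.sum_congr rfl fun j _ => by split_ifs <;> simp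
  rw [h1]
  refine (hB _).trans (Finset.sum_le_sum fun j _ => ?_)
  split_ifs
  · exact le_rfl
  · simp

set_option maxHeartbeats 1000000 in
/-- The estimate dual to the orthonormal Strichartz inequality, in the form of a bound by a sum. -/
theorem sum_lintegral_mul_le (hn : 2 ≤ n) {x z : ℝ} (hx0 : 0 < x) (hz0 : 0 < z) (hz : z < 1)
    (hxz : n * x < (n - 1) * z) (hxz2 : 2 * z + n * x < n) :
    ∃ ε C : ℝ, 0 < ε ∧ 0 < C ∧ ∀ {ι : Type} [Fintype ι] (lam : ι → ℝ≥0∞)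
      (W : ι → ℝ × Rn n → ℝ≥0∞) (h : ℤ → ι → Lp ℂ 2 (volume : Measure (Rn n)))
      (V : ℝ × Rn n → ℝ≥0∞) (K : ℝ≥0∞) (M : ℝ), (∀ j, lam j ≠ ∞) → (∀ j, Measurable (W j)) →
      Measurable V → (∀ w, V w ≠ ∞) → (∀ w, V w ≠ 0 → |w.1| ≤ M ∧ ‖w.2‖ ≤ M) →
      (∀ k, ∀ c : ι → ℂ, ‖∑ j, c j • h k j‖ ^ 2 ≤ ∑ j, ‖c j‖ ^ 2) →
      (∀ j, ∑' k, ENNReal.ofReal (‖h k j‖ ^ 2) ≤ 1) →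
      (∀ j w (m : ℤ), W j w ≤ K * ∑' k : ℤ, dy (ε * |(k : ℝ) + m|) *
        (dy (-(k * (n - 2 * z - n * x))) * ‖(inner ℂ (dyWave k w) (h k j) : ℂ)‖ₑ ^ 2)) →
      ∑ j, lam j * ∫⁻ w, V w * W j w ≤ K * ENNReal.ofReal C * (∑ j, lam j ^ (1 / z) +
        ∫⁻ t, (∫⁻ y, V (t, y) ^ (1 / (1 - x))) ^ ((1 - x) / (1 - z))) := by
  classical
  have hn1 : (2 : ℝ) ≤ n := by exact_mod_cast hn
  have hxz' : x ≤ z := by nlinarith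
  have hx1 : x < 1 := by linarith
  obtain ⟨ε, δ, C1, hε, hδ, hC1, hterm⟩ := dyWave_term_le hn hx0 hz0 hz hxz hxz2
  obtain ⟨C2, hC2, hsum⟩ := tsum_dyadic_le (r := n * (1 - x)) hε hδ
    (one_div_ne_zero hz0.ne') (one_div_ne_zero (sub_pos.2 hz).ne')
  obtain ⟨C3, hC3, hlam⟩ := tsum_dy_le_rpow (one_div_pos.2 hz0)
  obtain ⟨C4, hC4, hlev⟩ := tsum_volume_levels_le (n := n) hx1 hz hxz'
  refine ⟨ε, 4 * (C1 * C2 * (C3 + C4)), hε, by positivity, ?_⟩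
  intro ι _ lam W h V K M hlt hW hV hVt hVM hB hν hWle
  set S : ℤ → Set (ℝ × Rn n) := fun c => {w | dy c < V w} with hSdef
  have hS : ∀ c, MeasurableSet (S c) := fun c => measurableSet_lt measurable_const hV
  have hSM : ∀ c, ∀ w ∈ S c, |w.1| ≤ M ∧ ‖w.2‖ ≤ M := fun c w hw =>
    hVM w (ne_of_gt (lt_of_le_of_lt (zero_le) hw))
  set Θ : ℤ → ℤ → Set ℝ := fun c m => {t | dy (n * m) ≤ volume (Prod.mk t ⁻¹' S c) ∧
    volume (Prod.mk t ⁻¹' S c) < dy (n * (m + 1))} with hΘdef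
  have hDm : ∀ c, Measurable fun t => volume (Prod.mk t ⁻¹' S c) := fun c =>
    measurable_measure_prodMk_left (hS c)
  have hΘ : ∀ c m, MeasurableSet (Θ c m) := fun c m =>
    (measurableSet_le measurable_const (hDm c)).inter
      (measurableSet_lt (hDm c) measurable_const)
  have hΘfin : ∀ c m, volume (Θ c m) ≠ ∞ := by
    intro c m
    refine ne_top_of_le_ne_top (isCompact_Icc (a := -M) (b := M)).measure_lt_top.ne
      (measure_mono fun t ht => ?_)
    have h1 : volume (Prod.mk t ⁻¹' S c) ≠ 0 := (lt_of_lt_of_le (dy_pos _) ht.1).ne'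
    obtain ⟨y, hy⟩ := nonempty_of_measure_ne_zero h1
    exact abs_le.1 (hSM c _ hy).1
  have hsecfin : ∀ c t, volume (Prod.mk t ⁻¹' S c) ≠ ∞ := fun c t =>
    ne_top_of_le_ne_top (measure_closedBall_lt_top (x := (0 : Rn n)) (r := M)).ne
      (measure_mono fun y hy => by simpa using (hSM c _ hy).2)
  set E : ℤ → ℤ → Set (ℝ × Rn n) := fun c m => S c ∩ Prod.fst ⁻¹' Θ c m with hEdef
  have hE : ∀ c m, MeasurableSet (E c m) := fun c m => (hS c).inter (measurable_fst (hΘ c m))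
  have hEsec : ∀ c m t, volume (Prod.mk t ⁻¹' E c m) ≤ dy (n * (m + 1)) := by
    intro c m t
    by_cases ht : t ∈ Θ c m
    · exact (measure_mono (preimage_mono inter_subset_left)).trans ht.2.le
    · have : Prod.mk t ⁻¹' E c m = ∅ := by
        ext y
        simp only [hEdef, mem_preimage, mem_inter_iff, mem_empty_iff_false, iff_false, not_and]
        exact fun _ => ht
      simp [this]
  set h' : ℤ → ℤ → ι → Lp ℂ 2 (volume : Measure (Rn n)) := fun b k j =>
    if dy b < lam j then h k j else 0 with hh'
  set I : ℤ → ι → ℤ → ℤ → ℝ≥0∞ := fun k j c m =>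
    ∫⁻ w in E c m, ‖(inner ℂ (dyWave k w) (h k j) : ℂ)‖ₑ ^ 2 with hI
  have hWE : ∀ j c m, ∫⁻ w in E c m, W j w ≤
      K * ∑' k : ℤ, dy (ε * |(k : ℝ) + m|) * (dy (-(k * (n - 2 * z - n * x))) * I k j c m) := by
    intro j c m
    have hmk : ∀ k : ℤ, Measurable fun w : ℝ × Rn n => dy (ε * |(k : ℝ) + m|) *
        (dy (-(k * (n - 2 * z - n * x))) * ‖(inner ℂ (dyWave k w) (h k j) : ℂ)‖ₑ ^ 2) := fun k =>
      ((measurable_enorm_inner_dyWave k (h k j)).const_mul _).const_mul _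
    refine (lintegral_mono fun w => hWle j w m).trans (le_of_eq ?_)
    rw [lintegral_const_mul _ (Measurable.tsum hmk),
      lintegral_tsum fun k => (hmk k).aemeasurable]
    congr 1
    refine tsum_congr fun k => ?_
    rw [lintegral_const_mul _ ((measurable_enorm_inner_dyWave k (h k j)).const_mul _),
      lintegral_const_mul _ (measurable_enorm_inner_dyWave k (h k j))]
  set N : ℤ → ℤ → ℝ := fun k b => ∑ j, ‖h' b k j‖ ^ 2 with hN
  have hN0 : ∀ k b, 0 ≤ N k b := fun k b => Finset.sum_nonneg fun j _ => by positivity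
  have hpiece : ∀ b c m k : ℤ, dy (b + c) * dy (ε * |(k : ℝ) + m|) *
      (dy (-(k * (n - 2 * z - n * x))) * ∑ j, if dy b < lam j then I k j c m else 0) ≤
      ENNReal.ofReal C1 * (dy (-(ε * |(k : ℝ) + m|)) *
        dy (-(δ * |1 / z * b + 2 * k - 1 / (1 - z) * (c + n * (1 - x) * m)|)) *
        (ENNReal.ofReal (N k b) * dy (1 / z * b) +
          volume (Θ c m) * dy (1 / (1 - z) * (c + n * (1 - x) * m)))) := by
    intro b c m k
    have := hterm b c m k (h' b k) (hE c m) (hΘ c m) (τ := (volume (Θ c m)).toReal)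
      ENNReal.toReal_nonneg (hN0 k b) (by rw [ENNReal.ofReal_toReal (hΘfin c m)])
      (fun w hw => hw.2) (hEsec c m) (contraction_restrict (hB k) _) le_rfl
    rw [ENNReal.ofReal_toReal (hΘfin c m)] at this
    refine le_trans (le_of_eq ?_) this
    congr 2
    refine Finset.sum_congr rfl fun j _ => ?_
    simp only [hh', hI]
    split_ifs <;> simp
  have hA : ∑' (k : ℤ) (b : ℤ), ENNReal.ofReal (N k b) * dy (1 / z * b) ≤
      ENNReal.ofReal C3 * ∑ j, lam j ^ (1 / z) := by
    have h1 : ∀ k b : ℤ, ENNReal.ofReal (N k b) * dy (1 / z * b) =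
        ∑ j, ENNReal.ofReal (‖h k j‖ ^ 2) * (if dy b < lam j then dy (1 / z * b) else 0) := by
      intro k b
      rw [hN, ENNReal.ofReal_sum_of_nonneg fun j _ => by positivity, Finset.sum_mul]
      refine Finset.sum_congr rfl fun j _ => ?_
      simp only [hh']
      split_ifs <;> simp
    simp only [h1]
    calc _ = ∑ j, ∑' (k : ℤ), ENNReal.ofReal (‖h k j‖ ^ 2) *
          ∑' (b : ℤ), (if dy b < lam j then dy (1 / z * b) else 0) := by
          simp only [← ENNReal.tsum_mul_left]
          rw [← Summable.tsum_finsetSum fun j _ => ENNReal.summable]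
          refine tsum_congr fun k => ?_
          rw [← Summable.tsum_finsetSum fun j _ => ENNReal.summable]
      _ ≤ ∑ j, 1 * (ENNReal.ofReal C3 * lam j ^ (1 / z)) := by
          refine Finset.sum_le_sum fun j _ => ?_
          rw [ENNReal.tsum_mul_right]
          exact mul_le_mul' (hν j) (hlam _)
      _ = _ := by simp only [one_mul, Finset.mul_sum]
  have hBsum : ∑' (c : ℤ) (m : ℤ), volume (Θ c m) *
      dy (1 / (1 - z) * (c + n * (1 - x) * m)) ≤ _ := hlev hV
  set Y := ∫⁻ t, (∫⁻ y, V (t, y) ^ (1 / (1 - x))) ^ ((1 - x) / (1 - z)) with hY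
  calc ∑ j, lam j * ∫⁻ w, V w * W j w
      ≤ ∑ j, (2 * ∑' b : ℤ, if dy b < lam j then dy b else 0) * (2 * ∑' c : ℤ, dy c *
          ∑' m : ℤ, K * ∑' k : ℤ, dy (ε * |(k : ℝ) + m|) *
            (dy (-(k * (n - 2 * z - n * x))) * I k j c m)) := by
        refine Finset.sum_le_sum fun j _ => mul_le_mul' (le_two_mul_tsum_dy (hlt j)) ?_
        refine (lintegral_mul_le_tsum_levels hV (hW j) hVt).trans (mul_le_mul' le_rfl ?_)
        refine ENNReal.tsum_le_tsum fun c => mul_le_mul' le_rfl ?_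
        refine (lintegral_le_tsum_sections (by omega) (hS c) (hsecfin c) _).trans ?_
        exact ENNReal.tsum_le_tsum fun m => hWE j c m
    _ = K * 4 * ∑' (b : ℤ) (c : ℤ) (m : ℤ) (k : ℤ), dy (b + c) * dy (ε * |(k : ℝ) + m|) *
          (dy (-(k * (n - 2 * z - n * x))) * ∑ j, if dy b < lam j then I k j c m else 0) := by
        have hj : ∀ j, (2 * ∑' b : ℤ, if dy b < lam j then dy b else 0) * (2 * ∑' c : ℤ, dy c *
            ∑' m : ℤ, K * ∑' k : ℤ, dy (ε * |(k : ℝ) + m|) *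
              (dy (-(k * (n - 2 * z - n * x))) * I k j c m)) =
            ∑' (b : ℤ) (c : ℤ) (m : ℤ) (k : ℤ), K * 4 * (dy (b + c) *
              dy (ε * |(k : ℝ) + m|) * (dy (-(k * (n - 2 * z - n * x))) *
                if dy b < lam j then I k j c m else 0)) := by
          intro j
          rw [← ENNReal.tsum_mul_left, ← ENNReal.tsum_mul_right]
          refine tsum_congr fun b => ?_
          simp only [← ENNReal.tsum_mul_left]
          refine tsum_congr fun c => tsum_congr fun m => tsum_congr fun k => ?_
          split_ifs
          · rw [dy_add]; ring
          · simp
        rw [Finset.sum_congr rfl fun j _ => hj j,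
          ← Summable.tsum_finsetSum fun j _ => ENNReal.summable]
        simp only [Finset.mul_sum, ← ENNReal.tsum_mul_left]
        refine tsum_congr fun b => ?_
        rw [← Summable.tsum_finsetSum fun j _ => ENNReal.summable]
        refine tsum_congr fun c => ?_
        rw [← Summable.tsum_finsetSum fun j _ => ENNReal.summable]
        refine tsum_congr fun m => ?_
        rw [← Summable.tsum_finsetSum fun j _ => ENNReal.summable]
    _ ≤ K * 4 * ∑' (b : ℤ) (c : ℤ) (m : ℤ) (k : ℤ), ENNReal.ofReal C1 *
        (dy (-(ε * |(k : ℝ) + m|)) *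
        dy (-(δ * |1 / z * b + 2 * k - 1 / (1 - z) * (c + n * (1 - x) * m)|)) *
        (ENNReal.ofReal (N k b) * dy (1 / z * b) +
          volume (Θ c m) * dy (1 / (1 - z) * (c + n * (1 - x) * m)))) := by
        refine mul_le_mul' le_rfl ?_
        exact ENNReal.tsum_le_tsum fun b => ENNReal.tsum_le_tsum fun c =>
          ENNReal.tsum_le_tsum fun m => ENNReal.tsum_le_tsum fun k => hpiece b c m k
    _ ≤ K * 4 * (ENNReal.ofReal C1 * (ENNReal.ofReal C2 *
          (ENNReal.ofReal C3 * ∑ j, lam j ^ (1 / z) + ENNReal.ofReal C4 * Y))) := by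
        simp only [ENNReal.tsum_mul_left]
        refine mul_le_mul' le_rfl (mul_le_mul' le_rfl ?_)
        refine (hsum (fun k b => ENNReal.ofReal (N k b) * dy (1 / z * b))
          (fun c m => volume (Θ c m) * dy (1 / (1 - z) * (c + n * (1 - x) * m)))).trans ?_
        exact mul_le_mul' le_rfl (add_le_add hA hBsum)
    _ ≤ K * 4 * (ENNReal.ofReal C1 * (ENNReal.ofReal C2 *
          (ENNReal.ofReal (C3 + C4) * (∑ j, lam j ^ (1 / z) + Y)))) := by
        rw [mul_add (ENNReal.ofReal (C3 + C4))]
        gcongr <;> linarith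
    _ = _ := by
        rw [ENNReal.ofReal_mul (by norm_num), ENNReal.ofReal_mul (by positivity),
          ENNReal.ofReal_mul hC1.le]
        norm_num
        ring

end linearized_bound

section frequency_shells

variable {n : ℕ}

theorem sq_tsum_mul_le {ι : Type*} [Countable ι] (a b : ι → ℝ≥0∞) :
    (∑' i, a i * b i) ^ 2 ≤ (∑' i, a i ^ 2) * ∑' i, b i ^ 2 := by
  let _ : MeasurableSpace ι := ⊤
  have h := ENNReal.lintegral_mul_le_Lp_mul_Lq (μ := Measure.count) Real.HolderConjugate.two_two
    (f := a) (g := b) (measurable_of_countable _).aemeasurable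
    (measurable_of_countable _).aemeasurable
  simp only [lintegral_count, Pi.mul_apply] at h
  calc _ ≤ _ := pow_le_pow_left' h 2
    _ = _ := by
      rw [mul_pow, ← ENNReal.rpow_natCast, ← ENNReal.rpow_natCast, ← ENNReal.rpow_mul,
        ← ENNReal.rpow_mul]
      norm_num

/-- The dyadic frequency shell `2 ^ k ≤ |ξ| < 2 ^ (k + 1)`. -/
def shell (n : ℕ) (k : ℤ) : Set (Rn n) := {ξ | ‖ξ‖ ∈ Ico ((2 : ℝ) ^ k) (2 ^ (k + 1))}

theorem measurableSet_shell (k : ℤ) : MeasurableSet (shell n k) :=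
  measurable_norm measurableSet_Ico

theorem pairwise_disjoint_shell : Pairwise (Function.onFun Disjoint (shell n)) := by
  have h : Monotone fun k : ℤ => (2 : ℝ) ^ k := fun a b hab => zpow_le_zpow_right₀ one_le_two hab
  intro i j hij
  exact (h.pairwise_disjoint_on_Ico_succ hij).preimage _

theorem iUnion_shell : ⋃ k, shell n k = {0}ᶜ := by
  ext ξ
  simp only [mem_iUnion, mem_compl_iff, mem_singleton_iff]
  constructor
  · rintro ⟨k, hk⟩ rfl
    have : (2 : ℝ) ^ k ≤ 0 := by simpa using hk.1
    exact absurd this (not_le.2 (by positivity))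
  · intro h
    exact exists_mem_Ico_zpow (norm_pos_iff.2 h) one_lt_two

/-- The normalized multiplier on the shell of frequency `2 ^ k` turning `Ḣ^s` data into `L²` data
and undoing the Gaussian damping. -/
def shellMult (s : ℝ) (k : ℤ) (ξ : Rn n) : ℝ :=
  (shell n k).indicator (fun ξ => rexp (-2) * rexp ((2 : ℝ) ^ (-2 * (k : ℝ)) / 2 * ‖ξ‖ ^ 2) *
    (2 ^ (k * s) * ‖ξ‖ ^ (-s))) ξ

theorem measurable_shellMult (s : ℝ) (k : ℤ) : Measurable (shellMult (n := n) s k) := by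
  refine Measurable.indicator ?_ (measurableSet_shell k)
  fun_prop

theorem shellMult_nonneg (s : ℝ) (k : ℤ) (ξ : Rn n) : 0 ≤ shellMult s k ξ :=
  indicator_nonneg (fun _ _ => by positivity) _

theorem shellMult_le_indicator {s : ℝ} (hs : 0 ≤ s) (k : ℤ) (ξ : Rn n) :
    shellMult s k ξ ≤ (shell n k).indicator 1 ξ := by
  refine indicator_le_indicator' fun hξ => ?_
  have h2 : (0 : ℝ) < 2 ^ k := by positivity
  have hpos : 0 < ‖ξ‖ := h2.trans_le hξ.1
  have hlt : ‖ξ‖ / 2 ^ k ≤ 2 := by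
    rw [div_le_iff₀ h2]
    have := hξ.2.le
    rwa [zpow_add_one₀ two_ne_zero, mul_comm] at this
  have hge : 1 ≤ ‖ξ‖ / 2 ^ k := by rw [le_div_iff₀ h2, one_mul]; exact hξ.1
  have e1 : rexp (-2) * rexp ((2 : ℝ) ^ (-2 * (k : ℝ)) / 2 * ‖ξ‖ ^ 2) ≤ 1 := by
    rw [← Real.exp_add, Real.exp_le_one_iff]
    have : (2 : ℝ) ^ (-2 * (k : ℝ)) / 2 * ‖ξ‖ ^ 2 = (‖ξ‖ / 2 ^ k) ^ 2 / 2 := by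
      rw [show -2 * (k : ℝ) = ((-(k * 2) : ℤ) : ℝ) by push_cast; ring, Real.rpow_intCast,
        zpow_neg, zpow_mul]
      field_simp
    rw [this]
    nlinarith
  have e2 : (2 : ℝ) ^ (k * s) * ‖ξ‖ ^ (-s) ≤ 1 := by
    rw [Real.rpow_mul zero_le_two, Real.rpow_intCast, Real.rpow_neg hpos.le, ← div_eq_mul_inv,
      div_le_one (by positivity)]
    exact Real.rpow_le_rpow h2.le hξ.1 hs
  calc _ ≤ (1 : ℝ) * 1 := mul_le_mul e1 e2 (by positivity) zero_le_one
    _ = _ := by simp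

theorem shellMult_le_one {s : ℝ} (hs : 0 ≤ s) (k : ℤ) (ξ : Rn n) : shellMult s k ξ ≤ 1 :=
  (shellMult_le_indicator hs k ξ).trans (indicator_le_self' (by simp) _)

theorem memLp_shellMult_mul {s : ℝ} (hs : 0 ≤ s) (k : ℤ) (H : Lp ℂ 2 (volume : Measure (Rn n))) :
    MemLp (fun ξ => (shellMult s k ξ : ℂ) * H ξ) 2 volume := by
  refine (Lp.memLp H).mono
    ((Complex.measurable_ofReal.comp (measurable_shellMult s k)).aestronglyMeasurable.mul
      (Lp.aestronglyMeasurable H)) (ae_of_all _ fun ξ => ?_)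
  rw [norm_mul, Complex.norm_real, Real.norm_of_nonneg (shellMult_nonneg s k ξ)]
  exact mul_le_of_le_one_left (norm_nonneg _) (shellMult_le_one hs k ξ)

/-- Multiplication by `shellMult s k` on `L²`. -/
def shellOp {s : ℝ} (hs : 0 ≤ s) (k : ℤ) :
    Lp ℂ 2 (volume : Measure (Rn n)) →ₗ[ℂ] Lp ℂ 2 (volume : Measure (Rn n)) where
  toFun H := (memLp_shellMult_mul hs k H).toLp _
  map_add' H G := by
    rw [← MemLp.toLp_add (memLp_shellMult_mul hs k H) (memLp_shellMult_mul hs k G)]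
    refine MemLp.toLp_congr _ _ ?_
    filter_upwards [Lp.coeFn_add H G] with ξ h
    rw [h]
    simp [mul_add]
  map_smul' c H := by
    rw [RingHom.id_apply, ← MemLp.toLp_const_smul c (memLp_shellMult_mul hs k H)]
    refine MemLp.toLp_congr (memLp_shellMult_mul hs k _)
      ((memLp_shellMult_mul hs k H).const_smul c) ?_
    filter_upwards [Lp.coeFn_smul c H] with ξ h
    rw [h]
    simp [mul_left_comm]

theorem shellOp_coe {s : ℝ} (hs : 0 ≤ s) (k : ℤ) (H : Lp ℂ 2 (volume : Measure (Rn n))) :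
    shellOp hs k H =ᵐ[volume] fun ξ => (shellMult s k ξ : ℂ) * H ξ :=
  MemLp.coeFn_toLp (memLp_shellMult_mul hs k H)

theorem norm_shellOp_le {s : ℝ} (hs : 0 ≤ s) (k : ℤ) (H : Lp ℂ 2 (volume : Measure (Rn n))) :
    ‖shellOp hs k H‖ ≤ ‖H‖ := by
  refine Lp.norm_le_norm_of_ae_le ?_
  filter_upwards [shellOp_coe hs k H] with ξ h
  rw [h, norm_mul, Complex.norm_real, Real.norm_of_nonneg (shellMult_nonneg s k ξ)]
  exact mul_le_of_le_one_left (norm_nonneg _) (shellMult_le_one hs k ξ)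

theorem ofReal_norm_sq_eq_lintegral (H : Lp ℂ 2 (volume : Measure (Rn n))) :
    ENNReal.ofReal (‖H‖ ^ 2) = ∫⁻ ξ, ‖H ξ‖ₑ ^ 2 := by
  rw [ENNReal.ofReal_pow (norm_nonneg _), ofReal_norm, Lp.enorm_def,
    eLpNorm_eq_lintegral_rpow_enorm_toReal two_ne_zero ENNReal.ofNat_ne_top,
    ← ENNReal.rpow_natCast, ← ENNReal.rpow_mul]
  simp

theorem tsum_norm_shellOp_sq_le {s : ℝ} (hs : 0 ≤ s) (H : Lp ℂ 2 (volume : Measure (Rn n))) :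
    ∑' k, ENNReal.ofReal (‖shellOp hs k H‖ ^ 2) ≤ ENNReal.ofReal (‖H‖ ^ 2) := by
  calc _ ≤ ∑' k, ∫⁻ ξ in shell n k, ‖H ξ‖ₑ ^ 2 := by
        refine ENNReal.tsum_le_tsum fun k => ?_
        rw [ofReal_norm_sq_eq_lintegral, ← lintegral_indicator (measurableSet_shell k)]
        refine lintegral_mono_ae ?_
        filter_upwards [shellOp_coe hs k H] with ξ h
        rw [h, enorm_mul, mul_pow]
        have h1 := shellMult_le_indicator hs k ξ
        have h0 := shellMult_nonneg s k ξ
        by_cases hξ : ξ ∈ shell n k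
        · simp only [hξ, indicator_of_mem, Pi.one_apply] at h1 ⊢
          refine mul_le_of_le_one_left' (pow_le_one' ?_ 2)
          rw [← ofReal_norm, Complex.norm_real, Real.norm_of_nonneg h0]
          exact ENNReal.ofReal_le_one.2 h1
        · simp only [hξ, not_false_eq_true, indicator_of_notMem] at h1 ⊢
          simp [le_antisymm h1 h0]
    _ = ∫⁻ ξ in ⋃ k, shell n k, ‖H ξ‖ₑ ^ 2 :=
        (lintegral_iUnion measurableSet_shell pairwise_disjoint_shell _).symm
    _ ≤ _ := by
        rw [ofReal_norm_sq_eq_lintegral]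
        exact setLIntegral_le_lintegral _ _

/-- The oscillating factor `e^{i(x·ξ - t|ξ|²)}`. -/
def planeWave (w : ℝ × Rn n) (ξ : Rn n) : ℂ :=
  Complex.exp (Complex.I * (dotC w.2 ξ - (w.1 : ℂ) * ((‖ξ‖ : ℝ) : ℂ) ^ 2))

theorem norm_planeWave (w : ℝ × Rn n) (ξ : Rn n) : ‖planeWave w ξ‖ = 1 := by
  have : Complex.I * (dotC w.2 ξ - (w.1 : ℂ) * ((‖ξ‖ : ℝ) : ℂ) ^ 2) =
      ((∑ i, w.2 i * ξ i - w.1 * ‖ξ‖ ^ 2 : ℝ) : ℂ) * Complex.I := by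
    rw [dotC]; push_cast; ring
  rw [planeWave, this, Complex.norm_exp_ofReal_mul_I]

theorem continuous_planeWave : Continuous fun z : (ℝ × Rn n) × Rn n => planeWave z.1 z.2 := by
  unfold planeWave dotC
  fun_prop

theorem inner_dyWave_shellOp {s : ℝ} (hs : 0 ≤ s) (k : ℤ) (w : ℝ × Rn n) {c : ℝ} {g : Rn n → ℂ}
    {H : Lp ℂ 2 (volume : Measure (Rn n))}
    (hH : H =ᵐ[volume] fun ξ => ((c * ‖ξ‖ ^ s : ℝ) : ℂ) * g ξ) :
    inner ℂ (dyWave k w) (shellOp hs k H) = ((rexp (-2) * 2 ^ (k * s) * c : ℝ) : ℂ) *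
      ∫ ξ in shell n k, planeWave w ξ * g ξ := by
  rw [dyWave, inner_waveVec_left, ← integral_const_mul,
    ← integral_indicator (measurableSet_shell k)]
  refine integral_congr_ae ?_
  filter_upwards [shellOp_coe hs k H, hH] with ξ h1 h2
  rw [h1, h2, conj_dampedWave]
  by_cases hξ : ξ ∈ shell n k
  · have hpos : 0 < ‖ξ‖ := lt_of_lt_of_le (by positivity) hξ.1
    simp only [shellMult, hξ, indicator_of_mem]
    have e1 : rexp (-((2 : ℝ) ^ (-2 * (k : ℝ)) / 2 * ‖ξ‖ ^ 2)) * ((rexp (-2) *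
        rexp ((2 : ℝ) ^ (-2 * (k : ℝ)) / 2 * ‖ξ‖ ^ 2) * (2 ^ (k * s) * ‖ξ‖ ^ (-s))) *
        (c * ‖ξ‖ ^ s)) = rexp (-2) * 2 ^ (k * s) * c := by
      rw [Real.exp_neg, Real.rpow_neg hpos.le]
      have : ‖ξ‖ ^ s ≠ 0 := (by positivity)
      field_simp
    rw [← e1, planeWave]
    push_cast
    ring
  · simp [shellMult, hξ]

end frequency_shells

section orthonormal_data

variable {n : ℕ}

theorem enorm_integral_le_tsum_shell (hn : 0 < n) {F : Rn n → ℂ} (hF : Integrable F) :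
    ‖∫ ξ, F ξ‖ₑ ≤ ∑' k : ℤ, ‖∫ ξ in shell n k, F ξ‖ₑ := by
  have : Nonempty (Fin n) := ⟨⟨0, hn⟩⟩
  have h := hasSum_integral_iUnion (μ := volume) (measurableSet_shell (n := n))
    pairwise_disjoint_shell (f := F) hF.integrableOn
  rw [iUnion_shell, restrict_compl_singleton] at h
  rw [← h.tsum_eq]
  exact enorm_tsum_le_tsum_enorm

theorem enorm_integral_planeWave_sq_le (hn : 0 < n) {s : ℝ} (hs : 0 ≤ s) {c : ℝ} (hc : 0 < c)
    {ε : ℝ} (hε : 0 < ε) :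
    ∃ C : ℝ, 0 < C ∧ ∀ (g : Rn n → ℂ) (H : Lp ℂ 2 (volume : Measure (Rn n))), Integrable g →
      (H =ᵐ[volume] fun ξ => ((c * ‖ξ‖ ^ s : ℝ) : ℂ) * g ξ) → ∀ (w : ℝ × Rn n) (m : ℤ),
      ‖∫ ξ, planeWave w ξ * g ξ‖ₑ ^ 2 ≤ ENNReal.ofReal C * ∑' k : ℤ, dy (ε * |(k : ℝ) + m|) *
        (dy (-(k * (2 * s))) * ‖(inner ℂ (dyWave k w) (shellOp hs k H) : ℂ)‖ₑ ^ 2) := by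
  obtain ⟨C, hC, hsum⟩ := tsum_dy_neg_abs_le hε (one_ne_zero (α := ℝ))
  refine ⟨C * ((rexp (-2) * c)⁻¹) ^ 2, by positivity, fun g H hg hH w m => ?_⟩
  have hF : Integrable fun ξ => planeWave w ξ * g ξ := by
    refine hg.bdd_mul (c := 1) ?_ (ae_of_all _ fun ξ => (norm_planeWave w ξ).le)
    exact (continuous_planeWave.comp
      (by fun_prop : Continuous fun ξ : Rn n => (w, ξ))).aestronglyMeasurable
  have hpiece : ∀ k : ℤ, ‖∫ ξ in shell n k, planeWave w ξ * g ξ‖ₑ =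
      ENNReal.ofReal ((rexp (-2) * c)⁻¹) *
        (dy (-(k * s)) * ‖(inner ℂ (dyWave k w) (shellOp hs k H) : ℂ)‖ₑ) := by
    intro k
    rw [inner_dyWave_shellOp hs k w hH, enorm_mul, ← ofReal_norm (((_ : ℝ) : ℂ)), Complex.norm_real,
      Real.norm_of_nonneg (by positivity), ← mul_assoc, ← mul_assoc, dy,
      ← ENNReal.ofReal_mul (by positivity), ← ENNReal.ofReal_mul (by positivity)]
    rw [Real.rpow_neg zero_le_two]
    rw [show (rexp (-2) * c)⁻¹ * (2 ^ (k * s))⁻¹ * (rexp (-2) * 2 ^ (k * s) * c) = 1 by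
      have : (2 : ℝ) ^ (k * s) ≠ 0 := by positivity
      field_simp]
    simp
  calc _ ≤ (∑' k : ℤ, dy (-(ε * |(k : ℝ) + m|) / 2) * (dy (ε * |(k : ℝ) + m| / 2) *
        ‖∫ ξ in shell n k, planeWave w ξ * g ξ‖ₑ)) ^ 2 := by
        refine pow_le_pow_left' ((enorm_integral_le_tsum_shell hn hF).trans (le_of_eq ?_)) 2
        refine tsum_congr fun k => ?_
        rw [← mul_assoc, ← dy_add]
        ring_nf
        simp [dy_zero]
    _ ≤ _ := sq_tsum_mul_le _ _
    _ ≤ ENNReal.ofReal C * ∑' k : ℤ, ENNReal.ofReal (((rexp (-2) * c)⁻¹) ^ 2) *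
          (dy (ε * |(k : ℝ) + m|) *
        (dy (-(k * (2 * s))) * ‖(inner ℂ (dyWave k w) (shellOp hs k H) : ℂ)‖ₑ ^ 2)) := by
        refine mul_le_mul' (le_trans (le_of_eq (tsum_congr fun k => ?_)) (hsum (-m)))
          (le_of_eq (tsum_congr fun k => ?_))
        · rw [sq, ← dy_add, ← abs_neg (-(m : ℝ) - _)]
          ring_nf
        · rw [hpiece, mul_pow, mul_pow, mul_pow, ENNReal.ofReal_pow (by positivity), sq (dy _),
            sq (dy _), ← dy_add, ← dy_add]
          ring_nf
    _ = _ := by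
        rw [ENNReal.tsum_mul_left, ENNReal.ofReal_mul hC.le]
        ring

theorem measurable_enorm_integral_planeWave {g : Rn n → ℂ} (hg : Integrable g) :
    Measurable fun w : ℝ × Rn n => ‖∫ ξ, planeWave w ξ * g ξ‖ₑ := by
  refine (continuous_of_dominated (bound := fun ξ => ‖g ξ‖) ?_ ?_ hg.norm ?_).enorm.measurable
  · intro w
    exact (continuous_planeWave.comp
      (by fun_prop : Continuous fun ξ : Rn n => (w, ξ))).aestronglyMeasurable.mul
      hg.aestronglyMeasurable
  · intro w
    refine ae_of_all _ fun ξ => ?_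
    rw [norm_mul, norm_planeWave, one_mul]
  · refine ae_of_all _ fun ξ => ?_
    exact (continuous_planeWave.comp
      (by fun_prop : Continuous fun w : ℝ × Rn n => (w, ξ))).mul continuous_const

theorem schrodinger_eq (f : Rn n → ℂ) (w : ℝ × Rn n) :
    schrodinger f w.1 w.2 =
      (((2 * π : ℝ) ^ (-(n : ℝ)) : ℝ) : ℂ) * ∫ ξ, planeWave w ξ * FT f ξ := by
  simp only [schrodinger, prop, planeWave, one_mul, Complex.real_smul]

theorem schrodinger_eq_zero {f : Rn n → ℂ} (hf : ¬ Integrable (FT f)) (w : ℝ × Rn n) :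
    schrodinger f w.1 w.2 = 0 := by
  rw [schrodinger_eq, integral_undef, mul_zero]
  refine fun h => hf ?_
  have h2 := h.bdd_mul (c := 1) (f := fun ξ => conj (planeWave w ξ)) ?_
    (ae_of_all _ fun ξ => by rw [RCLike.norm_conj, norm_planeWave])
  · refine h2.congr (ae_of_all _ fun ξ => ?_)
    simp only
    rw [← mul_assoc, ← Complex.normSq_eq_conj_mul_self, Complex.normSq_eq_norm_sq, norm_planeWave]
    simp
  · exact (Complex.continuous_conj.comp (continuous_planeWave.comp
      (by fun_prop : Continuous fun ξ : Rn n => (w, ξ)))).aestronglyMeasurable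

theorem norm_sum_smul_sq_le_of_inner {ι H : Type*} [Fintype ι] [DecidableEq ι]
    [NormedAddCommGroup H] [InnerProductSpace ℂ H] {v : ι → H} {P : ι → Prop} [DecidablePred P]
    (hv : ∀ j k, inner ℂ (v j) (v k) = if j = k ∧ P j then (1 : ℂ) else 0) (c : ι → ℂ) :
    ‖∑ j, c j • v j‖ ^ 2 ≤ ∑ j, ‖c j‖ ^ 2 := by
  have h : ((‖∑ j, c j • v j‖ ^ 2 : ℝ) : ℂ) = ((∑ j, if P j then ‖c j‖ ^ 2 else 0 : ℝ) : ℂ) := by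
    push_cast
    have := inner_self_eq_norm_sq_to_K (𝕜 := ℂ) (∑ j, c j • v j)
    simp only [Complex.coe_algebraMap] at this
    rw [← this, sum_inner]
    simp only [inner_sum, inner_smul_left, inner_smul_right, hv]
    refine Finset.sum_congr rfl fun j _ => ?_
    rw [Finset.sum_eq_single j (fun k _ hk => by simp [hk.symm]) (by simp)]
    by_cases hP : P j
    · simp [hP, Complex.mul_conj, Complex.normSq_eq_norm_sq]
    · simp [hP]
  rw [Complex.ofReal_inj.1 h]
  refine Finset.sum_le_sum fun j _ => ?_
  split_ifs
  · exact le_rfl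
  · positivity

theorem OrthonormalHs.exists_Lp {s : ℝ} {f : ℕ → Rn n → ℂ} (hf : OrthonormalHs s f) :
    ∃ H : ℕ → Lp ℂ 2 (volume : Measure (Rn n)),
      (∀ j, Integrable (FT (f j)) → H j =ᵐ[volume]
        fun ξ => (((2 * π) ^ (-(n : ℝ) / 2) * ‖ξ‖ ^ s : ℝ) : ℂ) * FT (f j) ξ) ∧
      (∀ j, ‖H j‖ ≤ 1) ∧
      ∀ (N : ℕ) (c : Fin N → ℂ), ‖∑ j, c j • H j‖ ^ 2 ≤ ∑ j, ‖c j‖ ^ 2 := by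
  classical
  set κ : ℝ := (2 * π) ^ (-(n : ℝ) / 2) with hκ
  have hκpos : 0 < κ := by positivity
  have hκ2 : κ * κ = (2 * π) ^ (-(n : ℝ)) := by
    rw [hκ, ← Real.rpow_add (by positivity)]; ring_nf
  have hmem : ∀ j, Integrable (FT (f j)) →
      MemLp (fun ξ => ((κ * ‖ξ‖ ^ s : ℝ) : ℂ) * FT (f j) ξ) 2 volume := by
    intro j hj
    have hm : AEStronglyMeasurable (fun ξ => ((κ * ‖ξ‖ ^ s : ℝ) : ℂ) * FT (f j) ξ) volume := by
      refine AEStronglyMeasurable.mul ?_ hj.aestronglyMeasurable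
      exact (by fun_prop : Measurable fun ξ : Rn n => ((κ * ‖ξ‖ ^ s : ℝ) : ℂ)).aestronglyMeasurable
    rw [memLp_two_iff_integrable_sq_norm hm]
    have h1 := hf j j
    rw [if_pos rfl] at h1
    have h2 : Integrable (fun ξ : Rn n => ((‖ξ‖ ^ (2 * s) : ℝ) : ℂ) *
        (FT (f j) ξ * (starRingEnd ℂ) (FT (f j) ξ))) := by
      by_contra h
      rw [integral_undef h, smul_zero] at h1
      exact zero_ne_one h1
    refine (h2.norm.const_mul (κ * κ)).congr (ae_of_all _ fun ξ => ?_)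
    simp only [norm_mul, Complex.norm_real, RCLike.norm_conj]
    rw [mul_comm 2 s, Real.rpow_mul (norm_nonneg _), Real.rpow_ofNat, norm_pow,
      Real.norm_of_nonneg hκpos.le]
    ring
  let H : ℕ → Lp ℂ 2 (volume : Measure (Rn n)) := fun j =>
    if hj : Integrable (FT (f j)) then (hmem j hj).toLp _ else 0
  have hH : ∀ j, Integrable (FT (f j)) → H j =ᵐ[volume]
      fun ξ => ((κ * ‖ξ‖ ^ s : ℝ) : ℂ) * FT (f j) ξ := by
    intro j hj
    simp only [H, dif_pos hj]
    exact MemLp.coeFn_toLp _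
  have hH0 : ∀ j, ¬ Integrable (FT (f j)) → H j = 0 := fun j hj => dif_neg hj
  have hin : ∀ j k, inner ℂ (H j) (H k) = if j = k ∧ Integrable (FT (f j)) then (1 : ℂ) else 0 := by
    intro j k
    by_cases hj : Integrable (FT (f j))
    swap
    · rw [hH0 j hj, inner_zero_left, if_neg fun h => hj h.2]
    by_cases hk : Integrable (FT (f k))
    swap
    · rw [hH0 k hk, inner_zero_right, if_neg]
      rintro ⟨rfl, -⟩
      exact hk hj
    have h1 := hf k j
    simp only [hj, and_true]
    rw [L2.inner_def]
    calc _ = ∫ ξ, ((κ * κ : ℝ) : ℂ) * (((‖ξ‖ ^ (2 * s) : ℝ) : ℂ) *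
          (FT (f k) ξ * (starRingEnd ℂ) (FT (f j) ξ))) := by
          refine integral_congr_ae ?_
          filter_upwards [hH j hj, hH k hk] with ξ e1 e2
          rw [e1, e2, RCLike.inner_apply, map_mul, Complex.conj_ofReal, mul_comm 2 s,
            Real.rpow_mul (norm_nonneg _), Real.rpow_ofNat]
          push_cast
          ring
      _ = _ := by
          rw [integral_const_mul, hκ2, ← Complex.real_smul, h1]
          simp only [eq_comm]
  refine ⟨H, hH, fun j => ?_, fun N c => ?_⟩
  · have h := inner_self_eq_norm_sq_to_K (𝕜 := ℂ) (H j)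
    rw [hin] at h
    by_cases hj : Integrable (FT (f j))
    · simp only [hj, and_self, if_true, Complex.coe_algebraMap] at h
      have h2 : ‖H j‖ ^ 2 = 1 := by exact_mod_cast h.symm
      nlinarith [norm_nonneg (H j)]
    · rw [hH0 j hj]; simp
  · exact norm_sum_smul_sq_le_of_inner (v := fun j : Fin N => H j)
      (P := fun j => Integrable (FT (f j))) (fun j k => by simp [hin, Fin.ext_iff]) c

end orthonormal_data

section duality

variable {n : ℕ}

theorem lintegral_lintegral_rpow_le_of_tendsto {a b : ℝ} (ha : 0 < a) (hb : 0 < b)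
    {ρ : ℕ → ℝ × Rn n → ℝ≥0∞} {σ : ℝ × Rn n → ℝ≥0∞} (hρ : ∀ N, Measurable (ρ N))
    (hmono : ∀ w, Monotone fun N => ρ N w)
    (hlim : ∀ w, Filter.Tendsto (fun N => ρ N w) Filter.atTop (nhds (σ w))) {B : ℝ≥0∞}
    (hB : ∀ N, ∫⁻ t, (∫⁻ y, ρ N (t, y) ^ a) ^ b ≤ B) :
    ∫⁻ t, (∫⁻ y, σ (t, y) ^ a) ^ b ≤ B := by
  have hmeas : ∀ N, Measurable fun t => ∫⁻ y, ρ N (t, y) ^ a := fun N =>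
    Measurable.lintegral_prod_right' (f := fun w => ρ N w ^ a) ((hρ N).pow_const a)
  have h1 : ∀ t, Filter.Tendsto (fun N => ∫⁻ y, ρ N (t, y) ^ a) Filter.atTop
      (nhds (∫⁻ y, σ (t, y) ^ a)) := by
    intro t
    refine lintegral_tendsto_of_tendsto_of_monotone
      (fun N => (((hρ N).pow_const a).comp measurable_prodMk_left).aemeasurable)
      (ae_of_all _ fun y => ?_) (ae_of_all _ fun y => ?_)
    · exact fun N N' h => ENNReal.rpow_le_rpow (hmono (t, y) h) ha.le
    · exact (ENNReal.continuous_rpow_const.tendsto _).comp (hlim (t, y))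
  have h2 := lintegral_tendsto_of_tendsto_of_monotone (μ := (volume : Measure ℝ))
      (f := fun N t => (∫⁻ y, ρ N (t, y) ^ a) ^ b) (F := fun t => (∫⁻ y, σ (t, y) ^ a) ^ b)
      (fun N => ((hmeas N).pow_const b).aemeasurable)
      (ae_of_all _ fun t N N' h => ENNReal.rpow_le_rpow
        (lintegral_mono fun y => ENNReal.rpow_le_rpow (hmono (t, y) h) ha.le) hb.le)
      (ae_of_all _ fun t => (ENNReal.continuous_rpow_const.tendsto _).comp (h1 t))
  exact le_of_tendsto' h2 hB

/-- A bounded, compactly supported weight is its own extremizer in the mixed-norm duality. -/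
theorem exists_dual_weight {x z : ℝ} (hx0 : 0 < x) (hx1 : x < 1) (hz0 : 0 < z) (hz1 : z < 1)
    {σ : ℝ × Rn n → ℝ≥0∞} (hσ : Measurable σ) {M : ℝ} (hσM : ∀ w, σ w ≤ ENNReal.ofReal M)
    (hsupp : ∀ w, σ w ≠ 0 → |w.1| ≤ M ∧ ‖w.2‖ ≤ M) :
    ∃ V : ℝ × Rn n → ℝ≥0∞, Measurable V ∧ (∀ w, V w ≠ ∞) ∧
      (∀ w, V w ≠ 0 → |w.1| ≤ M ∧ ‖w.2‖ ≤ M) ∧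
      ∫⁻ w, V w * σ w = ∫⁻ t, (∫⁻ y, σ (t, y) ^ (1 / x)) ^ (x / z) ∧
      ∫⁻ t, (∫⁻ y, V (t, y) ^ (1 / (1 - x))) ^ ((1 - x) / (1 - z)) =
        ∫⁻ t, (∫⁻ y, σ (t, y) ^ (1 / x)) ^ (x / z) ∧
      ∫⁻ t, (∫⁻ y, σ (t, y) ^ (1 / x)) ^ (x / z) ≠ ∞ := by
  have hx1' : 0 < 1 - x := by linarith
  have hz1' : 0 < 1 - z := by linarith
  have hp : 0 < 1 / x - 1 := by rw [sub_pos, lt_div_iff₀ hx0]; linarith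
  set I : ℝ → ℝ≥0∞ := fun t => ∫⁻ y, σ (t, y) ^ (1 / x) with hI
  have hIm : Measurable I :=
    Measurable.lintegral_prod_right' (f := fun w => σ w ^ (1 / x)) (hσ.pow_const _)
  set B : ℝ≥0∞ := ENNReal.ofReal M ^ (1 / x) * volume (Metric.closedBall (0 : Rn n) M) with hB
  have hBtop : B ≠ ∞ := ENNReal.mul_ne_top
    (ENNReal.rpow_ne_top_of_nonneg (by positivity) ENNReal.ofReal_ne_top)
    measure_closedBall_lt_top.ne
  have hσ0 : ∀ w, σ w = 0 ∨ (|w.1| ≤ M ∧ ‖w.2‖ ≤ M) := fun w => or_iff_not_imp_left.2 (hsupp w)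
  have hIB : ∀ t, I t ≤ (Icc (-M) M).indicator (fun _ => B) t := by
    intro t
    by_cases ht : t ∈ Icc (-M) M
    · rw [indicator_of_mem ht, hB, ← setLIntegral_const, ← lintegral_indicator
        measurableSet_closedBall]
      refine lintegral_mono fun y => ?_
      rcases hσ0 (t, y) with h | h
      · simp only [h]
        rw [ENNReal.zero_rpow_of_pos (by positivity)]
        exact zero_le
      · rw [indicator_of_mem (by simpa using h.2)]
        exact ENNReal.rpow_le_rpow (hσM _) (by positivity)
    · rw [indicator_of_notMem ht, nonpos_iff_eq_zero]
      have : ∀ y, σ (t, y) ^ (1 / x) = 0 := by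
        intro y
        rcases hσ0 (t, y) with h | h
        · rw [h, ENNReal.zero_rpow_of_pos (by positivity)]
        · exact absurd (abs_le.1 h.1) ht
      simp only [hI, this, lintegral_zero]
  have hItop : ∀ t, I t ≠ ∞ := by
    intro t
    refine ne_top_of_le_ne_top hBtop ((hIB t).trans (indicator_le_self' (by simp) _))
  refine ⟨fun w => if I w.1 = 0 then 0 else σ w ^ (1 / x - 1) * I w.1 ^ (x / z - 1),
    ?_, ?_, ?_, ?_, ?_, ?_⟩
  · refine Measurable.ite ((hIm.comp measurable_fst) (measurableSet_singleton 0))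
      measurable_const ?_
    exact (hσ.pow_const _).mul ((hIm.comp measurable_fst).pow_const _)
  · intro w
    dsimp only
    split_ifs with h
    · exact ENNReal.zero_ne_top
    · refine ENNReal.mul_ne_top (ENNReal.rpow_ne_top_of_nonneg hp.le
        (ne_top_of_le_ne_top ENNReal.ofReal_ne_top (hσM w))) ?_
      exact ENNReal.rpow_ne_top_of_ne_zero h (hItop _)
  · intro w hw
    refine hsupp w fun h => hw ?_
    simp only [h, ENNReal.zero_rpow_of_pos hp, zero_mul, ite_self]
  · rw [Measure.volume_eq_prod, lintegral_prod _ (by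
      refine (Measurable.mul (Measurable.ite ((hIm.comp measurable_fst)
        (measurableSet_singleton 0)) measurable_const ?_) hσ).aemeasurable
      exact (hσ.pow_const _).mul ((hIm.comp measurable_fst).pow_const _))]
    refine lintegral_congr fun t => ?_
    change _ = I t ^ (x / z)
    by_cases h : I t = 0
    · simp [h, ENNReal.zero_rpow_of_pos (div_pos hx0 hz0)]
    · simp only [h, if_false]
      have e : ∀ y, σ (t, y) ^ (1 / x - 1) * I t ^ (x / z - 1) * σ (t, y) =
          I t ^ (x / z - 1) * σ (t, y) ^ (1 / x) := by
        intro y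
        rw [mul_right_comm, mul_comm]
        congr 1
        conv_lhs => rw [← ENNReal.rpow_one (σ (t, y)), ← ENNReal.rpow_mul, one_mul,
          ← ENNReal.rpow_add_of_nonneg _ _ hp.le zero_le_one]
        ring_nf
      simp only [e]
      rw [lintegral_const_mul' _ _ (ENNReal.rpow_ne_top_of_ne_zero h (hItop _))]
      change _ * I t = _
      conv_lhs => rw [← ENNReal.rpow_one (I t), ← ENNReal.rpow_mul, one_mul,
        ← ENNReal.rpow_add _ _ h (hItop t)]
      ring_nf
  · refine lintegral_congr fun t => ?_
    change _ = I t ^ (x / z)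
    by_cases h : I t = 0
    · simp [h, ENNReal.zero_rpow_of_pos (div_pos hx0 hz0), ENNReal.zero_rpow_of_pos, hx1', hz1']
    · simp only [h, if_false]
      have e : ∀ y, (σ (t, y) ^ (1 / x - 1) * I t ^ (x / z - 1)) ^ (1 / (1 - x)) =
          I t ^ ((x / z - 1) / (1 - x)) * σ (t, y) ^ (1 / x) := by
        intro y
        rw [ENNReal.mul_rpow_of_nonneg _ _ (by positivity), ← ENNReal.rpow_mul,
          ← ENNReal.rpow_mul, mul_comm]
        congr 2 <;> field_simp
      simp only [e]
      rw [lintegral_const_mul' _ _ (ENNReal.rpow_ne_top_of_ne_zero h (hItop _))]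
      change (_ * I t) ^ _ = _
      conv_lhs => rw [← ENNReal.rpow_one (I t), ← ENNReal.rpow_mul, one_mul,
        ← ENNReal.rpow_add _ _ h (hItop t), ← ENNReal.rpow_mul]
      congr 1
      field_simp
      ring
  · refine ne_top_of_le_ne_top ?_ (lintegral_mono fun t =>
      ENNReal.rpow_le_rpow (hIB t) (div_pos hx0 hz0).le)
    have : ∀ t, ((Icc (-M) M).indicator (fun _ => B) t) ^ (x / z) =
        (Icc (-M) M).indicator (fun _ => B ^ (x / z)) t := by
      intro t
      by_cases ht : t ∈ Icc (-M) M
      · simp [ht]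
      · simp [ht, ENNReal.zero_rpow_of_pos (div_pos hx0 hz0)]
    simp only [this]
    rw [lintegral_indicator_const measurableSet_Icc, Real.volume_Icc]
    exact ENNReal.mul_ne_top (ENNReal.rpow_ne_top_of_nonneg (div_pos hx0 hz0).le hBtop)
      ENNReal.ofReal_ne_top

/-- A mixed-norm bound from its dual, linearized formulation. -/
theorem lintegral_lintegral_rpow_le_of_dual {x z : ℝ} (hx0 : 0 < x) (hx1 : x < 1) (hz0 : 0 < z)
    (hz1 : z < 1) {ρ : ℝ × Rn n → ℝ≥0∞} (hρ : Measurable ρ) {D : ℝ} (hD : 0 < D) {Λ : ℝ≥0∞}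
    (h : ∀ (V : ℝ × Rn n → ℝ≥0∞) (M : ℝ), Measurable V → (∀ w, V w ≠ ∞) →
      (∀ w, V w ≠ 0 → |w.1| ≤ M ∧ ‖w.2‖ ≤ M) →
      ENNReal.ofReal (2 * D) * ∫⁻ w, V w * ρ w ≤ ENNReal.ofReal D *
        (Λ + ∫⁻ t, (∫⁻ y, V (t, y) ^ (1 / (1 - x))) ^ ((1 - x) / (1 - z)))) :
    ∫⁻ t, (∫⁻ y, ρ (t, y) ^ (1 / x)) ^ (x / z) ≤ Λ := by
  let S : ℕ → Set (ℝ × Rn n) := fun N => {w | |w.1| ≤ (N : ℝ) ∧ ‖w.2‖ ≤ (N : ℝ)}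
  have hS : ∀ N, MeasurableSet (S N) := fun N =>
    (measurableSet_le (f := fun w : ℝ × Rn n => |w.1|) (by fun_prop) measurable_const).inter
      (measurableSet_le (f := fun w : ℝ × Rn n => ‖w.2‖) (by fun_prop) measurable_const)
  let σ : ℕ → ℝ × Rn n → ℝ≥0∞ := fun N => (S N).indicator fun w => min (ρ w) (N : ℝ≥0∞)
  have hσm : ∀ N, Measurable (σ N) := fun N => (hρ.min measurable_const).indicator (hS N)
  have hσle : ∀ N w, σ N w ≤ ρ w := fun N w =>
    (indicator_le_self' (by simp) w).trans (min_le_left _ _)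
  refine lintegral_lintegral_rpow_le_of_tendsto (ρ := σ) (by positivity) (div_pos hx0 hz0) hσm
    ?_ ?_ fun N => ?_
  · intro w N N' hN
    have hN' : (N : ℝ) ≤ N' := by exact_mod_cast hN
    by_cases hw : w ∈ S N
    · have hw' : w ∈ S N' := ⟨hw.1.trans hN', hw.2.trans hN'⟩
      simp only [σ, indicator_of_mem hw, indicator_of_mem hw']
      exact min_le_min le_rfl (by exact_mod_cast hN)
    · simp only [σ, indicator_of_notMem hw, zero_le]
  · intro w
    have h1 : Filter.Tendsto (fun N : ℕ => min (ρ w) (N : ℝ≥0∞)) Filter.atTop (nhds (ρ w)) := by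
      simpa using (tendsto_const_nhds (x := ρ w)).min ENNReal.tendsto_nat_nhds_top
    refine h1.congr' ?_
    obtain ⟨N₀, hN₀⟩ := exists_nat_ge (max |w.1| ‖w.2‖)
    filter_upwards [Filter.eventually_ge_atTop N₀] with N hN
    have hN' : (N₀ : ℝ) ≤ N := by exact_mod_cast hN
    have hw : w ∈ S N := ⟨(le_max_left _ _).trans (hN₀.trans hN'),
      (le_max_right _ _).trans (hN₀.trans hN')⟩
    simp only [σ, indicator_of_mem hw]
  · obtain ⟨V, hV, hVtop, hVs, e1, e2, e3⟩ := exists_dual_weight hx0 hx1 hz0 hz1 (hσm N) (M := N)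
      (fun w => (indicator_le_self' (by simp) w).trans ((min_le_right _ _).trans (by simp)))
      (fun w hw => by
        by_contra hc
        exact hw (indicator_of_notMem (s := S N) hc _))
    have h1 := h V N hV hVtop hVs
    rw [e2] at h1
    have h2 := (mul_le_mul' le_rfl (e1.symm.le.trans
      (lintegral_mono fun w => mul_le_mul' le_rfl (hσle N w)))).trans h1
    set Y := ∫⁻ t, (∫⁻ y, σ N (t, y) ^ (1 / x)) ^ (x / z)
    rw [ENNReal.ofReal_mul zero_le_two, mul_comm (ENNReal.ofReal 2), mul_assoc,
      ENNReal.mul_le_mul_iff_right (ENNReal.ofReal_pos.2 hD).ne' ENNReal.ofReal_ne_top] at h2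
    rw [ENNReal.ofReal_ofNat, two_mul] at h2
    exact (ENNReal.add_le_add_iff_right e3).1 h2

end duality

section density_bound

variable {n : ℕ}

theorem measurable_enorm_schrodinger (f : Rn n → ℂ) :
    Measurable fun w : ℝ × Rn n => ‖schrodinger f w.1 w.2‖ₑ := by
  by_cases hf : Integrable (FT f)
  · simp only [schrodinger_eq, enorm_mul]
    exact (measurable_enorm_integral_planeWave hf).const_mul _
  · simp only [schrodinger_eq_zero hf, enorm_zero, measurable_const]

/-- The density bound for finite systems, in terms of nonnegative coefficients. -/
theorem lintegral_lintegral_sum_rpow_le (hn : 2 ≤ n) {x z s : ℝ} (hx0 : 0 < x) (hx1 : x < 1)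
    (hz0 : 0 < z) (hz : z < 1) (hxz : n * x < (n - 1) * z) (hxz2 : 2 * z + n * x < n)
    (hs : 2 * s = n - 2 * z - n * x) :
    ∃ C : ℝ, 0 < C ∧ ∀ (f : ℕ → Rn n → ℂ) (lam : ℕ → ℝ≥0∞), OrthonormalHs s f →
      (∀ j, lam j ≠ ∞) → ∀ N : ℕ,
      ∫⁻ t, (∫⁻ y, (∑ j ∈ Finset.range N, lam j * ‖schrodinger (f j) t y‖ₑ ^ 2) ^ (1 / x)) ^ (x / z)
        ≤ ENNReal.ofReal C * ∑ j ∈ Finset.range N, lam j ^ (1 / z) := by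
  have hs0 : 0 ≤ s := by linarith
  obtain ⟨ε, C, hε, hC, hmain⟩ := sum_lintegral_mul_le hn hx0 hz0 hz hxz hxz2
  obtain ⟨C0, hC0, hwave⟩ := enorm_integral_planeWave_sq_le (n := n) (by omega) hs0
    (c := (2 * π) ^ (-(n : ℝ) / 2)) (by positivity) hε
  set κ : ℝ := (2 * π) ^ (-(n : ℝ)) with hκ
  have hκpos : 0 < κ := by positivity
  set D : ℝ := κ ^ 2 * C0 * C with hD
  have hDpos : 0 < D := by positivity
  refine ⟨(2 * D) ^ (1 / z), by positivity, fun f lam hf hlam N => ?_⟩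
  obtain ⟨H, hH, hH1, hHsum⟩ := hf.exists_Lp
  have hsum : ∀ w : ℝ × Rn n, ∑ j ∈ Finset.range N, lam j * ‖schrodinger (f j) w.1 w.2‖ₑ ^ 2 =
      ∑ j : Fin N, lam j * ‖schrodinger (f j) w.1 w.2‖ₑ ^ 2 := fun w =>
    (Fin.sum_univ_eq_sum_range (fun j => lam j * ‖schrodinger (f j) w.1 w.2‖ₑ ^ 2) N).symm
  have hWm : ∀ j, Measurable fun w : ℝ × Rn n => ‖schrodinger (f j) w.1 w.2‖ₑ ^ 2 := fun j =>
    (measurable_enorm_schrodinger (f j)).pow_const 2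
  refine lintegral_lintegral_rpow_le_of_dual (n := n)
    (ρ := fun w => ∑ j ∈ Finset.range N, lam j * ‖schrodinger (f j) w.1 w.2‖ₑ ^ 2)
    hx0 hx1 hz0 hz (Finset.measurable_fun_sum _ fun j _ => (hWm j).const_mul _) hDpos ?_
  intro V M hV hVtop hVs
  have hW : ∀ (j : Fin N) (w : ℝ × Rn n) (m : ℤ), ‖schrodinger (f j) w.1 w.2‖ₑ ^ 2 ≤
      ENNReal.ofReal (κ ^ 2 * C0) * ∑' k : ℤ, dy (ε * |(k : ℝ) + m|) *
        (dy (-(k * (n - 2 * z - n * x))) *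
          ‖(inner ℂ (dyWave k w) (shellOp hs0 k (H j)) : ℂ)‖ₑ ^ 2) := by
    intro j w m
    by_cases hj : Integrable (FT (f j))
    · rw [schrodinger_eq, enorm_mul, mul_pow, ← ofReal_norm (((_ : ℝ) : ℂ)), Complex.norm_real,
        Real.norm_of_nonneg hκpos.le, ← ENNReal.ofReal_pow hκpos.le,
        ENNReal.ofReal_mul (by positivity), mul_assoc]
      refine mul_le_mul' le_rfl ?_
      have := hwave _ _ hj (hH j hj) w m
      rwa [hs] at this
    · rw [schrodinger_eq_zero hj]
      simp
  have key := hmain (ι := Fin N) (fun j => ENNReal.ofReal (2 * D) * lam j)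
    (fun j w => ‖schrodinger (f j) w.1 w.2‖ₑ ^ 2) (fun k j => shellOp hs0 k (H j)) V
    (ENNReal.ofReal (κ ^ 2 * C0)) M
    (fun j => ENNReal.mul_ne_top ENNReal.ofReal_ne_top (hlam j)) (fun j => hWm j) hV hVtop hVs
    (fun k c => by
      simp only [← map_smul, ← map_sum]
      refine le_trans ?_ (hHsum N c)
      exact pow_le_pow_left₀ (norm_nonneg _) (norm_shellOp_le hs0 k _) 2)
    (fun j => (tsum_norm_shellOp_sq_le hs0 (H j)).trans (by
      rw [ENNReal.ofReal_le_one]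
      exact pow_le_one₀ (norm_nonneg _) (hH1 j))) hW
  rw [← ENNReal.ofReal_mul (by positivity), ← hD] at key
  convert key using 1
  · simp only [hsum, Finset.mul_sum, mul_assoc]
    have hVm : ∀ j ∈ (Finset.univ : Finset (Fin N)), Measurable fun w : ℝ × Rn n =>
        V w * (lam j * ‖schrodinger (f j) w.1 w.2‖ₑ ^ 2) := fun j _ =>
      hV.mul ((hWm j).const_mul _)
    rw [lintegral_finsetSum _ hVm, Finset.mul_sum]
    refine Finset.sum_congr rfl fun j _ => ?_
    congr 1
    rw [← lintegral_const_mul' _ _ (hlam j)]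
    exact lintegral_congr fun w => by ring
  · congr 2
    rw [Finset.mul_sum, ← Fin.sum_univ_eq_sum_range (fun j => _ * lam j ^ (1 / z))]
    refine Finset.sum_congr rfl fun j _ => ?_
    rw [ENNReal.mul_rpow_of_nonneg _ _ (by positivity),
      ENNReal.ofReal_rpow_of_nonneg (by positivity) (by positivity)]

theorem enorm_density_le (lam : ℕ → ℝ) (f : ℕ → Rn n → ℂ) (t : ℝ) (y : Rn n) :
    ‖density lam f t y‖ₑ ≤ ∑' j, ENNReal.ofReal |lam j| * ‖schrodinger (f j) t y‖ₑ ^ 2 := by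
  refine enorm_tsum_le_tsum_enorm.trans (le_of_eq (tsum_congr fun j => ?_))
  rw [enorm_mul, enorm_pow, enorm_norm, Real.enorm_eq_ofReal_abs]

end density_bound

end OS

open OS
/-- Strong-type orthonormal Strichartz estimates at the critical
summability exponent `α = q` in the interior of `OCDA`, with data orthonormal in
`Ḣ^s(ℝⁿ)`, `2s = n - (2/q + n/p)`. -/
theorem critical_strong_type (n : ℕ) (hn : 2 ≤ n) (p q s : ℝ)
    (hpq : IntOCDA n (1 / p) (1 / q))
    (hs : 2 * s = n - (2 / q + n / p)) :
    ∃ C : ℝ, 0 < C ∧ ∀ (f : ℕ → Rn n → ℂ) (lam : ℕ → ℝ),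
      OrthonormalHs s f → seqNormE (ENNReal.ofReal q) lam ≠ ∞ →
      mixedLp (ENNReal.ofReal q) (ENNReal.ofReal p) (density lam f)
        ≤ ENNReal.ofReal C * seqNormE (ENNReal.ofReal q) lam := by
  obtain ⟨⟨hx0, hx1⟩, ⟨hz0, hz1⟩, h1, h2⟩ := hpq
  have hp : 0 < p := one_div_pos.1 hx0
  have hq : 0 < q := one_div_pos.1 hz0
  have hn1 : (0 : ℝ) < n - 1 := by
    have : (2 : ℝ) ≤ n := by exact_mod_cast hn
    linarith
  rw [div_mul_eq_mul_div, div_lt_iff₀ hn1, mul_comm (1 / q)] at h1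
  obtain ⟨C, hC, hbd⟩ := lintegral_lintegral_sum_rpow_le hn hx0 hx1 hz0 hz1 h1 h2
    (s := s) (by rw [hs]; ring)
  refine ⟨C ^ (1 / q), by positivity, fun f lam hf _ => ?_⟩
  have hWm : ∀ j, Measurable fun w : ℝ × Rn n => ‖schrodinger (f j) w.1 w.2‖ₑ ^ 2 := fun j =>
    (measurable_enorm_schrodinger (f j)).pow_const 2
  have hall : ∫⁻ t, (∫⁻ y, (∑' j, ENNReal.ofReal |lam j| * ‖schrodinger (f j) t y‖ₑ ^ 2) ^
      (1 / (1 / p))) ^ (1 / p / (1 / q)) ≤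
      ENNReal.ofReal C * ∑' j, ENNReal.ofReal |lam j| ^ q := by
    refine lintegral_lintegral_rpow_le_of_tendsto (n := n) (by positivity) (by positivity)
      (ρ := fun N w => ∑ j ∈ Finset.range N, ENNReal.ofReal |lam j| *
        ‖schrodinger (f j) w.1 w.2‖ₑ ^ 2)
      (σ := fun w => ∑' j, ENNReal.ofReal |lam j| * ‖schrodinger (f j) w.1 w.2‖ₑ ^ 2)
      (fun N => Finset.measurable_fun_sum _ fun j _ => (hWm j).const_mul _)
      (fun w N N' h => Finset.sum_le_sum_of_subset (Finset.range_mono h))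
      (fun w => ENNReal.tendsto_nat_tsum _) fun N => ?_
    refine (hbd f (fun j => ENNReal.ofReal |lam j|) hf (fun _ => ENNReal.ofReal_ne_top) N).trans ?_
    rw [one_div_one_div]
    exact mul_le_mul' le_rfl (ENNReal.sum_le_tsum _)
  have hp' : ENNReal.ofReal p ≠ 0 := (ENNReal.ofReal_pos.2 hp).ne'
  rw [mixedLp, eLp, if_neg ENNReal.ofReal_ne_top, seqNormE, if_neg ENNReal.ofReal_ne_top,
    ENNReal.toReal_ofReal hq.le, ← ENNReal.ofReal_rpow_of_nonneg hC.le (by positivity),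
    ← ENNReal.mul_rpow_of_nonneg _ _ (by positivity)]
  refine ENNReal.rpow_le_rpow (le_trans (lintegral_mono fun t => ?_) hall) (by positivity)
  simp only
  rw [eLpNorm_eq_lintegral_rpow_enorm_toReal hp' ENNReal.ofReal_ne_top, ENNReal.toReal_ofReal hp.le,
    ← ENNReal.rpow_mul, one_div_one_div, show 1 / p * q = 1 / p / (1 / q) by field_simp]
  refine ENNReal.rpow_le_rpow (lintegral_mono fun y => ?_) (by positivity)
  exact ENNReal.rpow_le_rpow (enorm_density_le lam f t y) hp.le
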